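/- Let n ∈ ℕ, E a complex Banach space, s ∈ ℝ, 0 < p < ∞, 0 < q ≤ ∞, a > n/min(p,q), and let S ∈ ℤ with S ≥ −1 and S ≥ ⌊s⌋. Let ε > 0 and Ψ, ψ ∈ S(ℝ^n) satisfy |Ψ(x)| > 0 for |x| < 2ε, |ψ(x)| > 0 for ε/2 < |x| < 2ε, and D^α ψ(0) = 0 for all multi-indices |α| ≤ S. Then there exist constants c₁, c₂ > 0 such that for all f ∈ F^s_{p,q}(E): c₁ ‖f|F^s_{p,q}(E)‖ ≤ ‖(Ψ*f)_a|L_p‖ + ‖ (Σ_{j≥1} 2^{jsq} ((ψ_j^* f)_a)^q)^{1/q} |L_p‖ ≤ c₂ ‖f|F^s_{p,q}(E)‖ (supremum over j if q = ∞). Moreover, an f ∈ S'(ℝ^n,E) belongs to F^s_{p,q}(E) if and only if ‖(Ψ*f)_a|L_p‖ + ‖ (Σ_{j≥1} 2^{jsq} ((ψ_j^* f)_a)^q)^{1/q} |L_p‖ < ∞. -/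

import Mathlib

noncomputable section

open MeasureTheory Filter Metric Real Set SchwartzMap
open scoped ENNReal NNReal Topology FourierTransform

/-- Euclidean space ℝⁿ. -/
abbrev Rn (n : ℕ) : Type := EuclideanSpace ℝ (Fin n)

/-- The Schwartz space 𝓢(ℝⁿ, ℂ). -/
abbrev Sch (n : ℕ) : Type := SchwartzMap (Rn n) ℂ

/-- Partial derivative in the `i`-th coordinate direction. -/
def pd {F : Type*} [NormedAddCommGroup F] [NormedSpace ℝ F] {n : ℕ} (i : Fin n)
    (g : Rn n → F) : Rn n → F :=
  fun x => lineDeriv ℝ g x (EuclideanSpace.single i (1 : ℝ))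

/-- Multi-index derivative `D^α = ∂₁^{α₁} ⋯ ∂ₙ^{αₙ}`. -/
def mderiv {F : Type*} [NormedAddCommGroup F] [NormedSpace ℝ F] {n : ℕ} (α : Fin n → ℕ)
    (g : Rn n → F) : Rn n → F :=
  (List.finRange n).foldr (fun i h => (pd i)^[α i] h) g

/-- The order `|α|` of a multi-index. -/
def mdeg {n : ℕ} (α : Fin n → ℕ) : ℕ := ∑ i, α i

/-- The Schwartz seminorm `‖φ‖_{K,L} = sup_x (1+|x|²)^{K/2} ∑_{|α| ≤ L} |D^α φ(x)|`. -/
def schSemi {n : ℕ} (K L : ℕ) (φ : Sch n) : ℝ :=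
  ⨆ x : Rn n, (1 + ‖x‖ ^ 2) ^ ((K : ℝ) / 2) *
    ∑ α : Fin n → Fin (L + 1), if mdeg (fun i => (α i : ℕ)) ≤ L
      then ‖mderiv (fun i => (α i : ℕ)) (fun y => φ y) x‖ else 0

/-- `E`-valued tempered distributions: linear maps `𝓢(ℝⁿ) → E` bounded by some
Schwartz seminorm. -/
structure TDist (n : ℕ) (E : Type*) [NormedAddCommGroup E] [NormedSpace ℂ E] where
  toFun : Sch n →ₗ[ℂ] E
  bound : ∃ (c : ℝ) (K L : ℕ), ∀ φ : Sch n, ‖toFun φ‖ ≤ c * schSemi K L φ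

namespace Aux

lemma hasTemperateGrowth_sub_left {n : ℕ} (x : Rn n) :
    Function.HasTemperateGrowth (fun y : Rn n => x - y) := by
  apply Function.HasTemperateGrowth.of_fderiv (k := 1) (C := ‖x‖ + 1)
  · have h : (fderiv ℝ (fun y : Rn n => x - y)) =
        fun _ : Rn n => -(ContinuousLinearMap.id ℝ (Rn n)) := by
      ext1 y
      rw [fderiv_const_sub]
      simp
    rw [h]
    exact .const _
  · exact (differentiable_const x).sub differentiable_id
  · intro y
    have h1 : ‖x - y‖ ≤ ‖x‖ + ‖y‖ := norm_sub_le x y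
    have h2 : (0:ℝ) ≤ ‖y‖ := norm_nonneg y
    have h3 : (0:ℝ) ≤ ‖x‖ := norm_nonneg x
    calc ‖x - y‖ ≤ ‖x‖ + ‖y‖ := h1
      _ ≤ (‖x‖ + 1) * (1 + ‖y‖) ^ 1 := by nlinarith

lemma antilipschitz_sub_left {n : ℕ} (x : Rn n) :
    AntilipschitzWith 1 (fun y : Rn n => x - y) := by
  refine (Isometry.antilipschitz ?_)
  intro y z
  simp only [edist_dist, dist_eq_norm, sub_sub_sub_cancel_left, norm_sub_rev]

end Aux

/-- The Schwartz function `y ↦ ψ(x - y)`. -/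
def shiftReflect {n : ℕ} (ψ : Sch n) (x : Rn n) : Sch n :=
  SchwartzMap.compCLMOfAntilipschitz (𝕜 := ℝ)
    (Aux.hasTemperateGrowth_sub_left x) (Aux.antilipschitz_sub_left x) ψ

/-- The dilated Schwartz function `ψ(t ·)` (junk value `0` when `t = 0`). -/
def dilate {n : ℕ} (ψ : Sch n) (t : ℝ) : Sch n :=
  if h : t = 0 then 0 else
    SchwartzMap.compCLM (𝕜 := ℝ) (g := fun y : Rn n => t • y)
      (by
        have := (t • ContinuousLinearMap.id ℝ (Rn n)).hasTemperateGrowth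
        exact this)
      (⟨1, |t|⁻¹, fun y => by
        have ht : 0 < |t| := abs_pos.mpr h
        have : ‖t • y‖ = |t| * ‖y‖ := by rw [norm_smul]; simp [Real.norm_eq_abs]
        rw [pow_one, this]
        rw [mul_add, mul_one]
        have : |t|⁻¹ * (|t| * ‖y‖) = ‖y‖ := by field_simp
        nlinarith [norm_nonneg y, inv_pos.mpr ht]⟩) ψ

/-- Fourier transform on Schwartz space. -/
def fourierS {n : ℕ} (φ : Sch n) : Sch n := FourierTransform.fourierCLE ℂ (Sch n) φ

/-- Inverse Fourier transform on Schwartz space. -/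
def invFourierS {n : ℕ} (φ : Sch n) : Sch n := (FourierTransform.fourierCLE ℂ (Sch n)).symm φ

variable {n : ℕ} {E : Type*} [NormedAddCommGroup E] [NormedSpace ℂ E]

/-- Convolution `(ψ * f)(x) := (2π)^{-n/2} f(ψ(x - ·))` of a Schwartz function with an
`E`-valued tempered distribution. -/
def tdConv (ψ : Sch n) (f : TDist n E) : Rn n → E :=
  fun x => ((2 * π) ^ (-(n : ℝ) / 2) : ℝ) • f.toFun (shiftReflect ψ x)

/-- The operator `f ↦ (φ f̂)ˇ = φ̌ * f`. -/
def mOp (φ : Sch n) (f : TDist n E) : Rn n → E := tdConv (invFourierS φ) f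

/-- `L_p`-norm (in `[0,∞]`) of an `ℝ≥0∞`-valued function. -/
def lpNormENN {n : ℕ} (p : ℝ≥0∞) (g : Rn n → ℝ≥0∞) : ℝ≥0∞ :=
  if p = ∞ then essSup g volume else (∫⁻ x, (g x) ^ p.toReal) ^ (1 / p.toReal)

/-- `ℓ_q`-norm (in `[0,∞]`) of a sequence, with the usual modification for `q = ∞`. -/
def lqSum (q : ℝ≥0∞) (a : ℕ → ℝ≥0∞) : ℝ≥0∞ :=
  if q = ∞ then ⨆ j, a j else (∑' j, (a j) ^ q.toReal) ^ (1 / q.toReal)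

/-- A smooth dyadic resolution of unity. -/
structure SmoothResolution (n : ℕ) (φ : ℕ → Sch n) : Prop where
  supp0 : Function.support (φ 0) ⊆ {ξ : Rn n | ‖ξ‖ ≤ 2}
  suppj : ∀ j : ℕ, 0 < j →
    Function.support (φ j) ⊆ {ξ : Rn n | 2 ^ ((j : ℝ) - 1) ≤ ‖ξ‖ ∧ ‖ξ‖ ≤ 2 ^ ((j : ℝ) + 1)}
  sum_eq : ∀ ξ : Rn n, ∑' j : ℕ, φ j ξ = 1
  deriv_bound : ∀ α : Fin n → ℕ, ∃ c : ℝ, ∀ (j : ℕ) (ξ : Rn n),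
    ‖mderiv α (fun y => φ j y) ξ‖ ≤ c * 2 ^ (-(j : ℝ) * (mdeg α : ℝ))

/-- The Besov quasi-norm `‖f | B^s_{p,q}(E)‖` w.r.t. the resolution of unity `φ`. -/
def besovNorm (s : ℝ) (p q : ℝ≥0∞) (φ : ℕ → Sch n) (f : TDist n E) : ℝ≥0∞ :=
  lqSum q fun j => (2 : ℝ≥0∞) ^ ((j : ℝ) * s) * eLpNorm (mOp (φ j) f) p volume

/-- The Triebel–Lizorkin quasi-norm `‖f | F^s_{p,q}(E)‖` w.r.t. the resolution of unity `φ`. -/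
def triebelNorm (s : ℝ) (p q : ℝ≥0∞) (φ : ℕ → Sch n) (f : TDist n E) : ℝ≥0∞ :=
  lpNormENN p fun x =>
    lqSum q fun j => (2 : ℝ≥0∞) ^ ((j : ℝ) * s) * (‖mOp (φ j) f x‖₊ : ℝ≥0∞)

variable {n : ℕ} {E : Type*} [NormedAddCommGroup E] [NormedSpace ℂ E]

/-- Peetre maximal function `sup_y ‖g(x-y)‖/(1+t|y|)^a`. -/
def peetreMax (a t : ℝ) (g : Rn n → E) : Rn n → ℝ≥0∞ :=
  fun x => ⨆ y : Rn n, (‖g (x - y)‖₊ : ℝ≥0∞) / ENNReal.ofReal ((1 + t * ‖y‖) ^ a)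

/-- `‖(Ψ^*f)_a|L_p‖ + (∑_{j≥1} 2^{jsq} ‖(ψ_j^*f)_a|L_p‖^q)^{1/q}`. -/
def besovPeetreNorm (s : ℝ) (p q : ℝ≥0∞) (a : ℝ) (Ψ ψ : Sch n) (f : TDist n E) : ℝ≥0∞ :=
  lpNormENN p (peetreMax a 1 (mOp Ψ f)) +
    lqSum q fun j => (2 : ℝ≥0∞) ^ (((j : ℝ) + 1) * s) *
      lpNormENN p (peetreMax a ((2 : ℝ) ^ ((j : ℝ) + 1))
        (mOp (dilate ψ ((2 : ℝ) ^ (-((j : ℝ) + 1)))) f))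

/-- `‖(Ψ^*f)_a|L_p‖ + ‖(∑_{j≥1} 2^{jsq} ((ψ_j^*f)_a)^q)^{1/q}|L_p‖`. -/
def triebelPeetreNorm (s : ℝ) (p q : ℝ≥0∞) (a : ℝ) (Ψ ψ : Sch n) (f : TDist n E) : ℝ≥0∞ :=
  lpNormENN p (peetreMax a 1 (mOp Ψ f)) +
    lpNormENN p fun x => lqSum q fun j => (2 : ℝ≥0∞) ^ (((j : ℝ) + 1) * s) *
      peetreMax a ((2 : ℝ) ^ ((j : ℝ) + 1))
        (mOp (dilate ψ ((2 : ℝ) ^ (-((j : ℝ) + 1)))) f) x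


end

noncomputable section
open MeasureTheory Filter Metric Real Set SchwartzMap
open scoped ENNReal NNReal Topology FourierTransform
namespace Sub
open LineDeriv

/-- product of Schwartz functions -/
def mulS {n : ℕ} (m B : Sch n) : Sch n := SchwartzMap.pairing (ContinuousLinearMap.mul ℂ ℂ) m B

@[simp] lemma mulS_apply {n : ℕ} (m B : Sch n) (x : Rn n) : mulS m B x = m x * B x := by
  simp [mulS]

@[simp] lemma shiftReflect_apply {n : ℕ} (ψ : Sch n) (x y : Rn n) :
    shiftReflect ψ x y = ψ (x - y) := rfl

lemma dilate_apply {n : ℕ} (ψ : Sch n) {t : ℝ} (ht : t ≠ 0) (x : Rn n) :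
    dilate ψ t x = ψ (t • x) := by
  unfold dilate
  rw [dif_neg ht]; rfl

lemma invFourierS_eq {n : ℕ} (φ : Sch n) : invFourierS φ = 𝓕⁻ φ := rfl

/-- iterated partial derivative along a word -/
def wD {n : ℕ} : List (Fin n) → Sch n → Sch n
  | [], φ => φ
  | i :: l, φ => ∂_{(EuclideanSpace.single i (1:ℝ) : Rn n)} (wD l φ)

lemma wD_append {n : ℕ} (l l' : List (Fin n)) (φ : Sch n) : wD (l ++ l') φ = wD l (wD l' φ) := by
  induction l with
  | nil => rfl
  | cons i l ih => simp [wD, ih]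

lemma pd_eq {n : ℕ} (i : Fin n) (φ : Sch n) :
    pd i (fun y => φ y) = fun y => wD [i] φ y := by
  funext y
  simp only [pd, wD]
  exact (SchwartzMap.lineDerivOp_apply _ _ _).symm

lemma pd_iter {n : ℕ} (i : Fin n) (k : ℕ) (φ : Sch n) :
    (pd i)^[k] (fun y => φ y) = fun y => wD (List.replicate k i) φ y := by
  induction k with
  | zero => rfl
  | succ k ih =>
    rw [Function.iterate_succ_apply', ih, pd_eq]
    rfl

def word {n : ℕ} (α : Fin n → ℕ) : List (Fin n) :=
  (List.finRange n).flatMap (fun i => List.replicate (α i) i)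

lemma mderiv_eq {n : ℕ} (α : Fin n → ℕ) (φ : Sch n) :
    mderiv α (fun y => φ y) = fun y => wD (word α) φ y := by
  unfold mderiv word
  generalize List.finRange n = L
  induction L with
  | nil => rfl
  | cons i L ih =>
    rw [List.foldr_cons, ih, List.flatMap_cons, wD_append, pd_iter]

lemma wD_add {n : ℕ} (l : List (Fin n)) (φ φ' : Sch n) : wD l (φ + φ') = wD l φ + wD l φ' := by
  induction l with
  | nil => rfl
  | cons i l ih => simp [wD, ih, lineDerivOp_add]

lemma wD_smul {n : ℕ} (l : List (Fin n)) (c : ℂ) (φ : Sch n) : wD l (c • φ) = c • wD l φ := by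
  induction l with
  | nil => rfl
  | cons i l ih => simp [wD, ih, lineDerivOp_smul]

lemma wD_cont {n : ℕ} (l : List (Fin n)) : Continuous (wD l : Sch n → Sch n) := by
  induction l with
  | nil => exact continuous_id
  | cons i l ih => exact (LineDeriv.continuous_lineDerivOp (E := Sch n) (F := Sch n) (EuclideanSpace.single i (1:ℝ) : Rn n)).comp ih

def wDL {n : ℕ} (l : List (Fin n)) : Sch n →L[ℂ] Sch n where
  toFun := wD l
  map_add' := wD_add l
  map_smul' := wD_smul l
  cont := wD_cont l

/-- Derivatives of reflected shifts. -/
lemma wD_shift {n : ℕ} (l : List (Fin n)) (φ : Sch n) (x y : Rn n) :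
    wD l (shiftReflect φ x) y = (-1 : ℂ) ^ l.length * wD l φ (x - y) := by
  induction l generalizing y with
  | nil => simp [wD]
  | cons i l ih =>
    simp only [wD]
    rw [lineDerivOp_apply_eq_fderiv, lineDerivOp_apply_eq_fderiv]
    have h1 : (⇑(wD l (shiftReflect φ x))) = fun y => (-1 : ℂ) ^ l.length * wD l φ (x - y) :=
      funext ih
    rw [h1]
    have hd : HasFDerivAt (fun y => (-1 : ℂ) ^ l.length * wD l φ (x - y))
        ((-1 : ℂ) ^ l.length • (((fderiv ℝ (wD l φ) (x - y)).comp
          (-(ContinuousLinearMap.id ℝ (Rn n)))))) y := by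
      apply HasFDerivAt.const_mul
      apply HasFDerivAt.comp y ((wD l φ).hasFDerivAt (x - y))
      exact (hasFDerivAt_id y).const_sub x
    rw [hd.fderiv]
    simp [pow_succ]

lemma wD_fourierInv {n : ℕ} (l : List (Fin n)) (m B : Sch n) :
    ∃ B' : Sch n, wD l (𝓕⁻ B) = 𝓕⁻ B' ∧ wD l (𝓕⁻ (mulS m B)) = 𝓕⁻ (mulS m B') := by
  induction l with
  | nil => exact ⟨B, rfl, rfl⟩
  | cons i l ih =>
    obtain ⟨B', h1, h2⟩ := ih
    refine ⟨(2 * π * Complex.I) • smulLeftCLM ℂ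
      (inner ℝ · (EuclideanSpace.single i (1:ℝ) : Rn n)) B', ?_, ?_⟩
    · simp only [wD]; rw [h1, lineDerivOp_fourierInv_eq]
    · simp only [wD]; rw [h2, lineDerivOp_fourierInv_eq]
      congr 1
      have ht : (inner ℝ · (EuclideanSpace.single i (1:ℝ) : Rn n)).HasTemperateGrowth := by fun_prop
      ext x
      simp only [_root_.smul_apply, mulS_apply, smulLeftCLM_apply_apply ht]
      simp only [smul_eq_mul, Complex.real_smul]
      ring

/-- the value formula for convolution -/
lemma fourierInv_mul {n : ℕ} (m B : Sch n) (x : Rn n) :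
    (𝓕⁻ (mulS m B) : Sch n) x = ∫ z, (𝓕⁻ m : Sch n) z * (𝓕⁻ B : Sch n) (x - z) := by
  have key : ∀ z : Rn n, (𝓕⁻ B : Sch n) (x - z) =
      𝓕 (fun ξ : Rn n => Real.fourierChar (inner ℝ ξ x) • B ξ) z := by
    intro z
    rw [SchwartzMap.fourierInv_coe, Real.fourierInv_eq, Real.fourier_eq]
    congr 1; funext ξ
    rw [← mul_smul, ← AddChar.map_add_eq_mul, inner_sub_right]
    congr 2; ring
  have hint : Integrable (fun ξ : Rn n => Real.fourierChar (inner ℝ ξ x) • B ξ) := by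
    refine (B.integrable (μ := volume)).norm.mono' ?_ (ae_of_all _ fun ξ => ?_)
    · apply Continuous.aestronglyMeasurable
      exact (by fun_prop : Continuous fun ξ : Rn n => Real.fourierChar (inner ℝ ξ x)).smul B.continuous
    · simp
  have h := VectorFourier.integral_bilin_fourierIntegral_eq_flip (L := innerₗ (Rn n))
    (μ := (volume : Measure (Rn n))) (ν := volume) (e := Real.fourierChar)
    (ContinuousLinearMap.mul ℂ ℂ)
    Real.continuous_fourierChar (by simpa using continuous_inner)
    ((𝓕⁻ m : Sch n).integrable (μ := volume)) hint
  simp only [flip_innerₗ, ContinuousLinearMap.mul_apply'] at h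
  simp only [key]
  have e1 : ∀ z, VectorFourier.fourierIntegral Real.fourierChar volume (innerₗ (Rn n))
      (fun ξ : Rn n => Real.fourierChar (inner ℝ ξ x) • B ξ) z = 
      𝓕 (fun ξ : Rn n => Real.fourierChar (inner ℝ ξ x) • B ξ) z := fun z => rfl
  simp only [e1] at h
  rw [← h]
  rw [SchwartzMap.fourierInv_coe, Real.fourierInv_eq]
  congr 1; funext ξ
  have e2 : VectorFourier.fourierIntegral Real.fourierChar volume (innerₗ (Rn n))
      (𝓕⁻ m : Sch n) ξ = m ξ := by
    have : (𝓕 (𝓕⁻ m : Sch n) : Sch n) = m := FourierTransform.fourier_fourierInv_eq m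
    have h3 := SchwartzMap.fourier_coe (𝓕⁻ m : Sch n)
    rw [this] at h3
    rw [h3]; rfl
  rw [e2]
  simp only [mulS_apply, Circle.smul_def, smul_eq_mul]
  ring

end Sub
end

noncomputable section
open MeasureTheory Filter Metric Real Set SchwartzMap
open scoped ENNReal NNReal Topology FourierTransform
namespace Sub
open LineDeriv

def wt {n : ℕ} (K : ℕ) (x : Rn n) : ℝ := (1 + ‖x‖ ^ 2) ^ ((K : ℝ) / 2)

lemma wt_nonneg {n : ℕ} (K : ℕ) (x : Rn n) : 0 ≤ wt K x := by unfold wt; positivity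

lemma wt_le {n : ℕ} (K : ℕ) (x : Rn n) : wt K x ≤ (1 + ‖x‖) ^ K := by
  unfold wt
  have h0 : 0 ≤ ‖x‖ := norm_nonneg x
  calc (1 + ‖x‖ ^ 2) ^ ((K : ℝ) / 2) ≤ ((1 + ‖x‖) ^ (2:ℝ)) ^ ((K : ℝ) / 2) := by
        apply Real.rpow_le_rpow (by positivity) _ (by positivity)
        rw [Real.rpow_two]; nlinarith
    _ = (1 + ‖x‖) ^ K := by
        rw [← Real.rpow_mul (by positivity)]
        rw [← Real.rpow_natCast]; congr 1; ring

def wtC {n : ℕ} (K : ℕ) (x : Rn n) : ℂ := (wt K x : ℝ)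

lemma wtC_temp {n : ℕ} (K : ℕ) : Function.HasTemperateGrowth (wtC K : Rn n → ℂ) := by
  have h1 := Function.hasTemperateGrowth_one_add_norm_sq_rpow (Rn n) ((K : ℝ) / 2)
  exact Function.Complex.hasTemperateGrowth_ofReal.comp h1

abbrev XX (n L : ℕ) := (Fin n → Fin (L+1)) → (BoundedContinuousFunction (Rn n) ℂ)

def iota (n K L : ℕ) : Sch n →L[ℂ] XX n L :=
  ContinuousLinearMap.pi fun α =>
    (SchwartzMap.toBoundedContinuousFunctionCLM ℂ (Rn n) ℂ) ∘L
      ((smulLeftCLM ℂ (wtC K)) ∘L wDL (word fun i => (α i : ℕ)))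

lemma iota_apply {n K L : ℕ} (φ : Sch n) (α : Fin n → Fin (L+1)) (x : Rn n) :
    iota n K L φ α x = wtC K x * wD (word fun i => (α i : ℕ)) φ x := by
  simp only [iota, ContinuousLinearMap.coe_pi', ContinuousLinearMap.comp_apply,
    toBoundedContinuousFunctionCLM_apply, smulLeftCLM_apply_apply (wtC_temp K)]
  rfl

lemma norm_iota_apply {n K L : ℕ} (φ : Sch n) (α : Fin n → Fin (L+1)) (x : Rn n) :
    ‖iota n K L φ α x‖ = wt K x * ‖wD (word fun i => (α i : ℕ)) φ x‖ := by
  rw [iota_apply, norm_mul, wtC, Complex.norm_real, Real.norm_of_nonneg (wt_nonneg K x)]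

lemma schSemi_le {n K L : ℕ} (φ : Sch n) :
    schSemi K L φ ≤ (Fintype.card (Fin n → Fin (L+1)) : ℝ) * ‖iota n K L φ‖ := by
  unfold schSemi
  apply ciSup_le
  intro x
  rw [Finset.mul_sum]
  calc _ ≤ ∑ α : Fin n → Fin (L+1), ‖iota n K L φ‖ := by
        apply Finset.sum_le_sum
        intro α _
        have h1 : ‖iota n K L φ α x‖ ≤ ‖iota n K L φ‖ :=
          ((iota n K L φ α).norm_coe_le_norm x).trans (norm_le_pi_norm _ α)
        rw [norm_iota_apply] at h1
        rw [mderiv_eq]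
        split_ifs
        · exact h1
        · simp
    _ = _ := by simp

lemma schSemi_nonneg {n K L : ℕ} (φ : Sch n) : 0 ≤ schSemi K L φ := by
  unfold schSemi
  apply Real.iSup_nonneg
  intro x
  apply mul_nonneg (by positivity)
  apply Finset.sum_nonneg
  intro α _
  split_ifs <;> positivity

lemma tdist_bound {n : ℕ} {E : Type*} [NormedAddCommGroup E] [NormedSpace ℂ E] (f : TDist n E) :
    ∃ (K L : ℕ) (C : ℝ), 0 ≤ C ∧ ∀ φ, ‖f.toFun φ‖ ≤ C * ‖iota n K L φ‖ := by
  obtain ⟨c, K, L, h⟩ := f.bound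
  refine ⟨K, L, |c| * (Fintype.card (Fin n → Fin (L+1)) : ℝ), by positivity, fun φ => ?_⟩
  calc _ ≤ c * schSemi K L φ := h φ
    _ ≤ |c| * schSemi K L φ := mul_le_mul_of_nonneg_right (le_abs_self c) (schSemi_nonneg φ)
    _ ≤ |c| * ((Fintype.card (Fin n → Fin (L+1)) : ℝ) * ‖iota n K L φ‖) :=
        mul_le_mul_of_nonneg_left (schSemi_le φ) (abs_nonneg c)
    _ = _ := by ring

lemma tdist_cont {n : ℕ} {E : Type*} [NormedAddCommGroup E] [NormedSpace ℂ E] (f : TDist n E) :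
    Continuous f.toFun := by
  obtain ⟨K, L, C, hC, h⟩ := tdist_bound f
  apply continuous_of_continuousAt_zero f.toFun
  rw [ContinuousAt, map_zero]
  apply squeeze_zero_norm h
  have : Continuous fun φ => C * ‖iota n K L φ‖ := by fun_prop
  simpa using this.tendsto 0

lemma decay_one {n : ℕ} {F : Type*} [NormedAddCommGroup F] [NormedSpace ℝ F]
    (g : SchwartzMap (Rn n) F) (K : ℕ) :
    ∃ C, 0 ≤ C ∧ ∀ x, (1 + ‖x‖) ^ K * ‖g x‖ ≤ C := by
  refine ⟨2 ^ K * ((Finset.Iic (K, 0)).sup (fun m => SchwartzMap.seminorm ℝ m.1 m.2) g),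
    by positivity, fun x => ?_⟩
  have := SchwartzMap.one_add_le_sup_seminorm_apply (𝕜 := ℝ) (m := (K, 0)) (k := K) (n := 0)
    le_rfl le_rfl g x
  simpa using this

lemma one_add_le {n : ℕ} (x z : Rn n) : 1 + ‖x‖ ≤ (1 + ‖z‖) * (1 + ‖z - x‖) := by
  have h : ‖x‖ ≤ ‖z‖ + ‖z - x‖ := by
    have := norm_sub_le z (z - x); simpa using this
  nlinarith [norm_nonneg z, norm_nonneg (z - x)]

lemma growth_one {n : ℕ} (g : Sch n) (K : ℕ) :
    ∃ C, 0 ≤ C ∧ ∀ z x : Rn n, wt K x * ‖g (z - x)‖ ≤ C * (1 + ‖z‖) ^ K := by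
  obtain ⟨C, hC, h⟩ := decay_one g K
  refine ⟨C, hC, fun z x => ?_⟩
  calc wt K x * ‖g (z - x)‖ ≤ ((1 + ‖z‖) * (1 + ‖z - x‖)) ^ K * ‖g (z - x)‖ := by
        gcongr
        exact (wt_le K x).trans (by gcongr; exact one_add_le x z)
    _ = ((1 + ‖z - x‖) ^ K * ‖g (z - x)‖) * (1 + ‖z‖) ^ K := by rw [mul_pow]; ring
    _ ≤ _ := by gcongr; exact h _

lemma lip_one {n : ℕ} (g : Sch n) (K : ℕ) :
    ∃ C, 0 ≤ C ∧ ∀ z z' x : Rn n, ‖z' - z‖ ≤ 1 →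
      wt K x * ‖g (z' - x) - g (z - x)‖ ≤ C * (1 + ‖z‖) ^ K * ‖z' - z‖ := by
  obtain ⟨C, hC, h⟩ := decay_one (fderivCLM ℝ (Rn n) ℂ g) K
  refine ⟨2 ^ K * C, by positivity, fun z z' x hz => ?_⟩
  have hb : ∀ u ∈ closedBall (z - x) 1, ‖fderiv ℝ g u‖ ≤ 2 ^ K * C / (1 + ‖z - x‖) ^ K := by
    intro u hu
    rw [le_div_iff₀ (by positivity)]
    have h1 := h u
    rw [fderivCLM_apply] at h1
    have h2 : 1 + ‖z - x‖ ≤ 2 * (1 + ‖u‖) := by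
      rw [mem_closedBall, dist_eq_norm] at hu
      have : ‖z - x‖ ≤ ‖u‖ + ‖u - (z - x)‖ := by
        have := norm_sub_le u (u - (z - x)); simpa using this
      linarith [norm_nonneg u]
    calc ‖fderiv ℝ g u‖ * (1 + ‖z - x‖) ^ K ≤ ‖fderiv ℝ g u‖ * (2 * (1 + ‖u‖)) ^ K := by gcongr
      _ = 2 ^ K * ((1 + ‖u‖) ^ K * ‖fderiv ℝ g u‖) := by rw [mul_pow]; ring
      _ ≤ _ := by gcongr
  have hm := (convex_closedBall (z - x) 1).norm_image_sub_le_of_norm_fderiv_le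
    (fun u _ => g.differentiableAt) hb (x := z - x) (y := z' - x) (by simp)
    (by rw [mem_closedBall, dist_eq_norm]; simpa using hz)
  have e : z' - x - (z - x) = z' - z := by abel
  rw [e] at hm
  calc wt K x * ‖g (z' - x) - g (z - x)‖
      ≤ ((1 + ‖z‖) * (1 + ‖z - x‖)) ^ K * (2 ^ K * C / (1 + ‖z - x‖) ^ K * ‖z' - z‖) := by
        gcongr
        exact (wt_le K x).trans (by gcongr; exact one_add_le x z)
    _ = _ := by rw [mul_pow]; field_simp

lemma norm_iota_le {n K L : ℕ} (φ : Sch n) {b : ℝ} (hb : 0 ≤ b)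
    (h : ∀ (α : Fin n → Fin (L+1)) x, wt K x * ‖wD (word fun i => (α i : ℕ)) φ x‖ ≤ b) :
    ‖iota n K L φ‖ ≤ b := by
  rw [pi_norm_le_iff_of_nonneg hb]
  intro α
  rw [BoundedContinuousFunction.norm_le hb]
  intro x
  rw [norm_iota_apply]; exact h α x

lemma wD_sub {n : ℕ} (l : List (Fin n)) (φ φ' : Sch n) : wD l (φ - φ') = wD l φ - wD l φ' :=
  (wDL l).map_sub φ φ'

lemma iota_growth {n : ℕ} (K L : ℕ) (V : Sch n) :
    ∃ C, 0 ≤ C ∧ ∀ z : Rn n, ‖iota n K L (shiftReflect V z)‖ ≤ C * (1 + ‖z‖) ^ K := by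
  choose C hC h using fun α : Fin n → Fin (L+1) => growth_one (wD (word fun i => (α i : ℕ)) V) K
  refine ⟨∑ α, C α, Finset.sum_nonneg fun α _ => hC α, fun z => ?_⟩
  have hs := Finset.sum_nonneg (s := Finset.univ) fun α _ => hC α
  refine norm_iota_le _ (by positivity) fun α x => ?_
  rw [wD_shift]
  simp only [norm_mul, norm_pow, norm_neg, norm_one, one_pow, one_mul]
  refine (h α z x).trans ?_
  gcongr
  exact Finset.single_le_sum (fun α _ => hC α) (Finset.mem_univ α)

lemma iota_lip {n : ℕ} (K L : ℕ) (V : Sch n) :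
    ∃ C, 0 ≤ C ∧ ∀ z z' : Rn n, ‖z' - z‖ ≤ 1 →
      ‖iota n K L (shiftReflect V z') - iota n K L (shiftReflect V z)‖
        ≤ C * (1 + ‖z‖) ^ K * ‖z' - z‖ := by
  choose C hC h using fun α : Fin n → Fin (L+1) => lip_one (wD (word fun i => (α i : ℕ)) V) K
  refine ⟨∑ α, C α, Finset.sum_nonneg fun α _ => hC α, fun z z' hz => ?_⟩
  have hs := Finset.sum_nonneg (s := Finset.univ) fun α _ => hC α
  rw [← map_sub]
  refine norm_iota_le _ (by positivity) fun α x => ?_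
  rw [wD_sub, _root_.sub_apply, wD_shift, wD_shift, ← mul_sub]
  simp only [norm_mul, norm_pow, norm_neg, norm_one, one_pow, one_mul]
  refine (h α z z' x hz).trans ?_
  gcongr
  exact Finset.single_le_sum (fun α _ => hC α) (Finset.mem_univ α)

lemma iota_cont {n : ℕ} (K L : ℕ) (V : Sch n) :
    Continuous fun z : Rn n => iota n K L (shiftReflect V z) := by
  obtain ⟨C, hC, h⟩ := iota_lip K L V
  rw [continuous_iff_continuousAt]
  intro z
  rw [ContinuousAt, tendsto_iff_norm_sub_tendsto_zero]
  have h2 : Tendsto (fun z' : Rn n => C * (1 + ‖z‖) ^ K * ‖z' - z‖) (𝓝 z) (𝓝 0) := by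
    have : Continuous fun z' : Rn n => C * (1 + ‖z‖) ^ K * ‖z' - z‖ := by fun_prop
    simpa using this.tendsto z
  refine squeeze_zero' (Eventually.of_forall fun _ => norm_nonneg _) ?_ h2
  filter_upwards [Metric.closedBall_mem_nhds z one_pos] with z' hz'
  exact h z z' (by simpa [dist_eq_norm] using hz')

lemma functional_ext_abs {S X E : Type*} [AddCommGroup S] [Module ℂ S] [NormedAddCommGroup X]
    [NormedSpace ℂ X] [NormedAddCommGroup E] [NormedSpace ℂ E]
    (f : S →ₗ[ℂ] E) (ι : S →ₗ[ℂ] X) {C : ℝ} (hC : 0 ≤ C)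
    (h : ∀ φ, ‖f φ‖ ≤ C * ‖ι φ‖) (e : StrongDual ℂ E) :
    ∃ F : StrongDual ℂ X, ∀ φ, F (ι φ) = e (f φ) := by
  obtain ⟨g, hg⟩ := ι.rangeRestrict.exists_rightInverse_of_surjective ι.range_rangeRestrict
  have hg' : ∀ x : LinearMap.range ι, ι (g x) = x := by
    intro x
    have := LinearMap.congr_fun hg x
    exact congrArg Subtype.val this
  let F0 : LinearMap.range ι →ₗ[ℂ] ℂ := (e.toLinearMap ∘ₗ f) ∘ₗ g
  have hF0 : ∀ x, ‖F0 x‖ ≤ (‖e‖ * C) * ‖x‖ := by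
    intro x
    calc ‖F0 x‖ = ‖e (f (g x))‖ := rfl
      _ ≤ ‖e‖ * ‖f (g x)‖ := e.le_opNorm _
      _ ≤ ‖e‖ * (C * ‖ι (g x)‖) := by gcongr; exact h _
      _ = _ := by rw [hg', mul_assoc]; rfl
  obtain ⟨F, hF, -⟩ := exists_extension_norm_eq (LinearMap.range ι) (F0.mkContinuous _ hF0)
  refine ⟨F, fun φ => ?_⟩
  have h1 := hF ⟨ι φ, LinearMap.mem_range_self ι φ⟩
  have h2 : F (ι φ) = e (f (g ⟨ι φ, LinearMap.mem_range_self ι φ⟩)) := h1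
  rw [h2]
  have h3 : f (g ⟨ι φ, LinearMap.mem_range_self ι φ⟩) = f φ := by
    rw [← sub_eq_zero, ← map_sub, ← norm_le_zero_iff]
    refine (h _).trans ?_
    rw [map_sub, hg']
    simp
  rw [h3]

lemma functional_ext {n : ℕ} {E : Type*} [NormedAddCommGroup E] [NormedSpace ℂ E]
    (f : TDist n E) {K L : ℕ} {C : ℝ} (hC : 0 ≤ C)
    (h : ∀ φ, ‖f.toFun φ‖ ≤ C * ‖iota n K L φ‖) (e : StrongDual ℂ E) :
    ∃ F : StrongDual ℂ (XX n L), ∀ φ, F (iota n K L φ) = e (f.toFun φ) :=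
  functional_ext_abs f.toFun (iota n K L).toLinearMap hC h e

lemma iota_integrable {n : ℕ} (K L : ℕ) (U V : Sch n) (y : Rn n) :
    Integrable fun z : Rn n => U z • iota n K L (shiftReflect V (y - z)) := by
  obtain ⟨C, hC, h⟩ := iota_growth K L V
  have hi : Integrable fun z : Rn n => C * (1 + ‖y‖) ^ K * ((1 + ‖z‖) ^ K * ‖U z‖) := by
    apply Integrable.const_mul
    obtain ⟨D, hD, hd⟩ := decay_one U (K + (n + 1))
    have hj : Integrable fun z : Rn n => D * (1 + ‖z‖) ^ (-((n : ℝ) + 1)) :=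
      (integrable_one_add_norm (by simp)).const_mul D
    refine hj.mono' (by fun_prop) (ae_of_all _ fun z => ?_)
    rw [Real.norm_of_nonneg (by positivity)]
    rw [Real.rpow_neg (by positivity), ← div_eq_mul_inv, le_div_iff₀ (by positivity)]
    refine le_trans (le_of_eq ?_) (hd z)
    have : (1 + ‖z‖) ^ ((n : ℝ) + 1) = (1 + ‖z‖) ^ (n + 1) := by
      rw [← Real.rpow_natCast]; norm_cast
    rw [this, pow_add]; ring
  refine hi.mono' ?_ (ae_of_all _ fun z => ?_)
  · haveI : SecondCountableTopologyEither (Rn n) (XX n L) := secondCountableTopologyEither_of_left _ _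
    apply Continuous.aestronglyMeasurable
    exact U.continuous.smul ((iota_cont K L V).comp (by fun_prop))
  · rw [norm_smul]
    calc ‖U z‖ * ‖iota n K L (shiftReflect V (y - z))‖ ≤ ‖U z‖ * (C * (1 + ‖y - z‖) ^ K) := by
          gcongr; exact h _
      _ ≤ ‖U z‖ * (C * ((1 + ‖y‖) * (1 + ‖z‖)) ^ K) := by
          gcongr
          nlinarith [norm_sub_le y z, norm_nonneg y, norm_nonneg z,
            mul_nonneg (norm_nonneg y) (norm_nonneg z)]
      _ = _ := by rw [mul_pow]; ring

lemma iota_conv {n : ℕ} (K L : ℕ) (m B : Sch n) (y : Rn n) :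
    iota n K L (shiftReflect (𝓕⁻ (mulS m B)) y) =
      ∫ z, (𝓕⁻ m : Sch n) z • iota n K L (shiftReflect (𝓕⁻ B) (y - z)) := by
  have hint := iota_integrable K L (𝓕⁻ m) (𝓕⁻ B) y
  funext α
  ext x
  let ev : XX n L →L[ℂ] ℂ := (BoundedContinuousFunction.evalCLM ℂ x).comp
    (ContinuousLinearMap.proj (R := ℂ) (φ := fun _ : Fin n → Fin (L+1) => BoundedContinuousFunction (Rn n) ℂ) α)
  have h1 := ev.integral_comp_comm hint
  have h2 : ∀ X : XX n L, ev X = X α x := fun X => rfl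
  rw [← h2, ← h2, ← h1]
  simp only [h2, Pi.smul_apply, BoundedContinuousFunction.coe_smul, iota_apply, wD_shift]
  obtain ⟨B', hB1, hB2⟩ := wD_fourierInv (word fun i => (α i : ℕ)) m B
  rw [hB1, hB2, fourierInv_mul, ← integral_const_mul, ← integral_const_mul]
  congr 1; funext z
  have : y - x - z = y - z - x := by abel
  rw [this, smul_eq_mul]; ring

lemma mOp_cont {n : ℕ} {E : Type*} [NormedAddCommGroup E] [NormedSpace ℂ E] (B : Sch n)
    (f : TDist n E) : Continuous (mOp B f) := by
  obtain ⟨K, L, C, hC, h⟩ := tdist_bound f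
  unfold mOp tdConv
  apply Continuous.const_smul
  rw [continuous_iff_continuousAt]
  intro z
  rw [ContinuousAt, tendsto_iff_norm_sub_tendsto_zero]
  have h0 := ((iota_cont K L (invFourierS B)).tendsto z)
  rw [tendsto_iff_norm_sub_tendsto_zero] at h0
  have h1 := h0.const_mul C
  rw [mul_zero] at h1
  refine squeeze_zero (fun _ => norm_nonneg _) (fun z' => ?_) h1
  rw [← map_sub, ← map_sub]
  exact h _

lemma mOp_growth {n : ℕ} {E : Type*} [NormedAddCommGroup E] [NormedSpace ℂ E] (B : Sch n)
    (f : TDist n E) : ∃ (C : ℝ) (K : ℕ), 0 ≤ C ∧ ∀ y, ‖mOp B f y‖ ≤ C * (1 + ‖y‖) ^ K := by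
  obtain ⟨K, L, C, hC, h⟩ := tdist_bound f
  obtain ⟨D, hD, hd⟩ := iota_growth K L (invFourierS B)
  refine ⟨‖((2 * π) ^ (-(n : ℝ) / 2) : ℝ)‖ * C * D, K, by positivity, fun y => ?_⟩
  unfold mOp tdConv
  rw [norm_smul, mul_assoc, mul_assoc]
  gcongr
  calc _ ≤ C * ‖iota n K L (shiftReflect (invFourierS B) y)‖ := h _
    _ ≤ C * (D * (1 + ‖y‖) ^ K) := by gcongr; exact hd y

lemma mOp_conv {n : ℕ} {E : Type*} [NormedAddCommGroup E] [NormedSpace ℂ E] (m B : Sch n)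
    (f : TDist n E) (y : Rn n) :
    ‖mOp (mulS m B) f y‖ₑ ≤ ∫⁻ z, ‖(𝓕⁻ m : Sch n) z‖ₑ * ‖mOp B f (y - z)‖ₑ := by
  obtain ⟨K, L, C, hC, h⟩ := tdist_bound f
  obtain ⟨e, he, he'⟩ := exists_dual_vector'' ℂ (mOp (mulS m B) f y)
  obtain ⟨F, hF⟩ := functional_ext f hC h e
  have hv : ∀ (B : Sch n) y, e (mOp B f y) =
      ((2 * π) ^ (-(n : ℝ) / 2) : ℝ) • F (iota n K L (shiftReflect (𝓕⁻ B) y)) := by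
    intro B y
    rw [hF]; unfold mOp tdConv
    rw [← Complex.coe_smul, map_smul]; rfl
  have h1 : ‖mOp (mulS m B) f y‖ₑ = ‖e (mOp (mulS m B) f y)‖ₑ := by
    rw [he', ← ofReal_norm, ← ofReal_norm, RCLike.norm_ofReal, abs_of_nonneg (norm_nonneg _)]
  rw [h1, hv, iota_conv, ← F.integral_comp_comm (iota_integrable K L (𝓕⁻ m) (𝓕⁻ B) y),
    ← integral_smul]
  refine (enorm_integral_le_lintegral_enorm _).trans ?_
  apply lintegral_mono
  intro z
  simp only [map_smul]
  rw [smul_comm, ← hv, smul_eq_mul, enorm_mul]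
  gcongr
  rw [← ofReal_norm, ← ofReal_norm]
  apply ENNReal.ofReal_le_ofReal
  calc _ ≤ ‖e‖ * ‖mOp B f (y - z)‖ := e.le_opNorm _
    _ ≤ 1 * _ := by gcongr
    _ = _ := one_mul _

def shiftReflectL {n : ℕ} (x : Rn n) : Sch n →L[ℝ] Sch n := SchwartzMap.compCLMOfAntilipschitz (𝕜 := ℝ)
    (Aux.hasTemperateGrowth_sub_left x) (Aux.antilipschitz_sub_left x)

lemma mOp_tendsto {n : ℕ} {E : Type*} [NormedAddCommGroup E] [NormedSpace ℂ E] (B : Sch n)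
    (f : TDist n E) (y : Rn n) (b : ℕ → Sch n) (hb : Tendsto b atTop (𝓝 B)) :
    Tendsto (fun N => mOp (b N) f y) atTop (𝓝 (mOp B f y)) := by
  have : Continuous fun B : Sch n => mOp B f y := by
    unfold mOp tdConv
    apply Continuous.const_smul
    apply (tdist_cont f).comp
    exact (shiftReflectL y).continuous.comp (FourierTransform.fourierCLE ℂ (Sch n)).symm.continuous
  exact (this.tendsto B).comp hb

lemma mOp_add {n : ℕ} {E : Type*} [NormedAddCommGroup E] [NormedSpace ℂ E] (B B' : Sch n)
    (f : TDist n E) (y : Rn n) : mOp (B + B') f y = mOp B f y + mOp B' f y := by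
  have h1 : invFourierS (B + B') = invFourierS B + invFourierS B' := map_add _ _ _
  have h2 : ∀ (u v : Sch n), shiftReflect (u + v) y = shiftReflect u y + shiftReflect v y :=
    fun u v => map_add (shiftReflectL y) u v
  unfold mOp tdConv
  rw [h1, h2, map_add, smul_add]

lemma mOp_zero {n : ℕ} {E : Type*} [NormedAddCommGroup E] [NormedSpace ℂ E]
    (f : TDist n E) (y : Rn n) : mOp 0 f y = 0 := by
  have := mOp_add 0 0 f y
  simpa using this

lemma mOp_sum {n : ℕ} {E : Type*} [NormedAddCommGroup E] [NormedSpace ℂ E] {ι : Type*}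
    (s : Finset ι) (B : ι → Sch n)
    (f : TDist n E) (y : Rn n) : mOp (∑ i ∈ s, B i) f y = ∑ i ∈ s, mOp (B i) f y := by
  classical
  induction s using Finset.induction_on with
  | empty => simp [mOp_zero]
  | insert i s hi ih => rw [Finset.sum_insert hi, Finset.sum_insert hi, mOp_add, ih]

end Sub
end

noncomputable section
open MeasureTheory Filter Metric Real Set SchwartzMap
open scoped ENNReal NNReal Topology FourierTransform
namespace Sub

lemma jensen_meas {α : Type*} [MeasurableSpace α] (ν : Measure α) {g : α → ℝ≥0∞}
    (hg : AEMeasurable g ν) {ρ : ℝ} (hρ : 1 ≤ ρ) :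
    (∫⁻ x, g x ∂ν) ^ ρ ≤ (ν univ) ^ (ρ - 1) * ∫⁻ x, g x ^ ρ ∂ν := by
  rcases hρ.eq_or_lt with rfl | h1
  · simp
  · have hc : ρ.HolderConjugate (ρ / (ρ - 1)) := Real.HolderConjugate.conjExponent h1
    have h := ENNReal.lintegral_mul_le_Lp_mul_Lq ν hc hg (g := fun _ => 1) aemeasurable_const
    have hρ0 : 0 < ρ := by linarith
    simp only [Pi.mul_apply, mul_one, ENNReal.one_rpow, lintegral_const, one_mul] at h
    calc _ ≤ ((∫⁻ x, g x ^ ρ ∂ν) ^ (1 / ρ) * ν univ ^ (1 / (ρ / (ρ - 1)))) ^ ρ :=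
          ENNReal.rpow_le_rpow h hρ0.le
      _ = _ := by
          rw [ENNReal.mul_rpow_of_nonneg _ _ hρ0.le, ← ENNReal.rpow_mul, ← ENNReal.rpow_mul, mul_comm]
          congr 1
          · congr 1; field_simp
          · rw [one_div_mul_cancel hρ0.ne', ENNReal.rpow_one]

lemma jensen_tsum (c x : ℕ → ℝ≥0∞) {ρ : ℝ} (hρ : 1 ≤ ρ) :
    (∑' i, c i * x i) ^ ρ ≤ (∑' i, c i) ^ (ρ - 1) * ∑' i, c i * x i ^ ρ := by
  have h := jensen_meas ((Measure.count : Measure ℕ).withDensity c) (g := x)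
    (measurable_of_countable _).aemeasurable hρ
  rw [lintegral_withDensity_eq_lintegral_mul _ (measurable_of_countable _) (measurable_of_countable _),
    lintegral_withDensity_eq_lintegral_mul _ (measurable_of_countable _) (measurable_of_countable _),
    lintegral_count, lintegral_count, withDensity_apply _ MeasurableSet.univ,
    Measure.restrict_univ, lintegral_count] at h
  exact h

def cv {n : ℕ} (K g : Rn n → ℝ≥0∞) (x : Rn n) : ℝ≥0∞ := ∫⁻ z, K (x - z) * g z

variable {n : ℕ}

lemma cv_meas {K g : Rn n → ℝ≥0∞} (hK : Measurable K) (hg : Measurable g) : Measurable (cv K g) := by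
  unfold cv
  exact Measurable.lintegral_prod_right' (f := fun p : Rn n × Rn n => K (p.1 - p.2) * g p.2)
    (by fun_prop)

lemma cv_mono {K K' g g' : Rn n → ℝ≥0∞} (h : ∀ x, K x ≤ K' x) (hg : ∀ x, g x ≤ g' x) (x : Rn n) :
    cv K g x ≤ cv K' g' x := lintegral_mono fun _ => mul_le_mul' (h _) (hg _)

lemma cv_alt (K g : Rn n → ℝ≥0∞) (x : Rn n) : cv K g x = ∫⁻ z, K z * g (x - z) := by
  unfold cv
  rw [← lintegral_sub_left_eq_self (fun z => K z * g (x - z)) x]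
  simp

lemma cv_adj {K g v : Rn n → ℝ≥0∞} (hK : Measurable K) (hg : Measurable g) (hv : Measurable v)
    (he : ∀ x, K (-x) = K x) : ∫⁻ x, cv K g x * v x = ∫⁻ x, g x * cv K v x := by
  unfold cv
  have h1 : ∀ x, (∫⁻ z, K (x - z) * g z) * v x = ∫⁻ z, K (x - z) * g z * v x := fun x =>
    (lintegral_mul_const _ (by fun_prop)).symm
  have h2 : ∀ x, g x * (∫⁻ z, K (x - z) * v z) = ∫⁻ z, g x * (K (x - z) * v z) := fun x =>
    (lintegral_const_mul _ (by fun_prop)).symm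
  simp only [h1, h2]
  rw [lintegral_lintegral_swap (by fun_prop)]
  apply lintegral_congr; intro x
  apply lintegral_congr; intro z
  rw [← he (z - x), neg_sub]; ring

lemma cv_one (K : Rn n → ℝ≥0∞) (x : Rn n) : cv K (fun _ => 1) x = ∫⁻ z, K z := by
  rw [cv_alt]; simp

lemma cv_jensen {K g : Rn n → ℝ≥0∞} (hK : Measurable K) (hg : Measurable g) {ρ : ℝ} (hρ : 1 ≤ ρ)
    (x : Rn n) : cv K g x ^ ρ ≤ (∫⁻ z, K z) ^ (ρ - 1) * cv K (fun z => g z ^ ρ) x := by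
  have hk : Measurable fun z => K (x - z) := by fun_prop
  have h := jensen_meas ((volume : Measure (Rn n)).withDensity fun z => K (x - z)) (g := g)
    hg.aemeasurable hρ
  rw [lintegral_withDensity_eq_lintegral_mul _ hk hg,
    lintegral_withDensity_eq_lintegral_mul _ hk (by fun_prop),
    withDensity_apply _ MeasurableSet.univ, Measure.restrict_univ] at h
  have h2 : ∫⁻ z, K (x - z) = ∫⁻ z, K z := lintegral_sub_left_eq_self K x
  rw [h2] at h
  exact h

lemma cv_int {K g : Rn n → ℝ≥0∞} (hK : Measurable K) (hg : Measurable g) 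
    (he : ∀ x, K (-x) = K x) : ∫⁻ x, cv K g x = (∫⁻ z, K z) * ∫⁻ x, g x := by
  have := cv_adj hK hg (v := fun _ => 1) measurable_const he
  simp only [mul_one, cv_one] at this
  rw [this, lintegral_mul_const _ hg, mul_comm]

lemma cv_Lp {K g : Rn n → ℝ≥0∞} (hK : Measurable K) (hg : Measurable g) {ρ : ℝ} (hρ : 1 ≤ ρ)
    (he : ∀ x, K (-x) = K x) {A : ℝ≥0∞} (hA : ∫⁻ z, K z ≤ A) :
    ∫⁻ x, cv K g x ^ ρ ≤ A ^ ρ * ∫⁻ x, g x ^ ρ := by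
  calc _ ≤ ∫⁻ x, (∫⁻ z, K z) ^ (ρ - 1) * cv K (fun z => g z ^ ρ) x :=
        lintegral_mono fun x => cv_jensen hK hg hρ x
    _ = (∫⁻ z, K z) ^ (ρ - 1) * ((∫⁻ z, K z) * ∫⁻ x, g x ^ ρ) := by
        rw [lintegral_const_mul _ (cv_meas hK (by fun_prop)), cv_int hK (by fun_prop) he]
    _ ≤ A ^ (ρ - 1) * (A * ∫⁻ x, g x ^ ρ) := by
        gcongr
    _ = _ := by
        rw [← mul_assoc]; congr 1
        conv_rhs => rw [show ρ = (ρ - 1) + 1 by ring, ENNReal.rpow_add_of_nonneg _ _ (by linarith) zero_le_one,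
          ENNReal.rpow_one]

/-- Exponential kernel -/
def We (t : ℝ) (x : Rn n) : ℝ≥0∞ := ENNReal.ofReal (t ^ n * Real.exp (-(t * ‖x‖)))
/-- polynomial kernel -/
def Kp (m t : ℝ) (x : Rn n) : ℝ≥0∞ := ENNReal.ofReal (t ^ n * (1 + t * ‖x‖) ^ (-m))

lemma We_meas (t : ℝ) : Measurable (We t : Rn n → ℝ≥0∞) := by unfold We; fun_prop
lemma Kp_meas (m t : ℝ) : Measurable (Kp m t : Rn n → ℝ≥0∞) := by unfold Kp; fun_prop
lemma We_even (t : ℝ) (x : Rn n) : We t (-x) = We t x := by simp [We]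
lemma Kp_even (m t : ℝ) (x : Rn n) : Kp m t (-x) = Kp m t x := by simp [Kp]

lemma We_mul (x y : Rn n) {s : ℝ} (hs : 0 ≤ s) :
    We s (x - y) ≤ ENNReal.ofReal (Real.exp (s * ‖y‖)) * We s x := by
  unfold We
  rw [← ENNReal.ofReal_mul (by positivity)]
  apply ENNReal.ofReal_le_ofReal
  rw [mul_left_comm, ← Real.exp_add]
  gcongr
  have : ‖x‖ ≤ ‖x - y‖ + ‖y‖ := by simpa using norm_add_le (x - y) y
  nlinarith

/-- scaling of integrals -/
lemma lint_scale {t : ℝ} (ht : 0 < t) (g : Rn n → ℝ≥0∞) :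
    ∫⁻ x, ENNReal.ofReal (t ^ n) * g (t • x) = ∫⁻ x, g x := by
  have h := Measure.addHaar_smul  (volume : Measure (Rn n))
  have h2 := Measure.map_addHaar_smul (volume : Measure (Rn n)) ht.ne'
  have h3 : ∫⁻ x, g (t • x) = ENNReal.ofReal (t ^ n)⁻¹ * ∫⁻ x, g x := by
    have e := (Homeomorph.smulOfNeZero t ht.ne' : Rn n ≃ₜ Rn n).measurableEmbedding.lintegral_map
      (μ := volume) g
    have e2 : (⇑(Homeomorph.smulOfNeZero t ht.ne' : Rn n ≃ₜ Rn n)) = fun x => t • x := rfl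
    rw [e2] at e
    rw [← e]
    have h4 : Measure.map (fun x : Rn n => t • x) volume = ENNReal.ofReal |(t ^ Module.finrank ℝ (Rn n))⁻¹| • volume := h2
    rw [h4, lintegral_smul_measure]
    simp [abs_of_pos ht]
  rw [lintegral_const_mul' _ _ ENNReal.ofReal_ne_top, h3, ← mul_assoc, ← ENNReal.ofReal_mul (by positivity),
    mul_inv_cancel₀ (by positivity)]
  simp

lemma exp_le_poly {u : ℝ} (hu : 0 ≤ u) (N : ℕ) :
    Real.exp (-u) ≤ ((N.factorial : ℝ) * Real.exp 1) * (1 + u) ^ (-(N : ℝ)) := by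
  have h := Real.pow_div_factorial_le_exp (1 + u) (by linarith) N
  rw [Real.rpow_neg (by linarith), Real.rpow_natCast, ← div_eq_mul_inv, le_div_iff₀ (by positivity)]
  rw [div_le_iff₀ (by positivity)] at h
  rw [Real.exp_add] at h
  rw [Real.exp_neg]
  rw [inv_mul_le_iff₀ (by positivity)]
  nlinarith

/-- integrals of the exponential kernel with half the exponent -/
lemma We_int (n : ℕ) : ∃ A : ℝ≥0∞, A ≠ ∞ ∧ ∀ t : ℝ, 0 < t →
    ∫⁻ y : Rn n, ENNReal.ofReal (t ^ n * Real.exp (-(t * ‖y‖ / 2))) ≤ A := by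
  refine ⟨∫⁻ y : Rn n, ENNReal.ofReal (Real.exp (-(‖y‖ / 2))), ?_, ?_⟩
  · have h1 := finite_integral_one_add_norm (E := Rn n) (μ := volume) (r := (n:ℝ) + 1) (by simp)
    refine ne_of_lt ?_
    calc _ ≤ ∫⁻ y : Rn n, ENNReal.ofReal (((n+1).factorial : ℝ) * Real.exp 1 * 2 ^ (n+1)) *
            ENNReal.ofReal ((1 + ‖y‖) ^ (-((n:ℝ)+1))) := by
          apply lintegral_mono; intro y; dsimp only
          rw [← ENNReal.ofReal_mul (by positivity)]
          apply ENNReal.ofReal_le_ofReal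
          refine (exp_le_poly (by positivity) (n+1)).trans ?_
          rw [mul_assoc _ (2 ^ (n+1))]
          apply mul_le_mul_of_nonneg_left _ (by positivity)
          push_cast
          rw [Real.rpow_neg (by positivity), Real.rpow_neg (by positivity), ← div_eq_mul_inv,
            inv_le_comm₀ (by positivity) (by positivity), inv_div, div_le_iff₀ (by positivity)]
          have : (2:ℝ) ^ (n+1) = 2 ^ ((n:ℝ) + 1) := by
            rw [← Real.rpow_natCast]; push_cast; rfl
          rw [this, ← Real.mul_rpow (by positivity) (by positivity)]
          apply Real.rpow_le_rpow (by positivity) (by linarith [norm_nonneg y]) (by positivity)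
      _ < ∞ := by
          rw [lintegral_const_mul' _ _ ENNReal.ofReal_ne_top]
          exact ENNReal.mul_lt_top ENNReal.ofReal_lt_top h1
  · intro t ht
    rw [← lint_scale ht (fun y : Rn n => ENNReal.ofReal (Real.exp (-(‖y‖ / 2))))]
    apply lintegral_mono; intro y
    dsimp only
    rw [← ENNReal.ofReal_mul (by positivity), norm_smul, Real.norm_of_nonneg ht.le]

lemma Kp_int (n : ℕ) {m : ℝ} (hm : (n:ℝ) < m) : ∃ A : ℝ≥0∞, A ≠ ∞ ∧ ∀ t : ℝ, 0 < t →
    ∫⁻ y : Rn n, Kp m t y ≤ A := by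
  refine ⟨∫⁻ y : Rn n, ENNReal.ofReal ((1 + ‖y‖) ^ (-m)), ?_, ?_⟩
  · exact (finite_integral_one_add_norm (E := Rn n) (μ := volume) (by simpa using hm)).ne
  · intro t ht
    rw [← lint_scale ht (fun y : Rn n => ENNReal.ofReal ((1 + ‖y‖) ^ (-m)))]
    apply lintegral_mono; intro y
    dsimp only [Kp]
    rw [← ENNReal.ofReal_mul (by positivity), norm_smul, Real.norm_of_nonneg ht.le]

end Sub
end

noncomputable section
open MeasureTheory Filter Metric Real Set SchwartzMap
open scoped ENNReal NNReal Topology FourierTransform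
namespace Sub
variable {n : ℕ}

lemma rpow_sub_step {ρ : ℝ} (hρ : 1 ≤ ρ) (S a : ℝ≥0∞) :
    (S + a) ^ ρ ≤ S ^ ρ + ENNReal.ofReal ρ * (a * (S + a) ^ (ρ - 1)) := by
  by_cases hS : S + a = ∞
  · rcases ENNReal.add_eq_top.1 hS with h | h
    · subst h; rw [ENNReal.top_rpow_of_pos (by linarith : (0:ℝ) < ρ)]; simp
    · subst h
      have : ENNReal.ofReal ρ * (∞ * (S + ∞) ^ (ρ - 1)) = ∞ := by
        rw [add_top, ENNReal.top_mul, ENNReal.mul_top]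
        · simp; linarith
        · rcases hρ.eq_or_lt with h | h
          · simp [← h]
          · rw [ENNReal.top_rpow_of_pos (by linarith)]; simp
      rw [this]; simp
  · have hs : S ≠ ∞ := fun h => hS (by simp [h])
    have ha : a ≠ ∞ := fun h => hS (by simp [h])
    lift S to ℝ≥0 using hs
    lift a to ℝ≥0 using ha
    rw [← ENNReal.coe_add, ← ENNReal.coe_rpow_of_nonneg _ (by linarith), ← ENNReal.coe_rpow_of_nonneg _ (by linarith),
      ← ENNReal.coe_rpow_of_nonneg _ (by linarith), ENNReal.ofReal, ← ENNReal.coe_mul, ← ENNReal.coe_mul,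
      ← ENNReal.coe_add, ENNReal.coe_le_coe, ← NNReal.coe_le_coe]
    push_cast
    rw [Real.coe_toNNReal _ (by linarith)]
    rcases eq_or_ne ((S:ℝ) + a) 0 with h0 | h0
    · rw [h0, Real.zero_rpow (by linarith)]; positivity
    · have hp : 0 < (S:ℝ) + a := lt_of_le_of_ne (by positivity) (Ne.symm h0)
      have hb := one_add_mul_self_le_rpow_one_add (s := -(a:ℝ) / (S + a)) (p := ρ)
        (by rw [le_div_iff₀ hp]; linarith [S.2]) hρ
      have e1 : 1 + -(a:ℝ) / (S + a) = S / (S + a) := by field_simp; ring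
      rw [e1, Real.div_rpow (by positivity) hp.le, le_div_iff₀ (by positivity)] at hb
      have e2 : ((S:ℝ) + a) ^ ρ = (S + a) * (S + a) ^ (ρ - 1) := by
        rw [mul_comm, ← Real.rpow_add_one h0]; congr 1; ring
      have e3 : (1 + ρ * (-(a:ℝ) / (S + a))) * (S + a) ^ ρ = (S + a) ^ ρ - ρ * (a * (S + a) ^ (ρ - 1)) := by
        rw [e2]; field_simp
        ring
      linarith

lemma rpow_sum_le {ρ : ℝ} (hρ : 1 ≤ ρ) (a : ℕ → ℝ≥0∞) (N : ℕ) :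
    (∑ k ∈ Finset.range N, a k) ^ ρ ≤
      ENNReal.ofReal ρ * ∑ k ∈ Finset.range N, a k * (∑ j ∈ Finset.range (k+1), a j) ^ (ρ - 1) := by
  induction N with
  | zero => simp; linarith
  | succ N ih =>
    rw [Finset.sum_range_succ, Finset.sum_range_succ, mul_add, ← Finset.sum_range_succ]
    rw [Finset.sum_range_succ]
    exact (rpow_sub_step hρ _ _).trans (add_le_add_left ih _)

/-- Young with small parameter -/
lemma young_small {ρ : ℝ} (hρ : 1 ≤ ρ) (h S : ℝ≥0∞) {M : ℝ≥0∞} (hM : M ≠ 0) (hM' : M ≠ ∞) :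
    h * S ^ (ρ - 1) ≤ M ^ (ρ - 1) * h ^ ρ + M⁻¹ * S ^ ρ := by
  have key : ∀ x : ℝ≥0∞, x ^ ρ = x * x ^ (ρ - 1) := by
    intro x
    conv_lhs => rw [show ρ = 1 + (ρ - 1) by ring, ENNReal.rpow_add_of_nonneg _ _ zero_le_one (by linarith),
          ENNReal.rpow_one]
  rcases le_total S (M * h) with hc | hc
  · refine le_trans ?_ le_self_add
    calc h * S ^ (ρ - 1) ≤ h * (M * h) ^ (ρ - 1) := by gcongr
      _ = _ := by rw [ENNReal.mul_rpow_of_nonneg _ _ (by linarith), key h]; ring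
  · refine le_trans ?_ le_add_self
    rw [key S, ← mul_assoc]
    gcongr
    rw [← ENNReal.div_eq_inv_mul, ENNReal.le_div_iff_mul_le (Or.inl hM) (Or.inl hM')]
    rwa [mul_comm]

lemma rpow_add_le_mul (x y : ℝ≥0∞) {r : ℝ} (hr : 0 ≤ r) :
    (x + y) ^ r ≤ 2 ^ r * (x ^ r + y ^ r) := by
  have h : x + y ≤ 2 * max x y := by
    rw [two_mul]; exact add_le_add (le_max_left _ _) (le_max_right _ _)
  calc (x + y) ^ r ≤ (2 * max x y) ^ r := ENNReal.rpow_le_rpow h hr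
    _ = 2 ^ r * (max x y) ^ r := ENNReal.mul_rpow_of_nonneg _ _ hr
    _ ≤ _ := by
      gcongr
      rcases le_total x y with h | h
      · rw [max_eq_right h]; exact le_add_self
      · rw [max_eq_left h]; exact le_self_add

lemma rpow_finsum_le (s : Finset ℕ) (x : ℕ → ℝ≥0∞) {r : ℝ} (hr : 0 < r) :
    (∑ i ∈ s, x i) ^ r ≤ (s.card : ℝ≥0∞) ^ r * ∑ i ∈ s, x i ^ r := by
  rcases s.eq_empty_or_nonempty with rfl | hs
  · simp [hr]
  obtain ⟨i, hi, him⟩ := Finset.exists_max_image s x hs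
  have h : ∑ j ∈ s, x j ≤ s.card * x i := by
    have := Finset.sum_le_card_nsmul s x (x i) him
    simpa [nsmul_eq_mul] using this
  calc _ ≤ (s.card * x i) ^ r := ENNReal.rpow_le_rpow h hr.le
    _ = s.card ^ r * x i ^ r := ENNReal.mul_rpow_of_nonneg _ _ hr.le
    _ ≤ _ := by gcongr; exact Finset.single_le_sum (f := fun i => x i ^ r) (fun _ _ => zero_le) hi

lemma mul_rpow_le {ρ : ℝ} (hρ : 1 ≤ ρ) (x y : ℝ≥0∞) : x * y ^ (ρ - 1) ≤ x ^ ρ + y ^ ρ := by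
  simpa using young_small hρ x y one_ne_zero ENNReal.one_ne_top

lemma sum_rpow_le {ρ : ℝ} (hρ : 1 ≤ ρ) (x : ℕ → ℝ≥0∞) (N : ℕ) :
    ∑ i ∈ Finset.range N, x i ^ ρ ≤ (∑ i ∈ Finset.range N, x i) ^ ρ := by
  induction N with
  | zero => simp
  | succ N ih =>
    rw [Finset.sum_range_succ, Finset.sum_range_succ]
    exact (add_le_add_left ih _).trans (ENNReal.add_rpow_le_rpow_add _ _ hρ)

lemma good_split {ρ : ℝ} (hρ : 1 ≤ ρ) (L : ℕ) (hL : 1 ≤ L) : ∃ C : ℝ≥0∞, C ≠ ∞ ∧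
    ∀ (a : ℕ → ℝ≥0∞) (N : ℕ), (∑ k ∈ Finset.range N, a k) ^ ρ ≤
      C * ∑ k ∈ Finset.range N, a k * (∑ j ∈ Finset.range (k+1-L), a j) ^ (ρ - 1)
      + C * ∑ k ∈ Finset.range N, a k ^ ρ := by
  have hρ0 : 0 < ρ := by linarith
  have hL1 : (1:ℝ≥0∞) ≤ L := by exact_mod_cast hL
  set D : ℝ≥0∞ := ENNReal.ofReal ρ * 2 ^ (ρ - 1) with hD
  have hDt : D ≠ ∞ := ENNReal.mul_ne_top ENNReal.ofReal_ne_top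
    (ENNReal.rpow_ne_top_of_nonneg (by linarith) (by simp))
  refine ⟨D * (2 * L ^ ρ * L), ENNReal.mul_ne_top hDt ?_, fun a N => ?_⟩
  · refine ENNReal.mul_ne_top (ENNReal.mul_ne_top (by simp) ?_) (by simp)
    exact ENNReal.rpow_ne_top_of_nonneg hρ0.le (by simp)
  have hone : (1:ℝ≥0∞) ≤ 2 * L ^ ρ * L := by
    calc (1:ℝ≥0∞) = 1 * 1 * 1 := by simp
      _ ≤ _ := by
        gcongr
        · exact one_le_two
        · exact ENNReal.one_le_rpow hL1 hρ0
  have hpt : ∀ k, a k * (∑ j ∈ Finset.range (k+1), a j) ^ (ρ - 1) ≤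
      2 ^ (ρ - 1) * (a k * (∑ j ∈ Finset.range (k+1-L), a j) ^ (ρ - 1)) +
      2 ^ (ρ - 1) * (2 * L ^ ρ * ∑ j ∈ Finset.Ico (k+1-L) (k+1), a j ^ ρ) := by
    intro k
    have e : ∑ j ∈ Finset.range (k+1), a j =
        ∑ j ∈ Finset.range (k+1-L), a j + ∑ j ∈ Finset.Ico (k+1-L) (k+1), a j :=
      (Finset.sum_range_add_sum_Ico a (by omega)).symm
    rw [e]
    set F := ∑ j ∈ Finset.range (k+1-L), a j
    set G := ∑ j ∈ Finset.Ico (k+1-L) (k+1), a j with hG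
    have hak : a k ≤ G := Finset.single_le_sum (f := a) (fun _ _ => zero_le)
      (Finset.mem_Ico.2 ⟨by omega, by omega⟩)
    have h2 : a k * G ^ (ρ - 1) ≤ 2 * L ^ ρ * ∑ j ∈ Finset.Ico (k+1-L) (k+1), a j ^ ρ := by
      calc a k * G ^ (ρ - 1) ≤ a k ^ ρ + G ^ ρ := mul_rpow_le hρ _ _
        _ ≤ G ^ ρ + G ^ ρ := by gcongr
        _ = 2 * G ^ ρ := (two_mul _).symm
        _ ≤ 2 * (L ^ ρ * ∑ j ∈ Finset.Ico (k+1-L) (k+1), a j ^ ρ) := by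
          gcongr
          refine (rpow_finsum_le _ _ hρ0).trans ?_
          gcongr
          simp; omega
        _ = _ := by ring
    calc a k * (F + G) ^ (ρ - 1) ≤ a k * (2 ^ (ρ - 1) * (F ^ (ρ - 1) + G ^ (ρ - 1))) := by
          gcongr; exact rpow_add_le_mul _ _ (by linarith)
      _ = 2 ^ (ρ - 1) * (a k * F ^ (ρ - 1)) + 2 ^ (ρ - 1) * (a k * G ^ (ρ - 1)) := by ring
      _ ≤ _ := by gcongr
  have hsw : ∑ k ∈ Finset.range N, ∑ j ∈ Finset.Ico (k+1-L) (k+1), a j ^ ρ ≤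
      L * ∑ k ∈ Finset.range N, a k ^ ρ := by
    rw [Finset.sum_comm' (t' := Finset.range N) (s' := fun j => (Finset.Ico j (j+L)).filter (· < N))
      (by intro x y; simp; omega)]
    rw [Finset.mul_sum]
    apply Finset.sum_le_sum
    intro j _
    rw [Finset.sum_const, nsmul_eq_mul]
    gcongr
    exact (Finset.card_filter_le _ _).trans (by simp)
  calc _ ≤ ENNReal.ofReal ρ * ∑ k ∈ Finset.range N, a k * (∑ j ∈ Finset.range (k+1), a j) ^ (ρ - 1) :=
        rpow_sum_le hρ a N
    _ ≤ ENNReal.ofReal ρ * ∑ k ∈ Finset.range N,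
        (2 ^ (ρ - 1) * (a k * (∑ j ∈ Finset.range (k+1-L), a j) ^ (ρ - 1)) +
      2 ^ (ρ - 1) * (2 * L ^ ρ * ∑ j ∈ Finset.Ico (k+1-L) (k+1), a j ^ ρ)) := by
        gcongr with k _; exact hpt k
    _ = D * 1 * ∑ k ∈ Finset.range N, a k * (∑ j ∈ Finset.range (k+1-L), a j) ^ (ρ - 1) +
        D * (2 * L ^ ρ) * ∑ k ∈ Finset.range N, ∑ j ∈ Finset.Ico (k+1-L) (k+1), a j ^ ρ := by
        rw [Finset.sum_add_distrib, ← Finset.mul_sum, ← Finset.mul_sum, ← Finset.mul_sum, hD]; ring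
    _ ≤ D * (2 * L ^ ρ * L) * ∑ k ∈ Finset.range N, a k * (∑ j ∈ Finset.range (k+1-L), a j) ^ (ρ - 1) +
        D * (2 * L ^ ρ) * (L * ∑ k ∈ Finset.range N, a k ^ ρ) := by gcongr
    _ = _ := by ring

lemma absorb {X Y C : ℝ≥0∞} (hX : X ≠ ∞) (h : X ≤ C * Y + 2⁻¹ * X) : X ≤ 2 * C * Y := by
  have h1 : 2⁻¹ * X ≤ C * Y := by
    have h2 : 2⁻¹ * X + 2⁻¹ * X ≤ C * Y + 2⁻¹ * X := by
      rwa [← add_mul, ENNReal.inv_two_add_inv_two, one_mul]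
    exact (ENNReal.add_le_add_iff_right (ENNReal.mul_ne_top (by simp) hX)).1 h2
  calc X = 2 * (2⁻¹ * X) := by rw [← mul_assoc, ENNReal.mul_inv_cancel (by simp) (by simp), one_mul]
    _ ≤ 2 * (C * Y) := by gcongr
    _ = _ := by ring

lemma lint_mono_pow_sum {ρ : ℝ} (hρ : 1 ≤ ρ) (h : ℕ → Rn n → ℝ≥0∞) (hm : ∀ k, Measurable (h k)) (N : ℕ) :
    ∑ k ∈ Finset.range N, ∫⁻ x, h k x ^ ρ ≤ ∫⁻ x, (∑ k ∈ Finset.range N, h k x) ^ ρ := by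
  rw [← lintegral_finsetSum _ (fun k _ => by fun_prop)]
  exact lintegral_mono fun x => sum_rpow_le hρ (fun k => h k x) N

/-- dual Doob inequality for the exponential kernels, finite version -/
lemma dual_exp_fin (n : ℕ) {ρ : ℝ} (hρ : 1 ≤ ρ) : ∃ C : ℝ≥0∞, C ≠ ∞ ∧ ∀ (t : ℝ), 0 < t →
    ∀ (h : ℕ → Rn n → ℝ≥0∞), (∀ k, Measurable (h k)) → ∀ N : ℕ,
    ∫⁻ x, (∑ k ∈ Finset.range N, cv (We (t * 2 ^ k)) (h k) x) ^ ρ ≤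
      C * ∫⁻ x, (∑ k ∈ Finset.range N, h k x) ^ ρ := by
  have hρ0 : 0 < ρ := by linarith
  obtain ⟨A, hA, hAi⟩ := We_int n
  obtain ⟨L, hL1, hL⟩ : ∃ L : ℕ, 1 ≤ L ∧ (ρ - 1) * (1/2) ^ L ≤ 1/2 := by
    have h1 : Tendsto (fun L : ℕ => (ρ - 1) * (1/2 : ℝ) ^ L) atTop (𝓝 ((ρ - 1) * 0)) :=
      (tendsto_pow_atTop_nhds_zero_of_lt_one (by norm_num) (by norm_num)).const_mul _
    rw [mul_zero] at h1
    obtain ⟨L, h2, h3⟩ := ((h1.eventually_le_const (by norm_num : (0:ℝ) < 1/2)).and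
      (eventually_ge_atTop 1)).exists
    exact ⟨L, h3, h2⟩
  obtain ⟨C, hC, hsplit⟩ := good_split hρ L hL1
  set M : ℝ≥0∞ := 2 * (C * A + 1) with hM
  have hM0 : M ≠ 0 := by simp [hM]
  have hMt : M ≠ ∞ := ENNReal.mul_ne_top (by simp) (by finiteness)
  have hAint : ∀ t : ℝ, 0 < t → ∫⁻ y : Rn n, We t y ≤ A := by
    intro t ht
    refine le_trans (lintegral_mono fun y => ?_) (hAi t ht)
    unfold We
    apply ENNReal.ofReal_le_ofReal
    gcongr
    have : 0 ≤ t * ‖y‖ := by positivity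
    linarith
  refine ⟨2 * (C * A * M ^ (ρ - 1) + C * A ^ ρ + 1), ?_, fun t ht h hm N => ?_⟩
  · have h1 : M ^ (ρ - 1) ≠ ∞ := ENNReal.rpow_ne_top_of_nonneg (by linarith) hMt
    have h2 : A ^ ρ ≠ ∞ := ENNReal.rpow_ne_top_of_nonneg (by linarith) hA
    finiteness
  set Y := ∫⁻ x, (∑ k ∈ Finset.range N, h k x) ^ ρ with hY
  by_cases hYt : Y = ∞
  · rw [hYt, ENNReal.mul_top (by simp)]; exact le_top
  set a : ℕ → Rn n → ℝ≥0∞ := fun k => cv (We (t * 2 ^ k)) (h k) with ha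
  have ham : ∀ k, Measurable (a k) := fun k => cv_meas (We_meas _) (hm k)
  have hta : ∀ k, ∫⁻ x, a k x ^ ρ ≤ A ^ ρ * ∫⁻ x, h k x ^ ρ := fun k =>
    cv_Lp (We_meas _) (hm k) hρ (We_even _) (hAint _ (by positivity))
  have hsum : ∑ k ∈ Finset.range N, ∫⁻ x, a k x ^ ρ ≤ A ^ ρ * Y := by
    calc _ ≤ ∑ k ∈ Finset.range N, A ^ ρ * ∫⁻ x, h k x ^ ρ := Finset.sum_le_sum fun k _ => hta k
      _ = A ^ ρ * ∑ k ∈ Finset.range N, ∫⁻ x, h k x ^ ρ := (Finset.mul_sum _ _ _).symm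
      _ ≤ _ := by gcongr; exact lint_mono_pow_sum hρ h hm N
  set X := ∫⁻ x, (∑ k ∈ Finset.range N, a k x) ^ ρ with hX
  have hXt : X ≠ ∞ := by
    refine ne_of_lt ?_
    calc X ≤ ∫⁻ x, ((Finset.range N).card : ℝ≥0∞) ^ ρ * ∑ k ∈ Finset.range N, a k x ^ ρ :=
          lintegral_mono fun x => rpow_finsum_le _ _ hρ0
      _ = ((Finset.range N).card : ℝ≥0∞) ^ ρ * ∑ k ∈ Finset.range N, ∫⁻ x, a k x ^ ρ := by
          rw [lintegral_const_mul _ (by fun_prop), lintegral_finsetSum _ (fun k _ => by fun_prop)]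
      _ ≤ ((Finset.range N).card : ℝ≥0∞) ^ ρ * (A ^ ρ * Y) := by gcongr
      _ < ∞ := by
          have h1 : ((Finset.range N).card : ℝ≥0∞) ^ ρ ≠ ∞ := ENNReal.rpow_ne_top_of_nonneg (by linarith) (by simp)
          have h2 : A ^ ρ ≠ ∞ := ENNReal.rpow_ne_top_of_nonneg (by linarith) hA
          finiteness
  -- main term
  have hmain : ∀ k ∈ Finset.range N,
      ∫⁻ x, a k x * (∑ j ∈ Finset.range (k+1-L), a j x) ^ (ρ - 1) ≤
      A * ∫⁻ x, h k x * (∑ j ∈ Finset.range N, a j x) ^ (ρ - 1) := by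
    intro k hk
    have hk' := Finset.mem_range.1 hk
    rw [ha]
    dsimp only
    rw [cv_adj (We_meas _) (hm k) (v := fun x => (∑ j ∈ Finset.range (k+1-L), a j x) ^ (ρ - 1))
      (by fun_prop) (We_even _)]
    rw [← lintegral_const_mul' _ _ hA]
    apply lintegral_mono
    intro x
    dsimp only
    rw [mul_left_comm]
    gcongr
    rw [cv_alt]
    set τ := t * 2 ^ k with hτ
    have hτ0 : 0 < τ := by positivity
    have hF : ∀ z : Rn n, We τ z * (∑ j ∈ Finset.range (k+1-L), a j (x - z)) ^ (ρ - 1) ≤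
        ENNReal.ofReal (τ ^ n * Real.exp (-(τ * ‖z‖ / 2))) * 
        (∑ j ∈ Finset.range N, a j x) ^ (ρ - 1) := by
      intro z
      have h1 : ∑ j ∈ Finset.range (k+1-L), a j (x - z) ≤
          ENNReal.ofReal (Real.exp (τ * (1/2) ^ L * ‖z‖)) * ∑ j ∈ Finset.range N, a j x := by
        rw [Finset.mul_sum]
        calc _ ≤ ∑ j ∈ Finset.range (k+1-L),
              ENNReal.ofReal (Real.exp (τ * (1/2) ^ L * ‖z‖)) * a j x := by
              apply Finset.sum_le_sum
              intro j hj
              have hj' := Finset.mem_range.1 hj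
              rw [ha]; dsimp only; unfold cv
              rw [← lintegral_const_mul' _ _ ENNReal.ofReal_ne_top]
              apply lintegral_mono; intro w; dsimp only
              rw [← mul_assoc]
              gcongr
              rw [show x - z - w = (x - w) - z by abel]
              refine (We_mul (x - w) z (by positivity)).trans ?_
              refine mul_le_mul_left (ENNReal.ofReal_le_ofReal (Real.exp_le_exp.2
                (mul_le_mul_of_nonneg_right ?_ (norm_nonneg z)))) _
              rw [hτ, mul_assoc]
              refine mul_le_mul_of_nonneg_left ?_ ht.le
              obtain ⟨d, rfl⟩ : ∃ d, k = d + j + L := ⟨k - j - L, by omega⟩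
              rw [pow_add, mul_assoc, ← mul_pow]
              norm_num
              rw [pow_add]
              have : (1:ℝ) ≤ 2 ^ d := one_le_pow₀ (by norm_num)
              nlinarith [show (0:ℝ) < 2 ^ j by positivity]
          _ ≤ _ := Finset.sum_le_sum_of_subset (by
              intro j hj; simp at hj ⊢; omega)
      calc _ ≤ We τ z * (ENNReal.ofReal (Real.exp (τ * (1/2) ^ L * ‖z‖)) * ∑ j ∈ Finset.range N, a j x) ^ (ρ - 1) := by
            gcongr
        _ = (We τ z * ENNReal.ofReal (Real.exp (τ * (1/2) ^ L * ‖z‖)) ^ (ρ - 1)) *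
            (∑ j ∈ Finset.range N, a j x) ^ (ρ - 1) := by
            rw [ENNReal.mul_rpow_of_nonneg _ _ (by linarith)]; ring
        _ ≤ _ := by
            gcongr
            unfold We
            rw [ENNReal.ofReal_rpow_of_pos (by positivity), ← ENNReal.ofReal_mul (by positivity)]
            apply ENNReal.ofReal_le_ofReal
            rw [← Real.exp_mul, mul_assoc, ← Real.exp_add]
            gcongr
            have : 0 ≤ τ * ‖z‖ := by positivity
            nlinarith
    calc _ ≤ _ := lintegral_mono hF
      _ = (∫⁻ z : Rn n, ENNReal.ofReal (τ ^ n * Real.exp (-(τ * ‖z‖ / 2)))) * _ :=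
          lintegral_mul_const _ (by fun_prop)
      _ ≤ A * _ := by gcongr; exact hAi τ hτ0
  have hfin : X ≤ (C * A * M ^ (ρ - 1) + C * A ^ ρ + 1) * Y + 2⁻¹ * X := by
    calc X ≤ ∫⁻ x, (C * ∑ k ∈ Finset.range N, a k x * (∑ j ∈ Finset.range (k+1-L), a j x) ^ (ρ - 1)
            + C * ∑ k ∈ Finset.range N, a k x ^ ρ) := lintegral_mono fun x => hsplit (fun k => a k x) N
      _ = C * ∑ k ∈ Finset.range N, (∫⁻ x, a k x * (∑ j ∈ Finset.range (k+1-L), a j x) ^ (ρ - 1))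
            + C * ∑ k ∈ Finset.range N, ∫⁻ x, a k x ^ ρ := by
          rw [lintegral_add_left (by fun_prop), lintegral_const_mul _ (by fun_prop),
            lintegral_const_mul _ (by fun_prop), lintegral_finsetSum _ (fun k _ => by fun_prop),
            lintegral_finsetSum _ (fun k _ => by fun_prop)]
      _ ≤ C * ∑ k ∈ Finset.range N, (A * ∫⁻ x, h k x * (∑ j ∈ Finset.range N, a j x) ^ (ρ - 1))
            + C * (A ^ ρ * Y) := by
          gcongr with k hk
          exact hmain k hk
      _ = C * A * (∫⁻ x, (∑ k ∈ Finset.range N, h k x) * (∑ j ∈ Finset.range N, a j x) ^ (ρ - 1))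
            + C * (A ^ ρ * Y) := by
          simp_rw [Finset.sum_mul]
          rw [← Finset.mul_sum, lintegral_finsetSum _ (fun k _ => by fun_prop), mul_assoc]
      _ ≤ C * A * (∫⁻ x, (M ^ (ρ - 1) * (∑ k ∈ Finset.range N, h k x) ^ ρ +
            M⁻¹ * (∑ j ∈ Finset.range N, a j x) ^ ρ)) + C * (A ^ ρ * Y) := by
          gcongr with x
          exact young_small hρ _ _ hM0 hMt
      _ = C * A * (M ^ (ρ - 1) * Y + M⁻¹ * X) + C * (A ^ ρ * Y) := by
          rw [lintegral_add_left (by fun_prop), lintegral_const_mul _ (by fun_prop),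
            lintegral_const_mul _ (by fun_prop)]
      _ = (C * A * M ^ (ρ - 1) + C * A ^ ρ) * Y + (C * A * M⁻¹) * X := by ring
      _ ≤ _ := by
          refine add_le_add (mul_le_mul_left le_self_add _) (mul_le_mul_left ?_ _)
          rw [← div_eq_mul_inv]
          rw [ENNReal.div_le_iff hM0 hMt, hM, ← mul_assoc, ENNReal.inv_mul_cancel (by simp) (by simp), one_mul]
          exact le_self_add
  exact absorb hXt hfin

end Sub
end

noncomputable section
open MeasureTheory Filter Metric Real Set SchwartzMap
open scoped ENNReal NNReal Topology FourierTransform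
namespace Sub
variable {n : ℕ}

lemma Kp_le (m : ℝ) (hm : 0 ≤ m) {t : ℝ} (ht : 0 < t) (x : Rn n) :
    Kp m t x ≤ ∑' i : ℕ, (ENNReal.ofReal (Real.exp 2 * 2 ^ (-(i:ℝ) * (m - n)))) * We ((1/2) ^ i * t) x := by
  set u := t * ‖x‖ with hu
  have hu0 : 0 ≤ u := by positivity
  obtain ⟨i, hi1, hi2⟩ := exists_nat_pow_near (x := 1 + u) (y := 2) (by linarith) (by norm_num)
  refine le_trans ?_ (ENNReal.le_tsum i)
  unfold Kp We
  rw [← ENNReal.ofReal_mul (by positivity)]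
  apply ENNReal.ofReal_le_ofReal
  have e1 : ((1/2:ℝ) ^ i * t) ^ n = 2 ^ (-(i:ℝ) * n) * t ^ n := by
    rw [mul_pow, ← pow_mul, one_div, inv_pow, neg_mul, Real.rpow_neg (by norm_num)]
    norm_cast
  have e2 : (2:ℝ) ^ (-(i:ℝ) * (m - n)) * 2 ^ (-(i:ℝ) * n) = (2 ^ i) ^ (-m) := by
    rw [← Real.rpow_add (by norm_num), ← Real.rpow_natCast, ← Real.rpow_mul (by norm_num)]
    congr 1; ring
  have e3 : (1 + u) ^ (-m) ≤ (2 ^ i : ℝ) ^ (-m) :=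
    Real.rpow_le_rpow_of_nonpos (by positivity) hi1 (by linarith)
  have e4 : 1 ≤ Real.exp 2 * Real.exp (-((1/2) ^ i * t * ‖x‖)) := by
    rw [← Real.exp_add]
    apply Real.one_le_exp
    have : (1/2:ℝ) ^ i * t * ‖x‖ = u / 2 ^ i := by rw [hu, one_div, inv_pow]; field_simp
    rw [this]
    have : u / 2 ^ i ≤ 2 := by
      rw [div_le_iff₀ (by positivity), mul_comm, ← pow_succ]; linarith
    linarith
  rw [e1]
  calc t ^ n * (1 + u) ^ (-m) ≤ t ^ n * (2 ^ i : ℝ) ^ (-m) * 1 := by rw [mul_one]; gcongr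
    _ ≤ t ^ n * (2 ^ i : ℝ) ^ (-m) * (Real.exp 2 * Real.exp (-((1/2) ^ i * t * ‖x‖))) := by gcongr
    _ = _ := by rw [← e2]; ring

lemma dual_poly (n : ℕ) {m : ℝ} (hm : (n:ℝ) < m) {ρ : ℝ} (hρ : 1 ≤ ρ) : ∃ C : ℝ≥0∞, C ≠ ∞ ∧
    ∀ (h : ℕ → Rn n → ℝ≥0∞), (∀ k, Measurable (h k)) → ∀ N : ℕ,
    ∫⁻ x, (∑ k ∈ Finset.range N, cv (Kp m (2 ^ k)) (h k) x) ^ ρ ≤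
      C * ∫⁻ x, (∑ k ∈ Finset.range N, h k x) ^ ρ := by
  obtain ⟨C, hC, hD⟩ := dual_exp_fin n hρ
  have hm0 : 0 ≤ m := le_trans (by positivity) hm.le
  set c : ℕ → ℝ≥0∞ := fun i => ENNReal.ofReal (Real.exp 2 * 2 ^ (-(i:ℝ) * (m - n))) with hc
  have hcs : ∑' i, c i ≠ ∞ := by
    have hs : Summable fun i : ℕ => Real.exp 2 * (2:ℝ) ^ (-(i:ℝ) * (m - n)) := by
      apply Summable.mul_left
      have : ∀ i : ℕ, (2:ℝ) ^ (-(i:ℝ) * (m - n)) = ((2:ℝ) ^ (-(m - n))) ^ i := by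
        intro i; rw [← Real.rpow_natCast, ← Real.rpow_mul (by norm_num)]; congr 1; ring
      simp_rw [this]
      apply summable_geometric_of_lt_one (by positivity)
      apply Real.rpow_lt_one_of_one_lt_of_neg (by norm_num) (by linarith)
    rw [← ENNReal.ofReal_tsum_of_nonneg (fun i => by positivity) hs]
    exact ENNReal.ofReal_ne_top
  set cs := ∑' i, c i
  refine ⟨cs ^ (ρ - 1) * (cs * C), ?_, fun h hmm N => ?_⟩
  · have : cs ^ (ρ - 1) ≠ ∞ := ENNReal.rpow_ne_top_of_nonneg (by linarith) hcs
    finiteness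
  set X : ℕ → Rn n → ℝ≥0∞ := fun i x => ∑ k ∈ Finset.range N, cv (We ((1/2) ^ i * 2 ^ k)) (h k) x with hX
  have hXm : ∀ i, Measurable (X i) := fun i => by
    have : ∀ k, Measurable (cv (We ((1/2) ^ i * 2 ^ k)) (h k)) := fun k => cv_meas (We_meas _) (hmm k)
    rw [hX]; fun_prop
  have h1 : ∀ x, ∑ k ∈ Finset.range N, cv (Kp m (2 ^ k)) (h k) x ≤ ∑' i, c i * X i x := by
    intro x
    have h2 : ∀ k, cv (Kp m (2 ^ k)) (h k) x ≤ ∑' i, c i * cv (We ((1/2) ^ i * 2 ^ k)) (h k) x := by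
      intro k
      calc _ ≤ ∫⁻ z, (∑' i : ℕ, c i * We ((1/2) ^ i * 2 ^ k) (x - z)) * h k z :=
            lintegral_mono fun z => mul_le_mul_left (Kp_le m hm0 (by positivity) _) _
        _ = ∫⁻ z, ∑' i : ℕ, c i * (We ((1/2) ^ i * 2 ^ k) (x - z) * h k z) := by
            congr 1; funext z; rw [← ENNReal.tsum_mul_right]; simp_rw [mul_assoc]
        _ = ∑' i, c i * cv (We ((1/2) ^ i * 2 ^ k)) (h k) x := by
            have hwm : ∀ i : ℕ, Measurable fun z => We ((1/2) ^ i * 2 ^ k) (x - z) * h k z := fun i =>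
              ((We_meas _).comp (by fun_prop)).mul (hmm k)
            rw [lintegral_tsum (fun i => ((hwm i).const_mul _).aemeasurable)]
            congr 1; funext i
            rw [lintegral_const_mul _ (hwm i)]; rfl
    calc _ ≤ ∑ k ∈ Finset.range N, ∑' i, c i * cv (We ((1/2) ^ i * 2 ^ k)) (h k) x :=
          Finset.sum_le_sum fun k _ => h2 k
      _ = ∑' i, ∑ k ∈ Finset.range N, c i * cv (We ((1/2) ^ i * 2 ^ k)) (h k) x :=
          (Summable.tsum_finsetSum fun k _ => ENNReal.summable).symm
      _ = _ := by simp_rw [hX, Finset.mul_sum]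
  calc _ ≤ ∫⁻ x, cs ^ (ρ - 1) * ∑' i, c i * X i x ^ ρ := lintegral_mono fun x =>
        (ENNReal.rpow_le_rpow (h1 x) (by linarith)).trans (jensen_tsum c (fun i => X i x) hρ)
    _ = cs ^ (ρ - 1) * ∑' i, c i * ∫⁻ x, X i x ^ ρ := by
        rw [lintegral_const_mul _ (by fun_prop), lintegral_tsum (fun i => by fun_prop)]
        congr 2; funext i
        rw [lintegral_const_mul _ (by fun_prop)]
    _ ≤ cs ^ (ρ - 1) * ∑' i, c i * (C * ∫⁻ x, (∑ k ∈ Finset.range N, h k x) ^ ρ) := by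
        gcongr with i
        exact hD _ (by positivity) h hmm N
    _ = _ := by rw [ENNReal.tsum_mul_right]; ring

lemma vv_le (n : ℕ) {m : ℝ} (hm : (n:ℝ) < m) {P Q : ℝ} (hQ : 1 ≤ Q) (hQP : Q ≤ P) :
    ∃ C : ℝ≥0∞, C ≠ ∞ ∧
    ∀ (g : ℕ → Rn n → ℝ≥0∞), (∀ k, Measurable (g k)) → ∀ N : ℕ,
    ∫⁻ x, (∑ k ∈ Finset.range N, (cv (Kp m (2 ^ k)) (g k) x) ^ Q) ^ (P / Q) ≤
      C * ∫⁻ x, (∑ k ∈ Finset.range N, g k x ^ Q) ^ (P / Q) := by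
  have hQ0 : 0 < Q := by linarith
  have hr : 1 ≤ P / Q := by rwa [le_div_iff₀ hQ0, one_mul]
  obtain ⟨C, hC, hD⟩ := dual_poly n hm hr
  obtain ⟨A, hA, hAi⟩ := Kp_int n hm
  have hAt : (A ^ (Q - 1)) ^ (P / Q) ≠ ∞ := ENNReal.rpow_ne_top_of_nonneg (by linarith)
    (ENNReal.rpow_ne_top_of_nonneg (by linarith) hA)
  refine ⟨(A ^ (Q - 1)) ^ (P / Q) * C, by finiteness, fun g hg N => ?_⟩
  have hcm : ∀ k, Measurable (cv (Kp m (2 ^ k)) (fun x => g k x ^ Q)) := fun k =>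
    cv_meas (Kp_meas _ _) (by fun_prop)
  calc _ ≤ ∫⁻ x, (A ^ (Q - 1)) ^ (P / Q) * (∑ k ∈ Finset.range N, cv (Kp m (2 ^ k)) (fun x => g k x ^ Q) x) ^ (P / Q) := by
        apply lintegral_mono; intro x; dsimp only
        rw [← ENNReal.mul_rpow_of_nonneg _ _ (by linarith), Finset.mul_sum]
        gcongr with k
        refine (cv_jensen (Kp_meas _ _) (hg k) hQ x).trans ?_
        gcongr
        exact hAi _ (by positivity)
    _ = (A ^ (Q - 1)) ^ (P / Q) * ∫⁻ x, (∑ k ∈ Finset.range N, cv (Kp m (2 ^ k)) (fun x => g k x ^ Q) x) ^ (P / Q) :=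
        lintegral_const_mul _ (by fun_prop)
    _ ≤ (A ^ (Q - 1)) ^ (P / Q) * (C * ∫⁻ x, (∑ k ∈ Finset.range N, g k x ^ Q) ^ (P / Q)) := by
        gcongr
        exact hD _ (fun k => by fun_prop) N
    _ = _ := by ring

/-- duality absorption -/
lemma vv_absorb {X Y Z C : ℝ≥0∞} {P : ℝ} (hP : 1 < P) (hX : X ≠ ∞) (hC : C ≠ ∞)
    (h : ∀ M : ℝ≥0∞, M ≠ 0 → M ≠ ∞ → X ≤ M ^ (P - 1) * Y + M⁻¹ * Z) (hZ : Z ≤ C * X) :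
    X ≤ (2 * (2 * (C + 1)) ^ (P - 1)) * Y := by
  have hM0 : 2 * (C + 1) ≠ 0 := by simp
  have hMt : 2 * (C + 1) ≠ ∞ := by finiteness
  apply absorb hX
  refine (h _ hM0 hMt).trans (add_le_add le_rfl ?_)
  calc (2 * (C + 1))⁻¹ * Z ≤ (2 * (C + 1))⁻¹ * (C * X) := by gcongr
    _ = C / (2 * (C + 1)) * X := by rw [ENNReal.div_eq_inv_mul]; ring
    _ ≤ 2⁻¹ * X := by
      refine mul_le_mul_left ?_ _
      rw [ENNReal.div_le_iff hM0 hMt, ← mul_assoc, ENNReal.inv_mul_cancel (by simp) (by simp), one_mul]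
      exact le_self_add

lemma young_dual {P : ℝ} (hP : 1 < P) (G V M : ℝ≥0∞) (hM : M ≠ 0) (hM' : M ≠ ∞) :
    G * V ≤ M ^ (P - 1) * G ^ P + M⁻¹ * V ^ (P / (P - 1)) := by
  have h := young_small hP.le G (V ^ (1 / (P - 1))) hM hM'
  rw [← ENNReal.rpow_mul, ← ENNReal.rpow_mul, one_div_mul_cancel (by linarith), ENNReal.rpow_one] at h
  rwa [show 1 / (P - 1) * P = P / (P - 1) by ring] at h

/-- finiteness of finite vector-valued expressions -/
lemma vv_fin {m : ℝ} (hm : (n:ℝ) < m) {P : ℝ} (hP : 1 ≤ P) {Q : ℝ} (hQ : 0 < Q)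
    (g : ℕ → Rn n → ℝ≥0∞) (hg : ∀ k, Measurable (g k)) (N : ℕ)
    (hY : ∫⁻ x, (∑ k ∈ Finset.range N, g k x ^ Q) ^ (P / Q) ≠ ∞) :
    ∫⁻ x, (∑ k ∈ Finset.range N, (cv (Kp m (2 ^ k)) (g k) x) ^ Q) ^ (P / Q) ≠ ∞ := by
  have hPQ : 0 < P / Q := by positivity
  obtain ⟨A, hA, hAi⟩ := Kp_int n hm
  have hcm : ∀ k, Measurable (cv (Kp m (2 ^ k)) (g k)) := fun k => cv_meas (Kp_meas _ _) (hg k)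
  have hAt : A ^ P ≠ ∞ := ENNReal.rpow_ne_top_of_nonneg (by linarith) hA
  have hNt : ((Finset.range N).card : ℝ≥0∞) ^ (P / Q) ≠ ∞ := ENNReal.rpow_ne_top_of_nonneg hPQ.le (by simp)
  refine ne_of_lt ?_
  calc _ ≤ ∫⁻ x, ((Finset.range N).card : ℝ≥0∞) ^ (P / Q) * ∑ k ∈ Finset.range N, (cv (Kp m (2 ^ k)) (g k) x) ^ P := by
        apply lintegral_mono; intro x
        refine (rpow_finsum_le _ _ hPQ).trans (le_of_eq ?_)
        congr 1
        apply Finset.sum_congr rfl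
        intro k _
        rw [← ENNReal.rpow_mul]; congr 1; field_simp
    _ = ((Finset.range N).card : ℝ≥0∞) ^ (P / Q) * ∑ k ∈ Finset.range N, ∫⁻ x, (cv (Kp m (2 ^ k)) (g k) x) ^ P := by
        rw [lintegral_const_mul _ (by fun_prop), lintegral_finsetSum _ (fun k _ => by fun_prop)]
    _ ≤ ((Finset.range N).card : ℝ≥0∞) ^ (P / Q) * ∑ k ∈ Finset.range N,
          (A ^ P * ∫⁻ x, (∑ k ∈ Finset.range N, g k x ^ Q) ^ (P / Q)) := by
        gcongr with k hk
        refine (cv_Lp (Kp_meas _ _) (hg k) hP (Kp_even _ _) (hAi _ (by positivity))).trans ?_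
        gcongr with x
        calc g k x ^ P = (g k x ^ Q) ^ (P / Q) := by rw [← ENNReal.rpow_mul]; congr 1; field_simp
          _ ≤ _ := by
            gcongr
            exact Finset.single_le_sum (f := fun k => g k x ^ Q) (fun _ _ => zero_le) hk
    _ < ∞ := by
        rw [Finset.sum_const, nsmul_eq_mul]
        have : ((Finset.range N).card : ℝ≥0∞) ≠ ∞ := by simp
        finiteness

lemma vv_gt (n : ℕ) {m : ℝ} (hm : (n:ℝ) < m) {P Q : ℝ} (hP : 1 < P) (hQP : P < Q) :
    ∃ C : ℝ≥0∞, C ≠ ∞ ∧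
    ∀ (g : ℕ → Rn n → ℝ≥0∞), (∀ k, Measurable (g k)) → ∀ N : ℕ,
    ∫⁻ x, (∑ k ∈ Finset.range N, (cv (Kp m (2 ^ k)) (g k) x) ^ Q) ^ (P / Q) ≤
      C * ∫⁻ x, (∑ k ∈ Finset.range N, g k x ^ Q) ^ (P / Q) := by
  have hQ1 : 1 < Q := by linarith
  set P' := P / (P - 1) with hP'
  set Q' := Q / (Q - 1) with hQ'
  have hP1 : 0 < P - 1 := by linarith
  have hQ1' : 0 < Q - 1 := by linarith
  have hQ'1 : 1 ≤ Q' := by rw [hQ', le_div_iff₀ hQ1']; linarith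
  have hQ'P' : Q' ≤ P' := by
    rw [hQ', hP', div_le_div_iff₀ hQ1' hP1]; nlinarith
  obtain ⟨C, hC, hD⟩ := vv_le n hm hQ'1 hQ'P'
  have hCt : (2 * (C + 1)) ^ (P - 1) ≠ ∞ := ENNReal.rpow_ne_top_of_nonneg (by linarith) (by finiteness)
  refine ⟨2 * (2 * (C + 1)) ^ (P - 1), by finiteness, fun g hg N => ?_⟩
  set Y := ∫⁻ x, (∑ k ∈ Finset.range N, g k x ^ Q) ^ (P / Q) with hY
  by_cases hYt : Y = ∞
  · rw [hYt, ENNReal.mul_top]; · exact le_top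
    · simp; intro h; linarith
  have hX := vv_fin hm hP.le (by linarith) g hg N hYt
  set b : ℕ → Rn n → ℝ≥0∞ := fun k => cv (Kp m (2 ^ k)) (g k) with hb
  have hbm : ∀ k, Measurable (b k) := fun k => cv_meas (Kp_meas _ _) (hg k)
  set Sb : Rn n → ℝ≥0∞ := fun x => ∑ k ∈ Finset.range N, b k x ^ Q with hSb
  have hSbm : Measurable Sb := by rw [hSb]; fun_prop
  set v : ℕ → Rn n → ℝ≥0∞ := fun k x => b k x ^ (Q - 1) * Sb x ^ (P / Q - 1) with hv
  have hvm : ∀ k, Measurable (v k) := fun k => by rw [hv]; fun_prop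
  set X := ∫⁻ x, Sb x ^ (P / Q) with hXX
  have hPQ : 0 < P / Q := by positivity
  have hZ : ∫⁻ x, (∑ k ∈ Finset.range N, (cv (Kp m (2 ^ k)) (v k) x) ^ Q') ^ (P' / Q') ≤ C * X := by
    refine (hD v hvm N).trans (mul_le_mul_right (lintegral_mono fun x => ?_) _)
    have e1 : ∑ k ∈ Finset.range N, v k x ^ Q' = Sb x * (Sb x ^ (P / Q - 1)) ^ Q' := by
      rw [hSb, Finset.sum_mul]
      apply Finset.sum_congr rfl; intro k _
      rw [hv]; dsimp only
      rw [ENNReal.mul_rpow_of_nonneg _ _ (by linarith), ← ENNReal.rpow_mul]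
      congr 2; rw [hQ']; field_simp
    rw [e1]
    rcases eq_or_ne (Sb x) 0 with h0 | h0
    · rw [h0, zero_mul, ENNReal.zero_rpow_of_pos (by positivity)]; simp
    rcases eq_or_ne (Sb x) ∞ with ht | ht
    · rw [ht, ENNReal.top_rpow_of_pos hPQ]; exact le_top
    rw [← ENNReal.rpow_mul]
    nth_rw 1 [← ENNReal.rpow_one (Sb x)]
    rw [← ENNReal.rpow_add _ _ h0 ht, ← ENNReal.rpow_mul]
    apply le_of_eq; congr 1
    rw [hP', hQ']; field_simp; ring
  refine vv_absorb hP hX hC (fun M hM0 hMt => ?_) hZ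
  have hfin : ∀ᵐ x, Sb x ^ (P / Q) < ∞ := ae_lt_top (by fun_prop) hX
  calc X ≤ ∫⁻ x, ∑ k ∈ Finset.range N, b k x * v k x := by
        apply lintegral_mono_ae
        filter_upwards [hfin] with x hx
        have ht : Sb x ≠ ∞ := by
          intro h; rw [h, ENNReal.top_rpow_of_pos hPQ] at hx; exact lt_irrefl _ hx
        have e1 : ∑ k ∈ Finset.range N, b k x * v k x = Sb x * Sb x ^ (P / Q - 1) := by
          rw [hSb, Finset.sum_mul]
          apply Finset.sum_congr rfl; intro k _
          rw [hv]; dsimp only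
          rw [← mul_assoc]; congr 1
          nth_rw 1 [← ENNReal.rpow_one (b k x)]
          rw [← ENNReal.rpow_add_of_nonneg _ _ zero_le_one hQ1'.le]; congr 1; ring
        rw [e1]
        rcases eq_or_ne (Sb x) 0 with h0 | h0
        · rw [h0, ENNReal.zero_rpow_of_pos hPQ]; simp
        nth_rw 2 [← ENNReal.rpow_one (Sb x)]
        rw [← ENNReal.rpow_add _ _ h0 ht]
        apply le_of_eq; congr 1; ring
    _ = ∑ k ∈ Finset.range N, ∫⁻ x, g k x * cv (Kp m (2 ^ k)) (v k) x := by
        rw [lintegral_finsetSum _ (fun k _ => by fun_prop)]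
        apply Finset.sum_congr rfl; intro k _
        exact cv_adj (Kp_meas _ _) (hg k) (hvm k) (Kp_even _ _)
    _ = ∫⁻ x, ∑ k ∈ Finset.range N, g k x * cv (Kp m (2 ^ k)) (v k) x := by
        have : ∀ k, Measurable (cv (Kp m (2 ^ k)) (v k)) := fun k => cv_meas (Kp_meas _ _) (hvm k)
        rw [lintegral_finsetSum _ (fun k _ => by fun_prop)]
    _ ≤ ∫⁻ x, (M ^ (P - 1) * (∑ k ∈ Finset.range N, g k x ^ Q) ^ (P / Q) + M⁻¹ *
          (∑ k ∈ Finset.range N, (cv (Kp m (2 ^ k)) (v k) x) ^ Q') ^ (P' / Q')) := by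
        apply lintegral_mono; intro x; dsimp only
        have hc : Q.HolderConjugate Q' := Real.HolderConjugate.conjExponent hQ1
        refine (ENNReal.inner_le_Lp_mul_Lq (Finset.range N) _ _ hc).trans ?_
        refine (young_dual hP _ _ M hM0 hMt).trans (le_of_eq ?_)
        rw [← ENNReal.rpow_mul, ← ENNReal.rpow_mul]
        congr 3
        · ring
        · rw [← hP']; ring
    _ = _ := by
        have : ∀ k, Measurable (cv (Kp m (2 ^ k)) (v k)) := fun k => cv_meas (Kp_meas _ _) (hvm k)
        rw [lintegral_add_left (by fun_prop), lintegral_const_mul _ (by fun_prop),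
          lintegral_const_mul _ (by fun_prop)]

end Sub
end

noncomputable section
open MeasureTheory Filter Metric Real Set SchwartzMap
open scoped ENNReal NNReal Topology FourierTransform
namespace Sub
variable {n : ℕ}

def supN (b : ℕ → ℝ≥0∞) (N : ℕ) : ℝ≥0∞ := (Finset.range N).sup b

lemma supN_succ (b : ℕ → ℝ≥0∞) (N : ℕ) : supN b (N+1) = b N ⊔ supN b N := by
  unfold supN; rw [Finset.range_add_one, Finset.sup_insert]

lemma supN_meas {b : ℕ → Rn n → ℝ≥0∞} (hb : ∀ k, Measurable (b k)) (N : ℕ) :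
    Measurable fun x => supN (fun k => b k x) N := by
  induction N with
  | zero => simp [supN]
  | succ N ih => simp only [supN_succ]; exact (hb N).sup ih

lemma le_supN (b : ℕ → ℝ≥0∞) {N k : ℕ} (hk : k ∈ Finset.range N) : b k ≤ supN b N :=
  Finset.le_sup (f := b) hk

lemma supN_rpow_le (b : ℕ → ℝ≥0∞) (N : ℕ) {P : ℝ} (hP : 0 < P) :
    supN b N ^ P ≤ ∑ k ∈ Finset.range N, b k ^ P := by
  induction N with
  | zero => simp [supN, hP]
  | succ N ih =>
    rw [supN_succ, Finset.sum_range_succ]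
    rcases le_total (b N) (supN b N) with h | h
    · rw [sup_eq_right.2 h]; exact ih.trans le_self_add
    · rw [sup_eq_left.2 h]; exact le_add_self

lemma exists_weights {b : ℕ → Rn n → ℝ≥0∞} (hb : ∀ k, Measurable (b k)) (N : ℕ) :
    ∃ w : ℕ → Rn n → ℝ≥0∞, (∀ k, Measurable (w k)) ∧ (∀ x, ∑ k ∈ Finset.range N, w k x ≤ 1) ∧
      ∀ x, ∑ k ∈ Finset.range N, b k x * w k x = supN (fun k => b k x) N := by
  induction N with
  | zero => exact ⟨fun _ _ => 0, fun _ => measurable_const, by simp, by simp [supN]⟩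
  | succ N ih =>
    obtain ⟨w, hw, h1, h2⟩ := ih
    have hs : MeasurableSet {x | supN (fun k => b k x) N < b N x} :=
      measurableSet_lt (supN_meas hb N) (hb N)
    classical
    refine ⟨fun k x => if supN (fun k => b k x) N < b N x then (if k = N then 1 else 0)
      else (if k = N then 0 else w k x), fun k => ?_, fun x => ?_, fun x => ?_⟩
    · by_cases hk : k = N
      · simp only [hk, if_true]; exact Measurable.ite hs measurable_const measurable_const
      · simp only [hk, if_false]; exact Measurable.ite hs measurable_const (hw k)
    · by_cases h : supN (fun k => b k x) N < b N x
      · simp [h]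
      · simp only [h, if_false]
        rw [Finset.sum_range_succ]
        simp only [if_true, add_zero]
        refine le_trans (le_of_eq (Finset.sum_congr rfl fun k hk => ?_)) (h1 x)
        rw [if_neg (by simp at hk; omega)]
    · rw [supN_succ, Finset.sum_range_succ]
      by_cases h : supN (fun k => b k x) N < b N x
      · simp only [h, if_true, mul_one, sup_eq_left.2 h.le]
        rw [Finset.sum_eq_zero, zero_add]
        intro k hk
        rw [if_neg (by simp at hk; omega), mul_zero]
      · simp only [h, if_false, if_true, mul_zero, add_zero, sup_eq_right.2 (not_lt.1 h)]
        rw [← h2 x]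
        refine Finset.sum_congr rfl fun k hk => ?_
        rw [if_neg (by simp at hk; omega)]

lemma vv_top (n : ℕ) {m : ℝ} (hm : (n:ℝ) < m) {P : ℝ} (hP : 1 < P) :
    ∃ C : ℝ≥0∞, C ≠ ∞ ∧
    ∀ (g : ℕ → Rn n → ℝ≥0∞), (∀ k, Measurable (g k)) → ∀ N : ℕ,
    ∫⁻ x, (supN (fun k => cv (Kp m (2 ^ k)) (g k) x) N) ^ P ≤
      C * ∫⁻ x, (supN (fun k => g k x) N) ^ P := by
  set P' := P / (P - 1) with hP'
  have hP1 : 0 < P - 1 := by linarith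
  have hP'1 : 1 ≤ P' := by rw [hP', le_div_iff₀ hP1]; linarith
  obtain ⟨C, hC, hD⟩ := dual_poly n hm hP'1
  have hCt : (2 * (C + 1)) ^ (P - 1) ≠ ∞ := ENNReal.rpow_ne_top_of_nonneg (by linarith) (by finiteness)
  refine ⟨2 * (2 * (C + 1)) ^ (P - 1), by finiteness, fun g hg N => ?_⟩
  set Y := ∫⁻ x, (supN (fun k => g k x) N) ^ P with hY
  by_cases hYt : Y = ∞
  · rw [hYt, ENNReal.mul_top]; · exact le_top
    · simp; intro h; linarith
  set b : ℕ → Rn n → ℝ≥0∞ := fun k => cv (Kp m (2 ^ k)) (g k) with hb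
  have hbm : ∀ k, Measurable (b k) := fun k => cv_meas (Kp_meas _ _) (hg k)
  set H : Rn n → ℝ≥0∞ := fun x => supN (fun k => b k x) N with hH
  have hHm : Measurable H := supN_meas hbm N
  have hGm := supN_meas hg N
  have hX : ∫⁻ x, H x ^ P ≠ ∞ := by
    obtain ⟨A, hA, hAi⟩ := Kp_int n hm
    have hAt : A ^ P ≠ ∞ := ENNReal.rpow_ne_top_of_nonneg (by linarith) hA
    refine ne_of_lt ?_
    calc _ ≤ ∫⁻ x, ∑ k ∈ Finset.range N, b k x ^ P :=
          lintegral_mono fun x => supN_rpow_le _ _ (by linarith)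
      _ = ∑ k ∈ Finset.range N, ∫⁻ x, b k x ^ P := lintegral_finsetSum _ (fun k _ => by fun_prop)
      _ ≤ ∑ k ∈ Finset.range N, A ^ P * Y := by
          refine Finset.sum_le_sum fun k hk => ?_
          refine (cv_Lp (Kp_meas _ _) (hg k) hP.le (Kp_even _ _) (hAi _ (by positivity))).trans ?_
          refine mul_le_mul_right (lintegral_mono fun x => ?_) _
          exact ENNReal.rpow_le_rpow (le_supN (fun k => g k x) hk) (by linarith)
      _ < ∞ := by
          rw [Finset.sum_const, nsmul_eq_mul]
          finiteness
  obtain ⟨w, hw, hw1, hw2⟩ := exists_weights hbm N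
  set v : ℕ → Rn n → ℝ≥0∞ := fun k x => w k x * H x ^ (P - 1) with hv
  have hvm : ∀ k, Measurable (v k) := fun k => by rw [hv]; fun_prop
  have hZ : ∫⁻ x, (∑ k ∈ Finset.range N, (cv (Kp m (2 ^ k)) (v k) x)) ^ P' ≤ C * ∫⁻ x, H x ^ P := by
    refine (hD v hvm N).trans (mul_le_mul_right (lintegral_mono fun x => ?_) _)
    have e1 : ∑ k ∈ Finset.range N, v k x ≤ H x ^ (P - 1) := by
      rw [hv]; dsimp only; rw [← Finset.sum_mul]
      calc _ ≤ 1 * H x ^ (P-1) := by gcongr; exact hw1 x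
        _ = _ := one_mul _
    calc _ ≤ (H x ^ (P - 1)) ^ P' := ENNReal.rpow_le_rpow e1 (by linarith)
      _ = _ := by rw [← ENNReal.rpow_mul]; congr 1; rw [hP']; field_simp
  refine vv_absorb hP hX hC (fun M hM0 hMt => ?_) hZ
  calc ∫⁻ x, H x ^ P ≤ ∫⁻ x, ∑ k ∈ Finset.range N, b k x * v k x := by
        apply lintegral_mono; intro x; dsimp only
        have e1 : ∑ k ∈ Finset.range N, b k x * v k x = H x * H x ^ (P - 1) := by
          conv_rhs => enter [1]; rw [hH]
          dsimp only
          rw [← hw2, Finset.sum_mul]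
          apply Finset.sum_congr rfl; intro k _
          rw [hv]; ring
        rw [e1]
        nth_rw 2 [← ENNReal.rpow_one (H x)]
        rw [← ENNReal.rpow_add_of_nonneg _ _ zero_le_one hP1.le]
        apply le_of_eq; congr 1; ring
    _ = ∑ k ∈ Finset.range N, ∫⁻ x, g k x * cv (Kp m (2 ^ k)) (v k) x := by
        rw [lintegral_finsetSum _ (fun k _ => by fun_prop)]
        apply Finset.sum_congr rfl; intro k _
        exact cv_adj (Kp_meas _ _) (hg k) (hvm k) (Kp_even _ _)
    _ = ∫⁻ x, ∑ k ∈ Finset.range N, g k x * cv (Kp m (2 ^ k)) (v k) x := by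
        have : ∀ k, Measurable (cv (Kp m (2 ^ k)) (v k)) := fun k => cv_meas (Kp_meas _ _) (hvm k)
        rw [lintegral_finsetSum _ (fun k _ => by fun_prop)]
    _ ≤ ∫⁻ x, (M ^ (P - 1) * (supN (fun k => g k x) N) ^ P + M⁻¹ *
          (∑ k ∈ Finset.range N, (cv (Kp m (2 ^ k)) (v k) x)) ^ P') := by
        apply lintegral_mono; intro x; dsimp only
        refine le_trans ?_ (young_dual hP _ _ M hM0 hMt)
        rw [Finset.mul_sum]
        refine Finset.sum_le_sum fun k hk => mul_le_mul_left (le_supN (fun k => g k x) hk) _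
    _ = _ := by
        have : ∀ k, Measurable (cv (Kp m (2 ^ k)) (v k)) := fun k => cv_meas (Kp_meas _ _) (hvm k)
        rw [lintegral_add_left (by fun_prop), lintegral_const_mul _ (by fun_prop),
          lintegral_const_mul _ (by fun_prop)]

lemma supN_mono (b : ℕ → ℝ≥0∞) : Monotone (supN b) := fun _ _ h =>
  Finset.sup_mono (Finset.range_mono h)

lemma supN_tendsto (b : ℕ → ℝ≥0∞) : Tendsto (supN b) atTop (𝓝 (⨆ k, b k)) := by
  have : (⨆ k, b k) = ⨆ N, supN b N := by
    apply le_antisymm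
    · exact iSup_le fun k => (le_supN b (Finset.self_mem_range_succ k)).trans (le_iSup (supN b) (k+1))
    · exact iSup_le fun N => Finset.sup_le fun k _ => le_iSup b k
  rw [this]
  exact tendsto_atTop_iSup (supN_mono b)

/-- partial lq sums to power P -/
def lqN (Q : ℝ≥0∞) (P : ℝ) (a : ℕ → ℝ≥0∞) (N : ℕ) : ℝ≥0∞ :=
  if Q = ∞ then (supN a N) ^ P else (∑ k ∈ Finset.range N, a k ^ Q.toReal) ^ (P / Q.toReal)

lemma lqN_mono (Q : ℝ≥0∞) {P : ℝ} (hP : 0 < P) (a : ℕ → ℝ≥0∞) : Monotone (lqN Q P a) := by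
  intro M N h
  unfold lqN
  split_ifs
  · exact ENNReal.rpow_le_rpow (supN_mono a h) hP.le
  · exact ENNReal.rpow_le_rpow (Finset.sum_le_sum_of_subset (Finset.range_mono h)) (by positivity)

lemma lqN_tendsto (Q : ℝ≥0∞) {P : ℝ} (a : ℕ → ℝ≥0∞) :
    Tendsto (lqN Q P a) atTop (𝓝 (lqSum Q a ^ P)) := by
  unfold lqN lqSum
  split_ifs
  · exact (ENNReal.continuous_rpow_const.tendsto _).comp (supN_tendsto a)
  · rw [← ENNReal.rpow_mul, show 1 / Q.toReal * P = P / Q.toReal by ring]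
    exact (ENNReal.continuous_rpow_const.tendsto _).comp ENNReal.summable.hasSum.tendsto_sum_nat

lemma lqN_meas (Q : ℝ≥0∞) (P : ℝ) {b : ℕ → Rn n → ℝ≥0∞} (hb : ∀ k, Measurable (b k)) (N : ℕ) :
    Measurable fun x => lqN Q P (fun k => b k x) N := by
  unfold lqN
  split_ifs
  · have := supN_meas hb N; fun_prop
  · fun_prop

lemma lqSum_meas (Q : ℝ≥0∞) {b : ℕ → Rn n → ℝ≥0∞} (hb : ∀ k, Measurable (b k)) :
    Measurable fun x => lqSum Q (fun k => b k x) := by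
  unfold lqSum
  split_ifs
  · exact Measurable.iSup hb
  · have : Measurable fun x => ∑' j, b j x ^ Q.toReal := Measurable.ennreal_tsum fun j => by fun_prop
    fun_prop

/-- vector-valued maximal-type inequality -/
lemma vv (n : ℕ) {m : ℝ} (hm : (n:ℝ) < m) {P : ℝ} (hP : 1 < P) {Q : ℝ≥0∞} (hQ : 1 < Q) :
    ∃ C : ℝ≥0∞, C ≠ ∞ ∧ ∀ (g : ℕ → Rn n → ℝ≥0∞), (∀ k, Measurable (g k)) →
    ∫⁻ x, (lqSum Q (fun k => cv (Kp m (2 ^ k)) (g k) x)) ^ P ≤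
      C * ∫⁻ x, (lqSum Q (fun k => g k x)) ^ P := by
  have key : ∃ C : ℝ≥0∞, C ≠ ∞ ∧ ∀ (g : ℕ → Rn n → ℝ≥0∞), (∀ k, Measurable (g k)) → ∀ N : ℕ,
    ∫⁻ x, lqN Q P (fun k => cv (Kp m (2 ^ k)) (g k) x) N ≤
      C * ∫⁻ x, lqN Q P (fun k => g k x) N := by
    by_cases hQt : Q = ∞
    · simp only [lqN, hQt, if_true]; exact vv_top n hm hP
    · simp only [lqN, hQt, if_false]
      have : 1 < Q.toReal := by
        rw [← ENNReal.toReal_one]; exact (ENNReal.toReal_lt_toReal (by simp) hQt).2 hQ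
      rcases le_or_gt Q.toReal P with h | h
      · exact vv_le n hm this.le h
      · exact vv_gt n hm hP h
  obtain ⟨C, hC, h⟩ := key
  refine ⟨C, hC, fun g hg => ?_⟩
  have hbm : ∀ k, Measurable (cv (Kp m (2 ^ k)) (g k)) := fun k => cv_meas (Kp_meas _ _) (hg k)
  have hP0 : 0 < P := by linarith
  have ht := lintegral_tendsto_of_tendsto_of_monotone (μ := (volume : Measure (Rn n)))
    (f := fun N x => lqN Q P (fun k => cv (Kp m (2 ^ k)) (g k) x) N)
    (fun N => (lqN_meas Q P hbm N).aemeasurable)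
    (Eventually.of_forall fun x => lqN_mono Q hP0 _)
    (Eventually.of_forall fun x => lqN_tendsto Q _)
  refine le_of_tendsto' ht fun N => (h g hg N).trans ?_
  refine mul_le_mul_right (lintegral_mono fun x => ?_) _
  exact (lqN_mono Q hP0 _).ge_of_tendsto (lqN_tendsto Q _) N

end Sub
end

noncomputable section
open MeasureTheory Filter Metric Real Set SchwartzMap
open scoped ENNReal NNReal Topology FourierTransform
namespace Sub
variable {n : ℕ} {E : Type*} [NormedAddCommGroup E]

lemma wt_pos {t : ℝ} (ht : 0 < t) (y : Rn n) : 0 < 1 + t * ‖y‖ := by positivity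

lemma wt_one_le {t : ℝ} (ht : 0 < t) (y : Rn n) : 1 ≤ 1 + t * ‖y‖ := by
  have : 0 ≤ t * ‖y‖ := by positivity
  linarith

lemma pm_le_iff {a t : ℝ} (ht : 0 < t) (g : Rn n → E) (x : Rn n) (B : ℝ≥0∞) :
    peetreMax a t g x ≤ B ↔ ∀ y, ‖g (x - y)‖ₑ ≤ B * ENNReal.ofReal ((1 + t * ‖y‖) ^ a) := by
  unfold peetreMax
  rw [iSup_le_iff]
  refine forall_congr' fun y => ?_
  have := Real.rpow_pos_of_pos (wt_pos ht y) a
  rw [ENNReal.div_le_iff (by simpa using this) (by simp)]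
  rfl

lemma le_pm {a t : ℝ} (ht : 0 < t) (g : Rn n → E) (x y : Rn n) :
    ‖g (x - y)‖ₑ ≤ peetreMax a t g x * ENNReal.ofReal ((1 + t * ‖y‖) ^ a) :=
  (pm_le_iff ht g x _).1 le_rfl y

lemma le_pm0 {a t : ℝ} (ht : 0 < t) (g : Rn n → E) (x : Rn n) :
    ‖g x‖ₑ ≤ peetreMax a t g x := by
  simpa using le_pm (a := a) ht g x 0

lemma le_pm' {a t : ℝ} (ht : 0 < t) (g : Rn n → E) (x z : Rn n) :
    ‖g z‖ₑ ≤ peetreMax a t g x * ENNReal.ofReal ((1 + t * ‖x - z‖) ^ a) := by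
  simpa using le_pm (a := a) ht g x (x - z)

lemma pm_meas {a t : ℝ} (ht : 0 < t) {g : Rn n → E} (hg : Continuous g) :
    Measurable (peetreMax a t g) := by
  apply LowerSemicontinuous.measurable
  unfold peetreMax
  apply lowerSemicontinuous_iSup
  intro y
  apply Continuous.lowerSemicontinuous
  have := Real.rpow_pos_of_pos (wt_pos ht y) a
  apply ENNReal.continuous_div_const _ (by simpa using this) |>.comp
  fun_prop

lemma wt_mul {t : ℝ} (ht : 0 < t) {m : ℝ} (hm : 0 ≤ m) (x y : Rn n) :
    (1 + t * ‖x + y‖) ^ m ≤ (1 + t * ‖x‖) ^ m * (1 + t * ‖y‖) ^ m := by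
  rw [← Real.mul_rpow (wt_pos ht x).le (wt_pos ht y).le]
  apply Real.rpow_le_rpow (wt_pos ht _).le _ hm
  have h1 := norm_add_le x y
  have h2 : 0 ≤ (t * ‖x‖) * (t * ‖y‖) := by positivity
  nlinarith

lemma Kp_shift {t : ℝ} (ht : 0 < t) {m : ℝ} (hm : 0 ≤ m) (x y : Rn n) :
    Kp m t (x - y) ≤ ENNReal.ofReal ((1 + t * ‖y‖) ^ m) * Kp m t x := by
  unfold Kp
  rw [← ENNReal.ofReal_mul (Real.rpow_nonneg (wt_pos ht y).le _)]
  apply ENNReal.ofReal_le_ofReal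
  rw [mul_left_comm]
  apply mul_le_mul_of_nonneg_left _ (by positivity)
  have h := wt_mul ht hm (x - y) y
  rw [sub_add_cancel] at h
  rw [Real.rpow_neg (wt_pos ht _).le, Real.rpow_neg (wt_pos ht _).le, ← div_eq_mul_inv,
    le_div_iff₀ (Real.rpow_pos_of_pos (wt_pos ht _) _), inv_mul_le_iff₀ (Real.rpow_pos_of_pos (wt_pos ht _) _)]
  exact h

lemma Kp_anti {t : ℝ} (ht : 0 < t) {m m' : ℝ} (hm : m ≤ m') (x : Rn n) :
    Kp m' t x ≤ Kp m t x := by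
  unfold Kp
  apply ENNReal.ofReal_le_ofReal
  apply mul_le_mul_of_nonneg_left _ (by positivity)
  exact Real.rpow_le_rpow_of_exponent_le (wt_one_le ht x) (by linarith)

lemma cvKp_shift {t : ℝ} (ht : 0 < t) {m : ℝ} (hm : 0 ≤ m) (g : Rn n → ℝ≥0∞) (x y : Rn n) :
    cv (Kp m t) g (x - y) ≤ ENNReal.ofReal ((1 + t * ‖y‖) ^ m) * cv (Kp m t) g x := by
  unfold cv
  rw [← lintegral_const_mul' _ _ (by simp)]
  apply lintegral_mono; intro z; dsimp only
  rw [← mul_assoc]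
  refine mul_le_mul_left ?_ _
  have := Kp_shift ht hm (x - z) y
  rwa [sub_right_comm] at this

lemma wt_rpow {t : ℝ} (ht : 0 < t) (y : Rn n) (a : ℝ) {r : ℝ} (hr : 0 ≤ r) :
    (ENNReal.ofReal ((1 + t * ‖y‖) ^ a)) ^ r = ENNReal.ofReal ((1 + t * ‖y‖) ^ (a * r)) := by
  rw [ENNReal.ofReal_rpow_of_nonneg (Real.rpow_nonneg (wt_pos ht y).le _) hr,
    ← Real.rpow_mul (wt_pos ht y).le]

/-- bounding r-th power of the maximal function -/
lemma pm_rpow_le {a t r : ℝ} (ht : 0 < t) (hr : 0 < r) (g : Rn n → E) (x : Rn n) (B : ℝ≥0∞)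
    (h : ∀ y, ‖g (x - y)‖ₑ ^ r ≤ B * ENNReal.ofReal ((1 + t * ‖y‖) ^ (a * r))) :
    peetreMax a t g x ^ r ≤ B := by
  rw [← ENNReal.rpow_le_rpow_iff (z := 1 / r) (by positivity), ← ENNReal.rpow_mul,
    mul_one_div_cancel hr.ne', ENNReal.rpow_one, pm_le_iff ht]
  intro y
  have := ENNReal.rpow_le_rpow (h y) (z := 1 / r) (by positivity)
  rw [← ENNReal.rpow_mul, mul_one_div_cancel hr.ne', ENNReal.rpow_one,
    ENNReal.mul_rpow_of_nonneg _ _ (by positivity), wt_rpow ht _ _ (by positivity)] at this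
  rwa [mul_assoc, mul_one_div_cancel hr.ne', mul_one] at this

lemma pm_small_finite {A t r : ℝ} (ht : 0 < t) (hr : 0 < r) (hr1 : r ≤ 1) (hA : 0 ≤ A) {g : Rn n → E}
    (hgc : Continuous g) {C : ℝ≥0∞} (hg : ∀ y, ‖g y‖ₑ ≤ C * cv (Kp A t) (fun z => ‖g z‖ₑ) y) (x : Rn n)
    (hfin : peetreMax A t g x ≠ ∞) :
    peetreMax A t g x ^ r ≤ C * cv (Kp (A * r) t) (fun z => ‖g z‖ₑ ^ r) x := by
  set G := peetreMax A t g x with hG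
  have key : G ≤ C * G ^ (1 - r) * cv (Kp (A * r) t) (fun z => ‖g z‖ₑ ^ r) x := by
    rw [hG, pm_le_iff ht]
    intro y
    have e : cv (Kp A t) (fun z => ‖g z‖ₑ) x ≤ G ^ (1 - r) * cv (Kp (A * r) t) (fun z => ‖g z‖ₑ ^ r) x := by
      unfold cv
      rw [← lintegral_const_mul' _ _ (ENNReal.rpow_ne_top_of_nonneg (by linarith) hfin)]
      apply lintegral_mono; intro z; dsimp only
      have h1 : ‖g z‖ₑ ≤ G ^ (1 - r) * ENNReal.ofReal ((1 + t * ‖x - z‖) ^ (A * (1 - r))) * ‖g z‖ₑ ^ r := by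
        rw [← wt_rpow ht _ _ (by linarith), ← ENNReal.mul_rpow_of_nonneg _ _ (by linarith)]
        calc ‖g z‖ₑ = ‖g z‖ₑ ^ (1 - r) * ‖g z‖ₑ ^ r := by
              rw [← ENNReal.rpow_add_of_nonneg _ _ (by linarith) hr.le]; simp
          _ ≤ _ := by
              refine mul_le_mul_left (ENNReal.rpow_le_rpow (le_pm' ht g x z) (by linarith)) _
      have h2 : Kp A t (x - z) * ENNReal.ofReal ((1 + t * ‖x - z‖) ^ (A * (1 - r))) = Kp (A * r) t (x - z) := by
        unfold Kp
        rw [← ENNReal.ofReal_mul (mul_nonneg (by positivity) (Real.rpow_nonneg (wt_pos ht _).le _)), mul_assoc,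
          ← Real.rpow_add (wt_pos ht _)]
        congr 3; ring
      calc _ ≤ Kp A t (x - z) * (G ^ (1 - r) * ENNReal.ofReal ((1 + t * ‖x - z‖) ^ (A * (1 - r))) * ‖g z‖ₑ ^ r) :=
            mul_le_mul_right h1 _
        _ = G ^ (1 - r) * ((Kp A t (x - z) * ENNReal.ofReal ((1 + t * ‖x - z‖) ^ (A * (1 - r)))) * ‖g z‖ₑ ^ r) := by ring
        _ = _ := by rw [h2]
    calc ‖g (x - y)‖ₑ ≤ C * cv (Kp A t) (fun z => ‖g z‖ₑ) (x - y) := hg _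
      _ ≤ C * (ENNReal.ofReal ((1 + t * ‖y‖) ^ A) * (G ^ (1 - r) * cv (Kp (A * r) t) (fun z => ‖g z‖ₑ ^ r) x)) := by
          refine mul_le_mul_right ((cvKp_shift ht hA _ x y).trans (mul_le_mul_right e _)) _
      _ = _ := by ring
  rcases eq_or_ne G 0 with h0 | h0
  · rw [h0, ENNReal.zero_rpow_of_pos hr]; exact zero_le
  have hp0 : G ^ (1 - r) ≠ 0 := by simp [h0, hfin]
  have hpt : G ^ (1 - r) ≠ ∞ := ENNReal.rpow_ne_top_of_nonneg (by linarith) hfin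
  have e2 : G = G ^ (1 - r) * G ^ r := by
    rw [← ENNReal.rpow_add_of_nonneg _ _ (by linarith) hr.le]; simp
  rw [← ENNReal.mul_le_mul_iff_right hp0 hpt, ← e2]
  refine key.trans (le_of_eq (by ring))

lemma pm_finite_of_growth {t : ℝ} (ht : 0 < t) {g : Rn n → E}
    {C : ℝ} {K : ℕ} (hC : 0 ≤ C) (hg : ∀ y, ‖g y‖ ≤ C * (1 + ‖y‖) ^ K) {A : ℝ} (hA : (K:ℝ) ≤ A) (x : Rn n) :
    peetreMax A t g x ≠ ∞ := by
  refine ne_top_of_le_ne_top (b := ENNReal.ofReal (C * ((1 + ‖x‖) * (1 + t⁻¹)) ^ K)) (by simp) ?_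
  rw [pm_le_iff ht]
  intro y
  rw [← ENNReal.ofReal_mul (by positivity), ← ofReal_norm_eq_enorm]
  apply ENNReal.ofReal_le_ofReal
  refine (hg _).trans ?_
  rw [mul_assoc]
  apply mul_le_mul_of_nonneg_left _ hC
  calc (1 + ‖x - y‖) ^ K ≤ (((1 + ‖x‖) * (1 + t⁻¹)) * (1 + t * ‖y‖)) ^ K := by
        apply pow_le_pow_left₀ (by positivity)
        have h1 := norm_sub_le x y
        have h2 : 0 ≤ ‖x‖ := norm_nonneg x
        have h3 : 0 ≤ t * ‖y‖ := by positivity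
        have h4 : 0 < t⁻¹ := by positivity
        have h5 : t⁻¹ * (t * ‖y‖) = ‖y‖ := by field_simp
        have e : (1 + ‖x‖) * (1 + t⁻¹) * (1 + t * ‖y‖) =
          1 + ‖x‖ + ‖y‖ + (t⁻¹ + ‖x‖ * t⁻¹ + t * ‖y‖ + ‖x‖ * (t * ‖y‖) + ‖x‖ * ‖y‖) := by
          linear_combination (1 + ‖x‖) * h5
        rw [e]
        have : 0 ≤ (t⁻¹ + ‖x‖ * t⁻¹ + t * ‖y‖ + ‖x‖ * (t * ‖y‖) + ‖x‖ * ‖y‖) := by positivity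
        linarith
    _ = ((1 + ‖x‖) * (1 + t⁻¹)) ^ K * (1 + t * ‖y‖) ^ (K:ℝ) := by rw [mul_pow, Real.rpow_natCast]
    _ ≤ _ := by
        apply mul_le_mul_of_nonneg_left _ (by positivity)
        exact Real.rpow_le_rpow_of_exponent_le (wt_one_le ht y) hA

lemma peetre_le (n : ℕ) {a r : ℝ} (ha : 0 ≤ a) (hr : 0 < r) (C : ℝ → ℝ≥0∞) (hC : ∀ m, C m ≠ ∞) :
    ∃ D : ℝ≥0∞, D ≠ ∞ ∧ ∀ (t : ℝ), 0 < t → ∀ g : Rn n → E, Continuous g →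
      (∃ (C : ℝ) (K : ℕ), 0 ≤ C ∧ ∀ y, ‖g y‖ ≤ C * (1 + ‖y‖) ^ K) →
      (∀ m, 0 ≤ m → ∀ y, ‖g y‖ₑ ≤ C m * cv (Kp m t) (fun z => ‖g z‖ₑ) y) →
      ∀ x, peetreMax a t g x ^ r ≤ D * cv (Kp (a * r) t) (fun z => ‖g z‖ₑ ^ r) x := by
  rcases le_or_gt r 1 with hr1 | hr1
  · refine ⟨C a + 1, by simp [hC], fun t ht g hgc ⟨C₀, K, hC₀, hK⟩ hg x => ?_⟩
    rcases eq_or_ne (cv (Kp (a * r) t) (fun z => ‖g z‖ₑ ^ r) x) ∞ with hJ | hJ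
    · rw [hJ, ENNReal.mul_top (by simp)]; exact le_top
    set A := max a K with hA
    have hA0 : 0 ≤ A := ha.trans (le_max_left _ _)
    have h3 : ∀ y, ‖g y‖ₑ ^ r ≤ C A * cv (Kp (a * r) t) (fun z => ‖g z‖ₑ ^ r) y := fun y => by
      refine (ENNReal.rpow_le_rpow (le_pm0 (a := A) ht g y) hr.le).trans ?_
      refine (pm_small_finite ht hr hr1 hA0 hgc (hg A hA0) y
        (pm_finite_of_growth ht hC₀ hK (le_max_right _ _) y)).trans ?_
      refine mul_le_mul_right (cv_mono (fun z => Kp_anti ht ?_ z) (fun _ => le_rfl) y) _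
      exact mul_le_mul_of_nonneg_right (le_max_left _ _) hr.le
    have h4 : peetreMax a t g x ^ r ≤ C A * cv (Kp (a * r) t) (fun z => ‖g z‖ₑ ^ r) x := by
      apply pm_rpow_le ht hr
      intro y
      refine (h3 _).trans ?_
      refine (mul_le_mul_right (cvKp_shift ht (by positivity) _ x y) _).trans (le_of_eq (by ring))
    have h5 : peetreMax a t g x ≠ ∞ := by
      intro h
      rw [h, ENNReal.top_rpow_of_pos hr, top_le_iff] at h4
      exact ENNReal.mul_ne_top (hC A) hJ h4
    refine (pm_small_finite ht hr hr1 ha hgc (hg a ha) x h5).trans ?_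
    exact mul_le_mul_left le_self_add _
  · set m := max (a * r) (n + 1) with hm
    have hm0 : 0 ≤ m := (by positivity : 0 ≤ a * r).trans (le_max_left _ _)
    have hmn : (n:ℝ) < m := lt_of_lt_of_le (by linarith) (le_max_right _ _)
    obtain ⟨B, hB, hBi⟩ := Kp_int n hmn
    have h1 : C m ^ r ≠ ∞ := ENNReal.rpow_ne_top_of_nonneg hr.le (hC m)
    have h2 : B ^ (r - 1) ≠ ∞ := ENNReal.rpow_ne_top_of_nonneg (by linarith) hB
    refine ⟨C m ^ r * B ^ (r - 1), by finiteness, fun t ht g hgc _ hg x => ?_⟩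
    apply pm_rpow_le ht hr
    intro y
    calc ‖g (x - y)‖ₑ ^ r ≤ (C m * cv (Kp m t) (fun z => ‖g z‖ₑ) (x - y)) ^ r :=
          ENNReal.rpow_le_rpow (hg m hm0 _) hr.le
      _ = C m ^ r * (cv (Kp m t) (fun z => ‖g z‖ₑ) (x - y)) ^ r := ENNReal.mul_rpow_of_nonneg _ _ hr.le
      _ ≤ C m ^ r * (B ^ (r - 1) * cv (Kp (a * r) t) (fun z => ‖g z‖ₑ ^ r) (x - y)) := by
          refine mul_le_mul_right ?_ _
          refine (cv_jensen (Kp_meas _ _) hgc.enorm.measurable hr1.le _).trans ?_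
          refine mul_le_mul' (ENNReal.rpow_le_rpow (hBi t ht) (by linarith)) ?_
          exact cv_mono (fun z => Kp_anti ht (le_max_left _ _) z) (fun _ => le_rfl) _
      _ ≤ C m ^ r * (B ^ (r - 1) * (ENNReal.ofReal ((1 + t * ‖y‖) ^ (a * r)) *
            cv (Kp (a * r) t) (fun z => ‖g z‖ₑ ^ r) x)) := by
          refine mul_le_mul_right (mul_le_mul_right (cvKp_shift ht (by positivity) _ x y) _) _
      _ = _ := by ring

end Sub
end

noncomputable section
open MeasureTheory Filter Metric Real Set SchwartzMap
open scoped ENNReal NNReal Topology FourierTransform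
namespace Sub
variable {n : ℕ}

lemma lqSum_mono {q : ℝ≥0∞} {a b : ℕ → ℝ≥0∞} (h : ∀ k, a k ≤ b k) : lqSum q a ≤ lqSum q b := by
  unfold lqSum
  split_ifs
  · exact iSup_mono h
  · exact ENNReal.rpow_le_rpow (ENNReal.tsum_le_tsum fun k => ENNReal.rpow_le_rpow (h k) (by positivity)) (by positivity)

lemma tR {q : ℝ≥0∞} (hq : 0 < q) (hq' : q ≠ ∞) : 0 < q.toReal := ENNReal.toReal_pos hq.ne' hq'

lemma lqSum_mul {q : ℝ≥0∞} (hq : 0 < q) (c : ℝ≥0∞) (a : ℕ → ℝ≥0∞) :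
    lqSum q (fun k => c * a k) = c * lqSum q a := by
  unfold lqSum
  split_ifs with h
  · rw [ENNReal.mul_iSup]
  · have hQ := tR hq h
    simp only [ENNReal.mul_rpow_of_nonneg _ _ hQ.le]
    rw [ENNReal.tsum_mul_left, ENNReal.mul_rpow_of_nonneg _ _ (by positivity), ← ENNReal.rpow_mul,
      mul_one_div_cancel hQ.ne', ENNReal.rpow_one]

lemma le_lqSum {q : ℝ≥0∞} (hq : 0 < q) (a : ℕ → ℝ≥0∞) (k : ℕ) : a k ≤ lqSum q a := by
  unfold lqSum
  split_ifs with h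
  · exact le_iSup a k
  · have hQ := tR hq h
    calc a k = (a k ^ q.toReal) ^ (1 / q.toReal) := by
          rw [← ENNReal.rpow_mul, mul_one_div_cancel hQ.ne', ENNReal.rpow_one]
      _ ≤ _ := ENNReal.rpow_le_rpow (ENNReal.le_tsum k) (by positivity)

lemma lqSum_shift_le {q : ℝ≥0∞} (a : ℕ → ℝ≥0∞) : lqSum q (fun k => a (k+1)) ≤ lqSum q a := by
  unfold lqSum
  split_ifs with h
  · exact iSup_le fun k => le_iSup a (k+1)
  · refine ENNReal.rpow_le_rpow ?_ (by positivity)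
    exact ENNReal.tsum_comp_le_tsum_of_injective (add_left_injective 1) (fun k => a k ^ q.toReal)

lemma lqSum_split {q : ℝ≥0∞} (hq : 0 < q) : ∃ C : ℝ≥0∞, C ≠ ∞ ∧ ∀ a : ℕ → ℝ≥0∞,
    lqSum q a ≤ C * (a 0 + lqSum q (fun k => a (k+1))) := by
  by_cases h : q = ∞
  · refine ⟨1, by simp, fun a => ?_⟩
    simp only [lqSum, h, if_true, one_mul]
    refine iSup_le fun k => ?_
    cases k with
    | zero => exact le_self_add
    | succ k => exact (le_iSup (fun k => a (k+1)) k).trans le_add_self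
  · have hQ := tR hq h
    refine ⟨2 ^ (1 / q.toReal), ENNReal.rpow_ne_top_of_nonneg (by positivity) (by simp), fun a => ?_⟩
    simp only [lqSum, h, if_false]
    rw [tsum_eq_zero_add' ENNReal.summable]
    refine (rpow_add_le_mul _ _ (by positivity)).trans (le_of_eq ?_)
    rw [← ENNReal.rpow_mul, mul_one_div_cancel hQ.ne', ENNReal.rpow_one]

lemma lqSum_rpow {q : ℝ≥0∞} (hq : 0 < q) {r : ℝ} (hr : 0 < r) (a : ℕ → ℝ≥0∞) :
    lqSum q a ^ r = lqSum (q / ENNReal.ofReal r) (fun k => a k ^ r) := by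
  have hr0 : ENNReal.ofReal r ≠ 0 := by simpa using hr
  unfold lqSum
  by_cases h : q = ∞
  · rw [if_pos h, if_pos (by rw [h, ENNReal.top_div_of_ne_top (by simp)])]
    exact (ENNReal.orderIsoRpow r hr).map_iSup a
  · rw [if_neg h, if_neg (ENNReal.div_ne_top h hr0)]
    have hQ := tR hq h
    rw [ENNReal.toReal_div, ENNReal.toReal_ofReal hr.le, ← ENNReal.rpow_mul]
    simp only [← ENNReal.rpow_mul]
    congr 1
    · congr 1; ext k; congr 1; field_simp
    · field_simp

/-- decay kernel -/
def ker (δ : ℝ) (j k : ℕ) : ℝ≥0∞ := (2:ℝ≥0∞) ^ (-(δ * |(j:ℝ) - k|))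

lemma ker_symm (δ : ℝ) (j k : ℕ) : ker δ j k = ker δ k j := by unfold ker; rw [abs_sub_comm]

lemma ker_tsum {δ : ℝ} (hδ : 0 < δ) : ∃ A : ℝ≥0∞, A ≠ ∞ ∧ ∀ j, ∑' k, ker δ j k ≤ A := by
  have hgeo : ∑' i : ℕ, (2:ℝ≥0∞) ^ (-(δ * (i:ℝ))) ≠ ∞ := by
    have : ∀ i : ℕ, (2:ℝ≥0∞) ^ (-(δ * (i:ℝ))) = ((2:ℝ≥0∞) ^ (-δ)) ^ i := fun i => by
      rw [← ENNReal.rpow_natCast, ← ENNReal.rpow_mul]; congr 1; ring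
    simp only [this]
    rw [ENNReal.tsum_geometric]
    have : (2:ℝ≥0∞) ^ (-δ) < 1 := ENNReal.rpow_lt_one_of_one_lt_of_neg (by norm_num) (by linarith)
    simpa using (tsub_pos_of_lt this).ne'
  refine ⟨∑' i : ℕ, (2:ℝ≥0∞) ^ (-(δ * (i:ℝ))) * 2, ?_, fun j => ?_⟩
  · rw [ENNReal.tsum_mul_right]; finiteness
  classical
  calc ∑' k, ker δ j k ≤ ∑' k, ∑' i : ℕ, (2:ℝ≥0∞) ^ (-(δ * (i:ℝ))) *
        ((if k = j + i then 1 else 0) + (if k + i = j then 1 else 0)) := by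
        refine ENNReal.tsum_le_tsum fun k => ?_
        rcases le_total j k with h | h
        · refine le_trans ?_ (ENNReal.le_tsum (k - j))
          rw [if_pos (by omega)]
          unfold ker
          rw [show |(j:ℝ) - k| = ((k - j : ℕ):ℝ) by
            rw [Nat.cast_sub h, abs_sub_comm, abs_of_nonneg (by simpa using h)]]
          calc _ = _ * (1:ℝ≥0∞) := (mul_one _).symm
            _ ≤ _ := mul_le_mul_right le_self_add _
        · refine le_trans ?_ (ENNReal.le_tsum (j - k))
          rw [if_pos (show k + (j - k) = j by omega)]
          unfold ker
          rw [show |(j:ℝ) - k| = ((j - k : ℕ):ℝ) by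
            rw [Nat.cast_sub h, abs_of_nonneg (by simpa using h)]]
          calc _ = _ * (1:ℝ≥0∞) := (mul_one _).symm
            _ ≤ _ := mul_le_mul_right le_add_self _
    _ = ∑' i : ℕ, ∑' k, (2:ℝ≥0∞) ^ (-(δ * (i:ℝ))) *
        ((if k = j + i then 1 else 0) + (if k + i = j then 1 else 0)) := ENNReal.tsum_comm
    _ ≤ _ := by
        refine ENNReal.tsum_le_tsum fun i => ?_
        rw [ENNReal.tsum_mul_left]
        refine mul_le_mul_right ?_ _
        rw [ENNReal.tsum_add, tsum_ite_eq, ← one_add_one_eq_two]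
        refine add_le_add le_rfl ?_
        rw [tsum_eq_single (j - i)]
        · split_ifs <;> simp
        · intro k hk; rw [if_neg (by omega)]

lemma tsum_rpow_le (c : ℕ → ℝ≥0∞) {Q : ℝ} (hQ : 0 < Q) (hQ1 : Q ≤ 1) :
    (∑' k, c k) ^ Q ≤ ∑' k, c k ^ Q := by
  have h1 : Tendsto (fun N => (∑ k ∈ Finset.range N, c k) ^ Q) atTop (𝓝 ((∑' k, c k) ^ Q)) :=
    (ENNReal.continuous_rpow_const.tendsto _).comp ENNReal.summable.hasSum.tendsto_sum_nat
  refine le_of_tendsto' h1 fun N => ?_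
  refine le_trans ?_ (ENNReal.sum_le_tsum (Finset.range N))
  induction N with
  | zero => simp [hQ]
  | succ N ih =>
    rw [Finset.sum_range_succ, Finset.sum_range_succ]
    exact (ENNReal.rpow_add_le_add_rpow _ _ hQ.le hQ1).trans (add_le_add ih le_rfl)

lemma seq_le {q : ℝ≥0∞} (hq : 0 < q) {δ : ℝ} (hδ : 0 < δ) : ∃ C : ℝ≥0∞, C ≠ ∞ ∧
    ∀ b d : ℕ → ℝ≥0∞, (∀ j, b j ≤ ∑' k, ker δ j k * d k) → lqSum q b ≤ C * lqSum q d := by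
  by_cases h : q = ∞
  · obtain ⟨A, hA, hk⟩ := ker_tsum hδ
    refine ⟨A, hA, fun b d hb => ?_⟩
    simp only [lqSum, h, if_true]
    refine iSup_le fun j => (hb j).trans ?_
    calc _ ≤ ∑' k, ker δ j k * (⨆ k, d k) := ENNReal.tsum_le_tsum fun k => mul_le_mul_right (le_iSup d k) _
      _ = (∑' k, ker δ j k) * (⨆ k, d k) := ENNReal.tsum_mul_right
      _ ≤ _ := mul_le_mul_left (hk j) _
  have hQ := tR hq h
  set Q := q.toReal with hQd
  suffices H : ∃ C : ℝ≥0∞, C ≠ ∞ ∧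
      ∀ b d : ℕ → ℝ≥0∞, (∀ j, b j ≤ ∑' k, ker δ j k * d k) → ∑' j, b j ^ Q ≤ C * ∑' k, d k ^ Q by
    obtain ⟨C, hC, H⟩ := H
    refine ⟨C ^ (1 / Q), ENNReal.rpow_ne_top_of_nonneg (by positivity) hC, fun b d hb => ?_⟩
    simp only [lqSum, h, if_false]
    rw [← ENNReal.mul_rpow_of_nonneg _ _ (by positivity)]
    exact ENNReal.rpow_le_rpow (H b d hb) (by positivity)
  have swap : ∀ (δ' : ℝ) (A : ℝ≥0∞), (∀ j, ∑' k, ker δ' j k ≤ A) → ∀ d : ℕ → ℝ≥0∞,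
      ∑' j, ∑' k, ker δ' j k * d k ≤ A * ∑' k, d k := by
    intro δ' A hA d
    rw [ENNReal.tsum_comm, ← ENNReal.tsum_mul_left]
    refine ENNReal.tsum_le_tsum fun k => ?_
    rw [ENNReal.tsum_mul_right]
    refine mul_le_mul_left ?_ _
    simp only [ker_symm δ' _ k]; exact hA k
  rcases le_or_gt 1 Q with h1 | h1
  · obtain ⟨A, hA, hk⟩ := ker_tsum hδ
    have hA1 : A ^ (Q - 1) ≠ ∞ := ENNReal.rpow_ne_top_of_nonneg (by linarith) hA
    refine ⟨A ^ (Q - 1) * A, by finiteness, fun b d hb => ?_⟩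
    calc ∑' j, b j ^ Q ≤ ∑' j, A ^ (Q - 1) * ∑' k, ker δ j k * d k ^ Q := by
          refine ENNReal.tsum_le_tsum fun j => ?_
          refine (ENNReal.rpow_le_rpow (hb j) hQ.le).trans ((jensen_tsum _ _ h1).trans ?_)
          exact mul_le_mul_left (ENNReal.rpow_le_rpow (hk j) (by linarith)) _
      _ = A ^ (Q - 1) * ∑' j, ∑' k, ker δ j k * d k ^ Q := ENNReal.tsum_mul_left
      _ ≤ A ^ (Q - 1) * (A * ∑' k, d k ^ Q) := mul_le_mul_right (swap δ A hk _) _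
      _ = _ := by ring
  · obtain ⟨A, hA, hk⟩ := ker_tsum (δ := δ * Q) (by positivity)
    refine ⟨A, hA, fun b d hb => ?_⟩
    refine le_trans ?_ (swap _ A hk _)
    refine ENNReal.tsum_le_tsum fun j => ?_
    refine (ENNReal.rpow_le_rpow (hb j) hQ.le).trans ((tsum_rpow_le _ hQ h1.le).trans (le_of_eq ?_))
    congr 1; ext k
    rw [ENNReal.mul_rpow_of_nonneg _ _ hQ.le]
    congr 1
    unfold ker
    rw [← ENNReal.rpow_mul]; congr 1; ring

lemma lp_mono {p : ℝ≥0∞} (hp' : p ≠ ∞) {g h : Rn n → ℝ≥0∞} (H : ∀ x, g x ≤ h x) :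
    lpNormENN p g ≤ lpNormENN p h := by
  simp only [lpNormENN, hp', if_false]
  exact ENNReal.rpow_le_rpow (lintegral_mono fun x => ENNReal.rpow_le_rpow (H x) (by positivity)) (by positivity)

lemma lp_le_of {p : ℝ≥0∞} (hp : 0 < p) (hp' : p ≠ ∞) {g h : Rn n → ℝ≥0∞} {C : ℝ≥0∞}
    (H : ∫⁻ x, g x ^ p.toReal ≤ C * ∫⁻ x, h x ^ p.toReal) :
    lpNormENN p g ≤ C ^ (1 / p.toReal) * lpNormENN p h := by
  simp only [lpNormENN, hp', if_false]
  rw [← ENNReal.mul_rpow_of_nonneg _ _ (by positivity)]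
  exact ENNReal.rpow_le_rpow H (by positivity)

lemma lp_mul {p : ℝ≥0∞} (hp : 0 < p) (hp' : p ≠ ∞) {C : ℝ≥0∞} (hC : C ≠ ∞) (g : Rn n → ℝ≥0∞) :
    lpNormENN p (fun x => C * g x) = C * lpNormENN p g := by
  have hP := tR hp hp'
  simp only [lpNormENN, hp', if_false]
  simp only [ENNReal.mul_rpow_of_nonneg _ _ hP.le]
  rw [lintegral_const_mul' _ _ (ENNReal.rpow_ne_top_of_nonneg hP.le hC),
    ENNReal.mul_rpow_of_nonneg _ _ (by positivity), ← ENNReal.rpow_mul,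
    mul_one_div_cancel hP.ne', ENNReal.rpow_one]

lemma lp_add {p : ℝ≥0∞} (hp : 0 < p) (hp' : p ≠ ∞) : ∃ C : ℝ≥0∞, C ≠ ∞ ∧ ∀ g h : Rn n → ℝ≥0∞,
    Measurable g → lpNormENN p (fun x => g x + h x) ≤ C * (lpNormENN p g + lpNormENN p h) := by
  have hP := tR hp hp'
  set P := p.toReal
  have h2 : (2:ℝ≥0∞) ^ P ≠ ∞ := ENNReal.rpow_ne_top_of_nonneg hP.le (by simp)
  refine ⟨(2 ^ P) ^ (1 / P) * 2 ^ (1 / P), ?_, fun g h hg => ?_⟩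
  · exact ENNReal.mul_ne_top (ENNReal.rpow_ne_top_of_nonneg (by positivity) h2)
      (ENNReal.rpow_ne_top_of_nonneg (by positivity) (by simp))
  simp only [lpNormENN, hp', if_false]
  calc _ ≤ (2 ^ P * ((∫⁻ x, g x ^ P) + ∫⁻ x, h x ^ P)) ^ (1 / P) := by
        refine ENNReal.rpow_le_rpow ?_ (by positivity)
        rw [← lintegral_add_left (by fun_prop), ← lintegral_const_mul' _ _ h2]
        exact lintegral_mono fun x => rpow_add_le_mul _ _ hP.le
    _ ≤ _ := by
        rw [ENNReal.mul_rpow_of_nonneg _ _ (by positivity), mul_assoc]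
        exact mul_le_mul_right (rpow_add_le_mul _ _ (r := 1 / P) (by positivity)) _

lemma cv_mul {K g : Rn n → ℝ≥0∞} {c : ℝ≥0∞} (hc : c ≠ ∞) (x : Rn n) :
    cv K (fun z => c * g z) x = c * cv K g x := by
  unfold cv
  rw [← lintegral_const_mul' _ _ hc]
  congr 1; ext z; ring

lemma stepB {p q : ℝ≥0∞} (hp : 0 < p) (hp' : p ≠ ∞) (hq : 0 < q) (s : ℝ) {r m : ℝ} (hr : 0 < r)
    (hrp : r < p.toReal) (hrq : ENNReal.ofReal r < q) (hm : (n:ℝ) < m) {D : ℝ≥0∞} (hD : D ≠ ∞) :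
    ∃ C : ℝ≥0∞, C ≠ ∞ ∧ ∀ G Gs : ℕ → Rn n → ℝ≥0∞, (∀ k, Measurable (G k)) →
      (∀ k x, Gs k x ^ r ≤ D * cv (Kp m (2 ^ k)) (fun z => G k z ^ r) x) →
      lpNormENN p (fun x => lqSum q fun k => (2:ℝ≥0∞) ^ ((k:ℝ) * s) * Gs k x) ≤
        C * lpNormENN p (fun x => lqSum q fun k => (2:ℝ≥0∞) ^ ((k:ℝ) * s) * G k x) := by
  have hP := tR hp hp'
  set P := p.toReal with hPd
  have hP1 : 1 < P / r := by rwa [one_lt_div hr]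
  have hr0 : ENNReal.ofReal r ≠ 0 := by simpa using hr
  have hQ1 : 1 < q / ENNReal.ofReal r := by
    rw [ENNReal.lt_div_iff_mul_lt (Or.inl hr0) (Or.inl (by simp)), one_mul]; exact hrq
  obtain ⟨C, hC, hv⟩ := vv n hm hP1 hQ1
  refine ⟨(D ^ (P / r) * C) ^ (1 / P), ?_, fun G Gs hG hGs => ?_⟩
  · have := ENNReal.rpow_ne_top_of_nonneg (y := P / r) (by positivity) hD
    exact ENNReal.rpow_ne_top_of_nonneg (by positivity) (by finiteness)
  apply lp_le_of hp hp'
  rw [← hPd]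
  set w : ℕ → ℝ≥0∞ := fun k => (2:ℝ≥0∞) ^ ((k:ℝ) * s) with hw
  have hwt : ∀ k, w k ^ r ≠ ∞ := fun k =>
    ENNReal.rpow_ne_top_of_nonneg hr.le (ENNReal.rpow_ne_top_of_ne_zero (by simp) (by simp))
  have e : ∀ a : ℕ → ℝ≥0∞, lqSum q a ^ P = (lqSum (q / ENNReal.ofReal r) (fun k => a k ^ r)) ^ (P / r) := fun a => by
    rw [← lqSum_rpow hq hr, ← ENNReal.rpow_mul]; congr 1; field_simp
  simp only [e]
  have h := hv (fun k x => (w k * G k x) ^ r) (fun k => by have := hG k; fun_prop)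
  calc _ ≤ ∫⁻ x, (D * lqSum (q / ENNReal.ofReal r) (fun k => cv (Kp m (2 ^ k)) (fun z => (w k * G k z) ^ r) x)) ^ (P / r) := by
        refine lintegral_mono fun x => ENNReal.rpow_le_rpow ?_ (by positivity)
        rw [← lqSum_mul (by exact lt_trans zero_lt_one hQ1)]
        refine lqSum_mono fun k => ?_
        simp only [ENNReal.mul_rpow_of_nonneg _ _ hr.le]
        rw [cv_mul (hwt k), mul_left_comm]
        exact mul_le_mul_right (hGs k x) _
    _ = D ^ (P / r) * ∫⁻ x, (lqSum (q / ENNReal.ofReal r) (fun k => cv (Kp m (2 ^ k)) (fun z => (w k * G k z) ^ r) x)) ^ (P / r) := by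
        rw [← lintegral_const_mul' _ _ (ENNReal.rpow_ne_top_of_nonneg (by positivity) hD)]
        congr 1; ext x
        rw [ENNReal.mul_rpow_of_nonneg _ _ (by positivity)]
    _ ≤ _ := by rw [mul_assoc]; exact mul_le_mul_right h _

end Sub
end

noncomputable section
open MeasureTheory Filter Metric Real Set SchwartzMap
open scoped ENNReal NNReal Topology FourierTransform
namespace Sub
open LineDeriv
variable {n : ℕ}

lemma lineD_comm (u v : Rn n) (φ : Sch n) : ∂_{u} (∂_{v} φ : Sch n) = ∂_{v} (∂_{u} φ : Sch n) := by
  ext x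
  have key : ∀ u v : Rn n, (∂_{u} (∂_{v} φ : Sch n) : Sch n) x = fderiv ℝ (fderiv ℝ φ) x u v := by
    intro u v
    rw [lineDerivOp_apply_eq_fderiv]
    have h1 : (⇑(∂_{v} φ : Sch n)) = fun y => fderiv ℝ φ y v := by
      funext y; exact lineDerivOp_apply_eq_fderiv v φ y
    rw [h1]
    have hd : DifferentiableAt ℝ (fderiv ℝ φ) x := by
      have := (φ.smooth 2).fderiv_right (m := 1) (by norm_num)
      exact (this.differentiable (by norm_num)).differentiableAt
    rw [fderiv_clm_apply hd (by fun_prop)]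
    simp
  rw [key, key]
  have hs := (φ.smooth 2).contDiffAt (x := x) |>.isSymmSndFDerivAt (by simp)
  exact hs.eq u v

lemma wD_perm {l l' : List (Fin n)} (h : l.Perm l') (φ : Sch n) : wD l φ = wD l' φ := by
  induction h with
  | nil => rfl
  | cons x _ ih => simp [wD, ih]
  | swap x y l => simp only [wD]; exact lineD_comm _ _ _
  | trans _ _ ih1 ih2 => exact ih1.trans ih2

lemma word_count (α : Fin n → ℕ) (i : Fin n) : (word α).count i = α i := by
  unfold word
  rw [List.count_flatMap]
  have : (List.count i ∘ fun i => List.replicate (α i) i) = fun j => if j = i then α j else 0 := by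
    funext j; simp [List.count_replicate]
  rw [this]
  have h2 : ((List.finRange n).map fun j => if j = i then α j else 0).sum = ∑ j, if j = i then α j else 0 := by
    rw [Fin.sum_univ_def]
  rw [h2]; simp

lemma wD_eq_word (l : List (Fin n)) (φ : Sch n) :
    wD l φ = wD (word (fun i => l.count i)) φ := by
  apply wD_perm
  rw [List.perm_iff_count]
  intro i
  rw [word_count]

lemma mdeg_count (l : List (Fin n)) : mdeg (fun i => l.count i) = l.length := by
  unfold mdeg
  induction l with
  | nil => simp
  | cons a l ih => simp [List.count_cons, Finset.sum_add_distrib, ih]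

lemma iter_eq_wD (l : ℕ) (w : Fin l → Fin n) (φ : Sch n) (x : Rn n) :
    iteratedFDeriv ℝ l φ x (fun i => EuclideanSpace.single (w i) (1:ℝ)) = wD (List.ofFn w) φ x := by
  rw [← iteratedLineDerivOp_eq_iteratedFDeriv]
  congr 1
  induction l with
  | zero => simp [wD]
  | succ l ih =>
    rw [iteratedLineDerivOp_succ_left, List.ofFn_succ]
    simp only [wD]
    rw [← ih (fun i => w i.succ)]
    rfl

lemma iter_norm_le (l : ℕ) (φ : Sch n) (x : Rn n) :
    ‖iteratedFDeriv ℝ l φ x‖ ≤ ∑ w : Fin l → Fin n, ‖mderiv (fun i => (List.ofFn w).count i) (fun y => φ y) x‖ := by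
  apply ContinuousMultilinearMap.opNorm_le_bound (by positivity)
  intro v
  have hv : v = fun i => ∑ j : Fin n, (v i j) • (EuclideanSpace.single j (1:ℝ) : Rn n) := by
    funext i
    conv_lhs => rw [← (EuclideanSpace.basisFun (Fin n) ℝ).sum_repr (v i)]
    simp
  conv_lhs => rw [hv]
  rw [ContinuousMultilinearMap.map_sum]
  refine (norm_sum_le _ _).trans ?_
  rw [Finset.sum_mul]
  refine Finset.sum_le_sum fun w _ => ?_
  have := (iteratedFDeriv ℝ l φ x).map_smul_univ (fun i => v i (w i)) (fun i => (EuclideanSpace.single (w i) (1:ℝ) : Rn n))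
  rw [this, norm_smul, iter_eq_wD, wD_eq_word, mul_comm, mderiv_eq]
  refine mul_le_mul_of_nonneg_left ?_ (norm_nonneg _)
  rw [norm_prod]
  refine Finset.prod_le_prod (fun _ _ => norm_nonneg _) fun i _ => ?_
  exact PiLp.norm_apply_le (v i) (w i)

/-- vanishing moments in terms of iterated derivatives -/
lemma iter_zero_of_mom {S : ℤ} {ψ : Sch n} (h : ∀ α : Fin n → ℕ, (mdeg α : ℤ) ≤ S → mderiv α (fun y => ψ y) 0 = 0)
    {l : ℕ} (hl : (l:ℤ) ≤ S) : iteratedFDeriv ℝ l ψ 0 = 0 := by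
  rw [← norm_le_zero_iff]
  refine (iter_norm_le l ψ 0).trans (le_of_eq (Finset.sum_eq_zero fun w _ => ?_))
  rw [h _ (by rw [mdeg_count]; simpa using hl), norm_zero]

lemma resol_iter {φ : ℕ → Sch n} (hφ : SmoothResolution n φ) (l : ℕ) :
    ∃ c : ℝ, 0 ≤ c ∧ ∀ (j : ℕ) (ξ : Rn n), ‖iteratedFDeriv ℝ l (φ j) ξ‖ ≤ c * ((2:ℝ) ^ j)⁻¹ ^ l := by
  choose c hc using hφ.deriv_bound
  have hc0 : ∀ α, 0 ≤ c α := fun α => by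
    have := (norm_nonneg _).trans (hc α 0 0)
    simpa using this
  refine ⟨∑ w : Fin l → Fin n, c (fun i => (List.ofFn w).count i),
    Finset.sum_nonneg fun w _ => hc0 _, fun j ξ => (iter_norm_le l _ ξ).trans ?_⟩
  rw [Finset.sum_mul]
  refine Finset.sum_le_sum fun w _ => (hc _ j ξ).trans (le_of_eq ?_)
  rw [mdeg_count]
  congr 1
  rw [List.length_ofFn, neg_mul, Real.rpow_neg (by norm_num), Real.rpow_mul (by norm_num), Real.rpow_natCast,
    Real.rpow_natCast, inv_pow]

lemma iter_bound (ψ : Sch n) (l N : ℕ) : ∃ C, 0 ≤ C ∧ ∀ x, (1 + ‖x‖) ^ N * ‖iteratedFDeriv ℝ l ψ x‖ ≤ C := by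
  refine ⟨2 ^ N * ((Finset.Iic (N, l)).sup (fun m => SchwartzMap.seminorm ℝ m.1 m.2) ψ),
    by positivity, fun x => ?_⟩
  exact SchwartzMap.one_add_le_sup_seminorm_apply (𝕜 := ℝ) (m := (N, l)) (k := N) (n := l)
    le_rfl le_rfl ψ x

/-- Taylor-type bound from vanishing moments: `d = S+1 - l` -/
lemma mom_bound {L : ℕ} {ψ : Sch n} (h : ∀ l < L, iteratedFDeriv ℝ l ψ 0 = 0) :
    ∀ d l : ℕ, l + d = L → ∃ C, 0 ≤ C ∧ ∀ x, ‖iteratedFDeriv ℝ l ψ x‖ ≤ C * ‖x‖ ^ d := by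
  intro d
  induction d with
  | zero =>
    intro l _
    obtain ⟨C, hC, h⟩ := iter_bound ψ l 0
    exact ⟨C, hC, fun x => by simpa using h x⟩
  | succ d ih =>
    intro l hl
    obtain ⟨C, hC, hb⟩ := ih (l + 1) (by omega)
    refine ⟨C, hC, fun x => ?_⟩
    have hd : ∀ y ∈ closedBall (0 : Rn n) ‖x‖, DifferentiableAt ℝ (iteratedFDeriv ℝ l ψ) y := fun y _ =>
      ((ψ.smooth (l+1)).differentiable_iteratedFDeriv (m := l) (by exact_mod_cast Nat.lt_succ_self l)).differentiableAt
    have hbd : ∀ y ∈ closedBall (0 : Rn n) ‖x‖, ‖fderiv ℝ (iteratedFDeriv ℝ l ψ) y‖ ≤ C * ‖x‖ ^ d := fun y hy => by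
      rw [norm_fderiv_iteratedFDeriv]
      refine (hb y).trans ?_
      have : ‖y‖ ≤ ‖x‖ := by simpa using hy
      gcongr
    have := (convex_closedBall (0 : Rn n) ‖x‖).norm_image_sub_le_of_norm_fderiv_le hd hbd
      (x := 0) (y := x) (by simp) (by simp)
    rw [h l (by omega)] at this
    simpa [pow_succ, mul_assoc] using this

end Sub
end

noncomputable section
open MeasureTheory Filter Metric Real Set SchwartzMap
open scoped ENNReal NNReal Topology FourierTransform
namespace Sub
variable {n : ℕ}

def W (a : ℝ) (M : Sch n) : ℝ≥0∞ := ∫⁻ z, ‖(𝓕⁻ M : Sch n) z‖ₑ * ENNReal.ofReal ((1 + ‖z‖) ^ a)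

lemma fInv_dilate (M : Sch n) {t : ℝ} (ht : 0 < t) (z : Rn n) :
    (𝓕⁻ (dilate M t⁻¹) : Sch n) z = (t:ℂ) ^ n * (𝓕⁻ M : Sch n) (t • z) := by
  rw [fourierInv_coe, fourierInv_coe, Real.fourierInv_eq, Real.fourierInv_eq]
  have h := Measure.integral_comp_smul (volume : Measure (Rn n))
    (fun v => Real.fourierChar (inner ℝ v (t • z)) • M v) t⁻¹
  have e : (fun v : Rn n => Real.fourierChar (inner ℝ v z) • (dilate M t⁻¹) v) =
      fun v => Real.fourierChar (inner ℝ (t⁻¹ • v) (t • z)) • M (t⁻¹ • v) := by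
    funext v
    rw [dilate_apply _ (inv_ne_zero ht.ne'), inner_smul_left, inner_smul_right]
    congr 3
    simp; field_simp
  rw [e, h, finrank_euclideanSpace, Fintype.card_fin, inv_pow, inv_inv, abs_of_pos (by positivity)]
  simp

lemma W_scale (a : ℝ) (M : Sch n) {t : ℝ} (ht : 0 < t) :
    ∫⁻ z, ‖(𝓕⁻ (dilate M t⁻¹) : Sch n) z‖ₑ * ENNReal.ofReal ((1 + t * ‖z‖) ^ a) = W a M := by
  unfold W
  rw [← lint_scale ht (fun z => ‖(𝓕⁻ M : Sch n) z‖ₑ * ENNReal.ofReal ((1 + ‖z‖) ^ a))]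
  congr 1; ext z
  rw [fInv_dilate M ht, enorm_mul, enorm_pow, norm_smul, Real.norm_of_nonneg ht.le, mul_assoc]
  congr 1
  rw [ENNReal.ofReal_pow ht.le]
  congr 1
  rw [← ofReal_norm_eq_enorm]; simp [abs_of_pos ht]

lemma pm_conv {E : Type*} [NormedAddCommGroup E] [NormedSpace ℂ E] {a : ℝ} (ha : 0 ≤ a)
    (M B : Sch n) {t τ : ℝ} (ht : 0 < t) (hτ : 0 < τ) (f : TDist n E) (x : Rn n) :
    peetreMax a τ (mOp (mulS (dilate M t⁻¹) B) f) x ≤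
      W a M * ENNReal.ofReal (max 1 (t / τ) ^ a) * peetreMax a t (mOp B f) x := by
  rw [pm_le_iff hτ]
  intro y
  have hcont : Measurable fun z => ‖(𝓕⁻ (dilate M t⁻¹) : Sch n) z‖ₑ * ENNReal.ofReal ((1 + t * ‖z‖) ^ a) := by
    have := (𝓕⁻ (dilate M t⁻¹) : Sch n).continuous
    have h2 := this.enorm.measurable
    fun_prop
  calc _ ≤ ∫⁻ z, ‖(𝓕⁻ (dilate M t⁻¹) : Sch n) z‖ₑ * ‖mOp B f (x - y - z)‖ₑ := mOp_conv _ _ f _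
    _ ≤ ∫⁻ z, (‖(𝓕⁻ (dilate M t⁻¹) : Sch n) z‖ₑ * ENNReal.ofReal ((1 + t * ‖z‖) ^ a)) *
          (peetreMax a t (mOp B f) x * ENNReal.ofReal (max 1 (t / τ) ^ a) *
            ENNReal.ofReal ((1 + τ * ‖y‖) ^ a)) := by
        apply lintegral_mono; intro z; dsimp only
        rw [sub_sub, mul_assoc]
        refine mul_le_mul_right ?_ _
        refine (le_pm (a := a) ht _ x (y + z)).trans ?_
        have h1 : (1 + t * ‖y + z‖) ^ a ≤ (1 + t * ‖z‖) ^ a * (max 1 (t / τ) ^ a * (1 + τ * ‖y‖) ^ a) := by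
          refine (wt_mul ht ha y z).trans ?_
          rw [mul_comm]
          apply mul_le_mul_of_nonneg_left _ (by positivity)
          rw [← Real.mul_rpow (by positivity) (by positivity)]
          apply Real.rpow_le_rpow (by positivity) _ ha
          have h2 := le_max_left 1 (t / τ)
          have h3 : t ≤ max 1 (t / τ) * τ := by
            have := le_max_right 1 (t / τ)
            rwa [div_le_iff₀ hτ] at this
          have h4 := norm_nonneg y
          nlinarith
        calc _ ≤ peetreMax a t (mOp B f) x * ENNReal.ofReal ((1 + t * ‖z‖) ^ a * (max 1 (t / τ) ^ a * (1 + τ * ‖y‖) ^ a)) :=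
              mul_le_mul_right (ENNReal.ofReal_le_ofReal h1) _
          _ = _ := by
              rw [ENNReal.ofReal_mul (by positivity), ENNReal.ofReal_mul (by positivity)]; ring
    _ = W a M * (peetreMax a t (mOp B f) x * ENNReal.ofReal (max 1 (t / τ) ^ a) *
            ENNReal.ofReal ((1 + τ * ‖y‖) ^ a)) := by
        rw [lintegral_mul_const _ hcont, W_scale a M ht]
    _ = _ := by ring

/-- kernel decay for the reproducing formula -/
lemma repr_decay (χ : Sch n) (m : ℝ) : ∃ C : ℝ≥0∞, C ≠ ∞ ∧ ∀ t : ℝ, 0 < t → ∀ z,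
    ‖(𝓕⁻ (dilate χ t⁻¹) : Sch n) z‖ₑ ≤ C * Kp m t z := by
  obtain ⟨C, hC, h⟩ := decay_one (𝓕⁻ χ : Sch n) ⌈m⌉₊
  refine ⟨ENNReal.ofReal C, by simp, fun t ht z => ?_⟩
  unfold Kp
  rw [fInv_dilate χ ht, ← ENNReal.ofReal_mul hC, ← ofReal_norm_eq_enorm]
  apply ENNReal.ofReal_le_ofReal
  rw [norm_mul, norm_pow, Complex.norm_real, Real.norm_of_nonneg ht.le, mul_left_comm]
  apply mul_le_mul_of_nonneg_left _ (by positivity)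
  have h1 := h (t • z)
  rw [norm_smul, Real.norm_of_nonneg ht.le] at h1
  rw [Real.rpow_neg (by positivity), ← div_eq_mul_inv, le_div_iff₀ (by positivity)]
  refine le_trans ?_ h1
  rw [mul_comm]
  apply mul_le_mul_of_nonneg_right _ (norm_nonneg _)
  rw [← Real.rpow_natCast]
  exact Real.rpow_le_rpow_of_exponent_le (wt_one_le ht z) (Nat.le_ceil m)

lemma W_le_seminorm (n : ℕ) (a : ℝ) : ∃ (s : Finset (ℕ × ℕ)) (C : ℝ), 0 ≤ C ∧ ∀ M : Sch n,
    W a M ≤ ENNReal.ofReal (C * (s.sup (schwartzSeminormFamily ℂ (Rn n) ℂ)) M) := by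
  set m : ℝ := n + 1 with hm
  set K := ⌈a + m⌉₊ with hK
  set L : Sch n →ₗ[ℂ] Sch n := (FourierTransform.fourierCLE ℂ (Sch n)).symm.toLinearMap with hL
  have hLc : Continuous L := (FourierTransform.fourierCLE ℂ (Sch n)).symm.continuous
  set q : Seminorm ℂ (Sch n) := ((SchwartzMap.seminorm ℂ 0 0) + (SchwartzMap.seminorm ℂ K 0)).comp L with hq
  have hqc : Continuous q := by
    have h0 := ((schwartz_withSeminorms ℂ (Rn n) ℂ).continuous_seminorm (0,0)).comp hLc
    have h1 := ((schwartz_withSeminorms ℂ (Rn n) ℂ).continuous_seminorm (K,0)).comp hLc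
    exact h0.add h1
  obtain ⟨s, C, -, hC⟩ := Seminorm.bound_of_continuous (schwartz_withSeminorms ℂ (Rn n) ℂ) q hqc
  obtain ⟨A, hA, hAi⟩ := Kp_int n (m := m) (by simp [hm])
  refine ⟨s, 2 ^ K * C * A.toReal, by positivity, fun M => ?_⟩
  set b := (s.sup (schwartzSeminormFamily ℂ (Rn n) ℂ)) M with hb
  have hb0 : 0 ≤ b := apply_nonneg _ _
  have hpt : ∀ z, ‖(𝓕⁻ M : Sch n) z‖ * (1 + ‖z‖) ^ a ≤ (2 ^ K * C * b) * (1 + ‖z‖) ^ (-m) := by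
    intro z
    have h1 : ‖(𝓕⁻ M : Sch n) z‖ * (1 + ‖z‖) ^ K ≤ 2 ^ K * q M := by
      have e1 : ‖(𝓕⁻ M : Sch n) z‖ ≤ SchwartzMap.seminorm ℂ 0 0 (𝓕⁻ M : Sch n) := by
        have := SchwartzMap.le_seminorm ℂ 0 0 (𝓕⁻ M : Sch n) z
        simpa using this
      have e2 : ‖z‖ ^ K * ‖(𝓕⁻ M : Sch n) z‖ ≤ SchwartzMap.seminorm ℂ K 0 (𝓕⁻ M : Sch n) := by
        have := SchwartzMap.le_seminorm ℂ K 0 (𝓕⁻ M : Sch n) z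
        simpa using this
      have e3 : q M = SchwartzMap.seminorm ℂ 0 0 (𝓕⁻ M : Sch n) + SchwartzMap.seminorm ℂ K 0 (𝓕⁻ M : Sch n) := rfl
      have e4 : (1 + ‖z‖) ^ K ≤ 2 ^ K * (1 + ‖z‖ ^ K) := by
        rcases le_total ‖z‖ 1 with h | h
        · calc (1 + ‖z‖) ^ K ≤ 2 ^ K := pow_le_pow_left₀ (by positivity) (by linarith) _
            _ ≤ _ := le_mul_of_one_le_right (by positivity) (by simp)
        · calc (1 + ‖z‖) ^ K ≤ (2 * ‖z‖) ^ K := pow_le_pow_left₀ (by positivity) (by linarith) _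
            _ = 2 ^ K * ‖z‖ ^ K := mul_pow _ _ _
            _ ≤ _ := by gcongr; linarith
      calc _ ≤ ‖(𝓕⁻ M : Sch n) z‖ * (2 ^ K * (1 + ‖z‖ ^ K)) := by gcongr
        _ = 2 ^ K * (‖(𝓕⁻ M : Sch n) z‖ + ‖z‖ ^ K * ‖(𝓕⁻ M : Sch n) z‖) := by ring
        _ ≤ _ := by rw [e3]; gcongr
    have h2 : q M ≤ C * b := by
      exact hC M
    rw [Real.rpow_neg (by positivity), ← div_eq_mul_inv, le_div_iff₀ (by positivity), mul_assoc,
      ← Real.rpow_add (by positivity)]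
    calc _ ≤ ‖(𝓕⁻ M : Sch n) z‖ * (1 + ‖z‖) ^ K := by
          gcongr
          rw [← Real.rpow_natCast]
          exact Real.rpow_le_rpow_of_exponent_le (by simp) (Nat.le_ceil _)
      _ ≤ _ := h1
      _ ≤ 2 ^ K * (C * b) := by gcongr
      _ = _ := by ring
  calc W a M ≤ ∫⁻ z : Rn n, ENNReal.ofReal (2 ^ K * C * b) * Kp m 1 z := by
        unfold W
        apply lintegral_mono; intro z; dsimp only
        rw [← ofReal_norm_eq_enorm, ← ENNReal.ofReal_mul (norm_nonneg _)]
        unfold Kp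
        rw [← ENNReal.ofReal_mul (by positivity)]
        apply ENNReal.ofReal_le_ofReal
        simpa using hpt z
    _ = ENNReal.ofReal (2 ^ K * C * b) * ∫⁻ z : Rn n, Kp m 1 z := lintegral_const_mul' _ _ (by simp)
    _ ≤ ENNReal.ofReal (2 ^ K * C * b) * A := mul_le_mul_right (hAi 1 one_pos) _
    _ = _ := by
        nth_rw 1 [← ENNReal.ofReal_toReal hA]
        rw [← ENNReal.ofReal_mul (by positivity)]; congr 1; ring

lemma W_ne_top (a : ℝ) (M : Sch n) : W a M ≠ ∞ := by
  obtain ⟨s, C, _, h⟩ := W_le_seminorm n a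
  exact ne_top_of_le_ne_top (by simp) (h M)

/-- kernel bound for compactly supported multipliers -/
lemma W_le_compact (n : ℕ) (a R : ℝ) : ∃ (L : ℕ) (C : ℝ), 0 ≤ C ∧ ∀ M : Sch n,
    tsupport M ⊆ closedBall 0 R → ∀ b, 0 ≤ b → (∀ l ≤ L, ∀ x ∈ tsupport M, ‖iteratedFDeriv ℝ l M x‖ ≤ b) →
    W a M ≤ ENNReal.ofReal (C * b) := by
  obtain ⟨s, C, hC, h⟩ := W_le_seminorm n a
  refine ⟨s.sup Prod.snd, C * ∑ i ∈ s, (|R|) ^ i.1, by positivity, fun M hM b hb hl => ?_⟩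
  refine (h M).trans (ENNReal.ofReal_le_ofReal ?_)
  rw [mul_assoc]
  apply mul_le_mul_of_nonneg_left _ hC
  apply Seminorm.finset_sup_apply_le (by positivity)
  intro i hi
  calc schwartzSeminormFamily ℂ (Rn n) ℂ i M ≤ |R| ^ i.1 * b := by
        apply SchwartzMap.seminorm_le_bound ℂ _ _ _ (by positivity)
        intro x
        by_cases hx : x ∈ tsupport M
        · have h1 := hM hx
          rw [mem_closedBall_zero_iff] at h1
          have h2 := hl i.2 (Finset.le_sup (f := Prod.snd) hi) x hx
          have h3 : ‖x‖ ≤ |R| := h1.trans (le_abs_self R)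
          gcongr
        · have : iteratedFDeriv ℝ i.2 M x = 0 := by
            by_contra hne
            exact hx (support_iteratedFDeriv_subset i.2 hne)
          rw [this]; simp; positivity
    _ ≤ _ := by
        gcongr
        exact Finset.single_le_sum (f := fun i : ℕ × ℕ => |R| ^ i.1) (fun _ _ => by positivity) hi

lemma dilate_iter (ψ : Sch n) {t : ℝ} (ht : 0 < t) (i : ℕ) (x : Rn n) :
    ‖iteratedFDeriv ℝ i (dilate ψ t) x‖ = t ^ i * ‖iteratedFDeriv ℝ i ψ (t • x)‖ := by
  have e : (⇑(dilate ψ t)) = fun z => ψ (t • z) := funext (dilate_apply ψ ht.ne')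
  rw [e, iteratedFDeriv_comp_const_smul t (ψ.smooth i)]
  rw [norm_smul, norm_pow, Real.norm_of_nonneg ht.le]

lemma tsupport_mulS (m χ : Sch n) : tsupport (mulS m χ) ⊆ tsupport χ := by
  apply closure_mono
  intro x hx
  rw [Function.mem_support] at hx ⊢
  intro h; apply hx; simp [h]

/-- Main kernel lemma -/
lemma W_dilate (a : ℝ) (χ : Sch n) {R : ℝ} (hχ : tsupport χ ⊆ closedBall 0 R) :
    ∃ (L : ℕ) (C : ℝ), 0 ≤ C ∧ ∀ (ψ : Sch n) (t : ℝ), 0 < t → ∀ b, 0 ≤ b →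
    (∀ i ≤ L, ∀ x ∈ tsupport χ, t ^ i * ‖iteratedFDeriv ℝ i ψ (t • x)‖ ≤ b) →
    W a (mulS (dilate ψ t) χ) ≤ ENNReal.ofReal (C * b) := by
  obtain ⟨L, C, hC, h⟩ := W_le_compact n a R
  choose D hD hDb using fun l => iter_bound χ l 0
  refine ⟨L, C * ∑ l ∈ Finset.range (L+1), ∑ i ∈ Finset.range (l+1), (l.choose i : ℝ) * D (l - i),
    mul_nonneg hC (Finset.sum_nonneg fun l _ => Finset.sum_nonneg fun i _ => mul_nonneg (by positivity) (hD _)),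
    fun ψ t ht b hb hi => ?_⟩
  rw [mul_assoc]
  refine h _ ((tsupport_mulS _ _).trans hχ) _ (mul_nonneg (Finset.sum_nonneg fun l _ => Finset.sum_nonneg fun i _ => mul_nonneg (by positivity) (hD _)) hb) fun l hl x hx => ?_
  have hx' := tsupport_mulS _ _ hx
  have e : (⇑(mulS (dilate ψ t) χ)) = fun y => dilate ψ t y * χ y := funext fun y => mulS_apply _ _ y
  rw [e]
  refine (norm_iteratedFDeriv_mul_le ((dilate ψ t).smooth ⊤) (χ.smooth ⊤) x (n := l) (by exact_mod_cast le_top)).trans ?_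
  calc _ ≤ ∑ i ∈ Finset.range (l+1), (l.choose i : ℝ) * b * D (l - i) := by
        refine Finset.sum_le_sum fun i hil => ?_
        rw [dilate_iter ψ ht]
        have h1 := hi i (by simp at hil; omega) x hx'
        have h2 : ‖iteratedFDeriv ℝ (l - i) χ x‖ ≤ D (l - i) := by simpa using hDb (l - i) x
        gcongr
    _ = (∑ i ∈ Finset.range (l+1), (l.choose i : ℝ) * D (l - i)) * b := by
        rw [Finset.sum_mul]; refine Finset.sum_congr rfl fun i _ => by ring
    _ ≤ _ := by
        apply mul_le_mul_of_nonneg_right _ hb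
        exact Finset.single_le_sum (f := fun l => ∑ i ∈ Finset.range (l+1), (l.choose i : ℝ) * D (l - i))
          (fun l _ => Finset.sum_nonneg fun i _ => mul_nonneg (by positivity) (hD _)) (by simp; omega)

end Sub
end

noncomputable section
open MeasureTheory Filter Metric Real Set SchwartzMap
open scoped ENNReal NNReal Topology FourierTransform
namespace Sub
variable {n : ℕ}

lemma T1 (a : ℝ) {L : ℕ} {ψ : Sch n} (h : ∀ l < L, iteratedFDeriv ℝ l ψ 0 = 0) (χ : Sch n) {R : ℝ}
    (hχ : tsupport χ ⊆ closedBall 0 R) : ∃ C, 0 ≤ C ∧ ∀ t : ℝ, 0 < t → t ≤ 1 →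
    W a (mulS (dilate ψ t) χ) ≤ ENNReal.ofReal (C * t ^ L) := by
  obtain ⟨L0, C, hC, hW⟩ := W_dilate a χ hχ
  have key : ∀ i : ℕ, ∃ D, 0 ≤ D ∧ ∀ t : ℝ, 0 < t → t ≤ 1 → ∀ x ∈ tsupport χ,
      t ^ i * ‖iteratedFDeriv ℝ i ψ (t • x)‖ ≤ D * t ^ L := by
    intro i
    rcases le_or_gt i L with hi | hi
    · obtain ⟨D, hD, hb⟩ := mom_bound h (L - i) i (by omega)
      refine ⟨D * |R| ^ (L - i), by positivity, fun t ht ht1 x hx => ?_⟩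
      have hx' : ‖x‖ ≤ |R| := (mem_closedBall_zero_iff.1 (hχ hx)).trans (le_abs_self R)
      calc _ ≤ t ^ i * (D * ‖t • x‖ ^ (L - i)) := by gcongr; exact hb _
        _ ≤ t ^ i * (D * (t * |R|) ^ (L - i)) := by
            rw [norm_smul, Real.norm_of_nonneg ht.le]; gcongr
        _ = D * |R| ^ (L - i) * (t ^ i * t ^ (L - i)) := by rw [mul_pow]; ring
        _ = _ := by rw [← pow_add]; congr 2; omega
    · obtain ⟨D, hD, hb⟩ := iter_bound ψ i 0
      refine ⟨D, hD, fun t ht ht1 x hx => ?_⟩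
      have := hb (t • x)
      rw [pow_zero, one_mul] at this
      calc _ ≤ t ^ L * D :=
            mul_le_mul (pow_le_pow_of_le_one ht.le ht1 hi.le) this (norm_nonneg _) (by positivity)
        _ = _ := mul_comm _ _
  choose D hD hb using key
  have hs : 0 ≤ ∑ i ∈ Finset.range (L0 + 1), D i := Finset.sum_nonneg fun i _ => hD i
  refine ⟨C * ∑ i ∈ Finset.range (L0 + 1), D i, mul_nonneg hC hs, fun t ht ht1 => ?_⟩
  rw [mul_assoc]
  refine hW ψ t ht _ (by positivity) fun i hi x hx => (hb i t ht ht1 x hx).trans ?_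
  apply mul_le_mul_of_nonneg_right _ (by positivity)
  exact Finset.single_le_sum (f := D) (fun i _ => hD i) (by simp; omega)

lemma T2 (a : ℝ) (ψ χ : Sch n) {R ρ : ℝ} (hρ : 0 < ρ)
    (hχ : tsupport χ ⊆ closedBall 0 R) (hχ' : ∀ x ∈ tsupport χ, ρ ≤ ‖x‖) (N : ℕ) :
    ∃ C, 0 ≤ C ∧ ∀ t : ℝ, 1 ≤ t →
    W a (mulS (dilate ψ t) χ) ≤ ENNReal.ofReal (C * t⁻¹ ^ N) := by
  obtain ⟨L0, C, hC, hW⟩ := W_dilate a χ hχ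
  have key : ∀ i : ℕ, ∃ D, 0 ≤ D ∧ ∀ t : ℝ, 1 ≤ t → ∀ x ∈ tsupport χ,
      t ^ i * ‖iteratedFDeriv ℝ i ψ (t • x)‖ ≤ D * t⁻¹ ^ N := by
    intro i
    obtain ⟨D, hD, hb⟩ := iter_bound ψ i (N + i)
    refine ⟨D * (ρ⁻¹) ^ (N + i), by positivity, fun t ht x hx => ?_⟩
    have ht0 : 0 < t := by linarith
    have h1 := hb (t • x)
    rw [norm_smul, Real.norm_of_nonneg ht0.le] at h1
    have h2 : (t * ρ) ^ (N + i) * ‖iteratedFDeriv ℝ i ψ (t • x)‖ ≤ D := by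
      refine le_trans ?_ h1
      gcongr
      have := mul_le_mul_of_nonneg_left (hχ' x hx) ht0.le
      linarith
    have e : t ^ i * ‖iteratedFDeriv ℝ i ψ (t • x)‖ =
      ((t * ρ) ^ (N + i) * ‖iteratedFDeriv ℝ i ψ (t • x)‖) * (ρ⁻¹ ^ (N + i) * t⁻¹ ^ N) := by
      rw [mul_pow, pow_add t, inv_pow, inv_pow]; field_simp
    rw [e, mul_assoc D]
    gcongr
  choose D hD hb using key
  have hs : 0 ≤ ∑ i ∈ Finset.range (L0 + 1), D i := Finset.sum_nonneg fun i _ => hD i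
  refine ⟨C * ∑ i ∈ Finset.range (L0 + 1), D i, mul_nonneg hC hs, fun t ht => ?_⟩
  have ht0 : 0 < t := by linarith
  rw [mul_assoc]
  refine hW ψ t ht0 _ (by positivity) fun i hi x hx => (hb i t ht x hx).trans ?_
  apply mul_le_mul_of_nonneg_right _ (by positivity)
  exact Finset.single_le_sum (f := D) (fun i _ => hD i) (by simp; omega)

section
variable {E : Type*} [NormedAddCommGroup E] [NormedSpace ℂ E]

lemma pm_sum {a τ : ℝ} (hτ : 0 < τ) (A : Sch n) (b : ℕ → Sch n)
    (hlim : Tendsto (fun N => ∑ k ∈ Finset.range N, b k) atTop (𝓝 A)) (f : TDist n E) (x : Rn n) :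
    peetreMax a τ (mOp A f) x ≤ ∑' k, peetreMax a τ (mOp (b k) f) x := by
  rw [pm_le_iff hτ]
  intro y
  have h1 := (mOp_tendsto A f (x - y) _ hlim).enorm
  refine le_of_tendsto h1 (Eventually.of_forall fun N => ?_)
  rw [mOp_sum]
  refine (enorm_sum_le _ _).trans ?_
  rw [← ENNReal.tsum_mul_right]
  refine le_trans ?_ (ENNReal.sum_le_tsum (Finset.range N))
  exact Finset.sum_le_sum fun k _ => le_pm hτ _ x y

lemma transfer {a : ℝ} (ha : 0 ≤ a) (s δ : ℝ) (A B : ℕ → Sch n) (M : ℕ → ℕ → Sch n)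
    (hlim : ∀ j, Tendsto (fun N => ∑ k ∈ Finset.range N, mulS (dilate (M j k) ((2:ℝ) ^ k)⁻¹) (B k))
      atTop (𝓝 (A j))) (C : ℝ≥0∞)
    (hW : ∀ j k, W a (M j k) * ENNReal.ofReal (max 1 ((2:ℝ) ^ k / (2:ℝ) ^ j) ^ a) *
      (2:ℝ≥0∞) ^ ((j:ℝ) * s) ≤ C * (ker δ j k * (2:ℝ≥0∞) ^ ((k:ℝ) * s))) (f : TDist n E) (x : Rn n) (j : ℕ) :
    (2:ℝ≥0∞) ^ ((j:ℝ) * s) * peetreMax a (2 ^ j) (mOp (A j) f) x ≤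
      ∑' k, ker δ j k * (C * ((2:ℝ≥0∞) ^ ((k:ℝ) * s) * peetreMax a (2 ^ k) (mOp (B k) f) x)) := by
  refine (mul_le_mul_right (pm_sum (by positivity) _ _ (hlim j) f x) _).trans ?_
  rw [← ENNReal.tsum_mul_left]
  refine ENNReal.tsum_le_tsum fun k => ?_
  refine (mul_le_mul_right (pm_conv ha (M j k) (B k) (by positivity) (by positivity) f x) _).trans ?_
  have := mul_le_mul_left (hW j k) (peetreMax a (2 ^ k) (mOp (B k) f) x)
  calc _ = W a (M j k) * ENNReal.ofReal (max 1 ((2:ℝ) ^ k / (2:ℝ) ^ j) ^ a) *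
      (2:ℝ≥0∞) ^ ((j:ℝ) * s) * peetreMax a (2 ^ k) (mOp (B k) f) x := by ring
    _ ≤ _ := this
    _ = _ := by ring

/-- the mixed norm of Peetre maximal functions of a family -/
def pN (s : ℝ) (p q : ℝ≥0∞) (a : ℝ) (A : ℕ → Sch n) (f : TDist n E) : ℝ≥0∞ :=
  lpNormENN p fun x => lqSum q fun j => (2:ℝ≥0∞) ^ ((j:ℝ) * s) * peetreMax a (2 ^ j) (mOp (A j) f) x

lemma transfer_norm {p q : ℝ≥0∞} (hp : 0 < p) (hp' : p ≠ ∞) (hq : 0 < q) {a : ℝ} (ha : 0 ≤ a) (s : ℝ) {δ : ℝ} (hδ : 0 < δ)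
    (A B : ℕ → Sch n) (M : ℕ → ℕ → Sch n)
    (hlim : ∀ j, Tendsto (fun N => ∑ k ∈ Finset.range N, mulS (dilate (M j k) ((2:ℝ) ^ k)⁻¹) (B k))
      atTop (𝓝 (A j))) {C : ℝ≥0∞} (hC : C ≠ ∞)
    (hW : ∀ j k, W a (M j k) * ENNReal.ofReal (max 1 ((2:ℝ) ^ k / (2:ℝ) ^ j) ^ a) *
      (2:ℝ≥0∞) ^ ((j:ℝ) * s) ≤ C * (ker δ j k * (2:ℝ≥0∞) ^ ((k:ℝ) * s))) :
    ∃ C' : ℝ≥0∞, C' ≠ ∞ ∧ ∀ f : TDist n E, pN s p q a A f ≤ C' * pN s p q a B f := by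
  obtain ⟨C1, hC1, h1⟩ := seq_le hq hδ
  refine ⟨C1 * C, ENNReal.mul_ne_top hC1 hC, fun f => ?_⟩
  unfold pN
  rw [← lp_mul hp hp' (ENNReal.mul_ne_top hC1 hC)]
  refine lp_mono hp' fun x => ?_
  rw [mul_assoc, ← lqSum_mul hq]
  exact h1 _ _ fun j => transfer ha s δ A B M hlim C hW f x j

/-- Step A -/
lemma stepA {p q : ℝ≥0∞} (hp : 0 < p) (hp' : p ≠ ∞) (hq : 0 < q) (a : ℝ)
    (ha : (n : ℝ) / (min p q).toReal < a) (s : ℝ) (φ : ℕ → Sch n) (χ : Sch n)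
    (hχ : ∀ k, φ k = mulS (dilate χ ((2:ℝ) ^ k)⁻¹) (φ k)) :
    ∃ C : ℝ≥0∞, C ≠ ∞ ∧ ∀ f : TDist n E, pN s p q a φ f ≤ C * triebelNorm s p q φ f := by
  have hmin : min p q ≠ ∞ := ne_top_of_le_ne_top hp' (min_le_left _ _)
  have hmin0 : 0 < min p q := lt_min hp hq
  have hmt := tR hmin0 hmin
  have ha0 : 0 < a := lt_of_le_of_lt (by positivity) ha
  have h1 : (n:ℝ) / a < (min p q).toReal := by
    rw [div_lt_iff₀ hmt] at ha
    rw [div_lt_iff₀ ha0]; linarith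
  obtain ⟨r, hr1, hr2⟩ := exists_between h1
  have hr0 : 0 < r := lt_of_le_of_lt (by positivity) hr1
  have hm : (n:ℝ) < a * r := by rw [div_lt_iff₀ ha0] at hr1; linarith
  have hrm : ENNReal.ofReal r < min p q := by rwa [ENNReal.ofReal_lt_iff_lt_toReal hr0.le hmin]
  have hrp : r < p.toReal := by
    rw [← ENNReal.ofReal_lt_iff_lt_toReal hr0.le hp']
    exact hrm.trans_le (min_le_left _ _)
  choose C hC hK using repr_decay χ
  obtain ⟨D, hD, hP⟩ := peetre_le (E := E) n ha0.le hr0 C hC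
  obtain ⟨C', hC', hB⟩ := stepB (n := n) hp hp' hq s hr0 hrp (hrm.trans_le (min_le_right _ _)) hm hD
  refine ⟨C', hC', fun f => ?_⟩
  refine hB (fun k x => ‖mOp (φ k) f x‖ₑ) (fun k => peetreMax a (2 ^ k) (mOp (φ k) f))
    (fun k => (mOp_cont _ f).enorm.measurable) fun k x => ?_
  refine hP (2 ^ k) (by positivity) _ (mOp_cont _ f) (mOp_growth _ f) (fun m hm y => ?_) x
  have h2 := mOp_conv (dilate χ ((2:ℝ) ^ k)⁻¹) (φ k) f y
  rw [← hχ k] at h2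
  refine h2.trans ?_
  rw [cv_alt, ← lintegral_const_mul' _ _ (hC m)]
  refine lintegral_mono fun z => ?_
  dsimp only
  rw [← mul_assoc]
  exact mul_le_mul_left (hK m _ (by positivity) z) _
end
end Sub
end

noncomputable section
open MeasureTheory Filter Metric Real Set SchwartzMap
open scoped ENNReal NNReal Topology FourierTransform
namespace Sub
variable {n : ℕ}

lemma exists_bump (n : ℕ) {r R : ℝ} (hr : 0 < r) (hR : r < R) : ∃ χ : Sch n,
    (∀ x, ‖x‖ ≤ r → χ x = 1) ∧ tsupport χ ⊆ closedBall 0 R := by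
  let f : ContDiffBump (0 : Rn n) := ⟨r, R, hr, hR⟩
  have hs : Function.support (fun x => ((f x : ℝ) : ℂ)) = Function.support f := by
    ext x; simp
  have hts : tsupport (fun x => ((f x : ℝ) : ℂ)) = closedBall 0 R := by
    unfold tsupport; rw [hs]; exact f.tsupport_eq
  have hc : HasCompactSupport (fun x => ((f x : ℝ) : ℂ)) := by
    unfold HasCompactSupport; rw [hts]; exact isCompact_closedBall _ _
  have hd : ContDiff ℝ ((⊤:ℕ∞):WithTop ℕ∞) (fun x => ((f x : ℝ) : ℂ)) := Complex.ofRealCLM.contDiff.comp f.contDiff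
  refine ⟨hc.toSchwartzMap hd, fun x hx => ?_, hts.le⟩
  show ((f x : ℝ) : ℂ) = 1
  rw [f.one_of_mem_closedBall (by simpa using hx)]; simp

lemma zero_of_tsupp {χ : Sch n} {R : ℝ} (h : tsupport χ ⊆ closedBall 0 R) {x : Rn n} (hx : R < ‖x‖) : χ x = 0 := by
  by_contra hne
  have := h (subset_tsupport _ hne)
  rw [mem_closedBall_zero_iff] at this; linarith

/-- difference bump -/
lemma exists_bump_pair (n : ℕ) {r R : ℝ} (hr : 0 < r) (hR : r < R) {κ : ℝ} (hκ : 1 ≤ κ) : ∃ χ χ' : Sch n,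
    (∀ x, ‖x‖ ≤ r → χ x = 1) ∧ tsupport χ ⊆ closedBall 0 R ∧
    (∀ x, χ' x = χ x - χ (κ • x)) ∧ tsupport χ' ⊆ closedBall 0 R ∧ ∀ x ∈ tsupport χ', r / κ ≤ ‖x‖ := by
  obtain ⟨χ, h1, h2⟩ := exists_bump n hr hR
  have hκ0 : 0 < κ := by linarith
  have e : ∀ x, (χ - dilate χ κ) x = χ x - χ (κ • x) := fun x => by
    rw [SchwartzMap.sub_apply, dilate_apply _ hκ0.ne']
  refine ⟨χ, χ - dilate χ κ, h1, h2, e, ?_, ?_⟩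
  · apply closure_minimal _ isClosed_closedBall
    intro x hx
    by_contra hne
    rw [mem_closedBall_zero_iff, not_le] at hne
    apply hx
    have h3 : R < ‖κ • x‖ := by
      rw [norm_smul, Real.norm_of_nonneg hκ0.le]
      nlinarith [norm_nonneg x]
    rw [e, zero_of_tsupp h2 hne, zero_of_tsupp h2 h3, sub_zero]
  · have : tsupport (χ - dilate χ κ : Sch n) ⊆ {x | r / κ ≤ ‖x‖} := by
      apply closure_minimal _ (isClosed_le continuous_const continuous_norm)
      intro x hx
      by_contra hne
      rw [mem_setOf_eq, not_le, lt_div_iff₀ hκ0] at hne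
      apply hx
      have h3 : ‖κ • x‖ ≤ r := by
        rw [norm_smul, Real.norm_of_nonneg hκ0.le]; linarith
      have h4 : ‖x‖ ≤ r := by nlinarith [norm_nonneg x]
      rw [e, h1 _ h3, h1 _ h4, sub_self]
    exact this

lemma supp_le {φ : ℕ → Sch n} (hφ : SmoothResolution n φ) {j : ℕ} {ξ : Rn n} (h : φ j ξ ≠ 0) :
    ‖ξ‖ ≤ 2 * 2 ^ j := by
  rcases Nat.eq_zero_or_pos j with rfl | hj
  · simpa using hφ.supp0 h
  · have := (hφ.suppj j hj h).2
    rw [Real.rpow_add (by norm_num), Real.rpow_natCast, Real.rpow_one] at this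
    linarith

lemma supp_ge {φ : ℕ → Sch n} (hφ : SmoothResolution n φ) {j : ℕ} (hj : 0 < j) {ξ : Rn n} (h : φ j ξ ≠ 0) :
    2 ^ j ≤ 2 * ‖ξ‖ := by
  have := (hφ.suppj j hj h).1
  rw [Real.rpow_sub (by norm_num), Real.rpow_natCast, Real.rpow_one] at this
  linarith

lemma partial_one {φ : ℕ → Sch n} (hφ : SmoothResolution n φ) {N : ℕ} (hN : 0 < N) {ξ : Rn n}
    (h : 2 * ‖ξ‖ < 2 ^ N) : ∑ k ∈ Finset.range N, φ k ξ = 1 := by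
  rw [← hφ.sum_eq ξ]
  symm
  apply tsum_eq_sum
  intro k hk
  by_contra hne
  simp at hk
  have h1 := supp_ge hφ (by omega) hne
  have h2 : (2:ℝ) ^ N ≤ 2 ^ k := pow_le_pow_right₀ (by norm_num) hk
  linarith

lemma mul_decay {φ : ℕ → Sch n} (hφ : SmoothResolution n φ) (A : Sch n) (K l : ℕ) : ∃ C, 0 ≤ C ∧ ∀ k x,
    (1 + ‖x‖) ^ K * ‖iteratedFDeriv ℝ l (mulS A (φ k)) x‖ ≤ C := by
  choose c hc hb using resol_iter hφ
  choose D hD hDb using fun l => iter_bound A l K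
  refine ⟨∑ i ∈ Finset.range (l+1), (l.choose i : ℝ) * D i * c (l - i),
    Finset.sum_nonneg fun i _ => mul_nonneg (mul_nonneg (by positivity) (hD _)) (hc _), fun k x => ?_⟩
  have e : (⇑(mulS A (φ k))) = fun y => A y * φ k y := funext fun y => mulS_apply _ _ y
  rw [e]
  have h1 := norm_iteratedFDeriv_mul_le (A.smooth ⊤) ((φ k).smooth ⊤) x (n := l) (by exact_mod_cast le_top)
  refine (mul_le_mul_of_nonneg_left h1 (by positivity)).trans ?_
  rw [Finset.mul_sum]
  refine Finset.sum_le_sum fun i _ => ?_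
  have h2 : ‖iteratedFDeriv ℝ (l - i) (φ k) x‖ ≤ c (l - i) := by
    refine (hb (l - i) k x).trans (mul_le_of_le_one_right (hc _) ?_)
    apply pow_le_one₀ (by positivity)
    exact inv_le_one_of_one_le₀ (one_le_pow₀ (by norm_num))
  have h3 := hDb i x
  calc _ = (l.choose i : ℝ) * ((1 + ‖x‖) ^ K * ‖iteratedFDeriv ℝ i A x‖) * ‖iteratedFDeriv ℝ (l - i) (φ k) x‖ := by ring
    _ ≤ _ := by
      have := hD i
      gcongr

lemma sum_tendsto {φ : ℕ → Sch n} (hφ : SmoothResolution n φ) (A : Sch n) :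
    Tendsto (fun N => ∑ k ∈ Finset.range N, mulS A (φ k)) atTop (𝓝 A) := by
  rw [(schwartz_withSeminorms ℝ (Rn n) ℂ).tendsto_nhds]
  rintro ⟨K, l⟩ ε hε
  obtain ⟨C, hC, hb⟩ := mul_decay hφ A (K + 1) l
  obtain ⟨D, hD, hDb⟩ := iter_bound A l (K + 1)
  have hlim : Tendsto (fun N : ℕ => ((N:ℝ) ^ 1 * (1/2:ℝ) ^ N) * (2 * C) + ((N:ℝ) ^ 0 * (1/2:ℝ) ^ N) * (2 * D)) atTop (𝓝 0) := by
    have h1 := (tendsto_pow_const_mul_const_pow_of_abs_lt_one 1 (r := (1/2:ℝ)) (by rw [abs_of_pos] <;> norm_num)).mul_const (2 * C)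
    have h2 := (tendsto_pow_const_mul_const_pow_of_abs_lt_one 0 (r := (1/2:ℝ)) (by rw [abs_of_pos] <;> norm_num)).mul_const (2 * D)
    simpa using h1.add h2
  filter_upwards [hlim.eventually_lt_const hε, eventually_gt_atTop 0] with N hN hN0
  refine lt_of_le_of_lt ?_ hN
  apply SchwartzMap.seminorm_le_bound ℝ _ _ _ (by positivity)
  intro x
  have hfun : (⇑(∑ k ∈ Finset.range N, mulS A (φ k) - A)) = fun y => (∑ k ∈ Finset.range N, mulS A (φ k)) y - A y := rfl
  have hval : ∀ y, (∑ k ∈ Finset.range N, mulS A (φ k)) y = A y * ∑ k ∈ Finset.range N, φ k y := by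
    intro y
    rw [SchwartzMap.sum_apply, Finset.mul_sum]
    simp
  dsimp only
  by_cases hx : 2 * ‖x‖ < 2 ^ N
  · have hz : (⇑(∑ k ∈ Finset.range N, mulS A (φ k) - A)) =ᶠ[𝓝 x] fun _ => 0 := by
      have ho : IsOpen {y : Rn n | 2 * ‖y‖ < 2 ^ N} := isOpen_lt (by fun_prop) continuous_const
      filter_upwards [ho.mem_nhds hx] with y hy
      rw [hfun]
      dsimp only
      rw [hval, partial_one hφ hN0 hy, mul_one, sub_self]
    rw [(hz.iteratedFDeriv ℝ l).eq_of_nhds]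
    simp only [iteratedFDeriv_zero_fun, Pi.zero_apply, norm_zero, mul_zero]
    positivity
  · push Not at hx
    have hx1 : 2 ^ N ≤ 2 * (1 + ‖x‖) := by linarith
    have hpos : 0 < 1 + ‖x‖ := by positivity
    have hinv : (1 + ‖x‖)⁻¹ ≤ 2 * (1/2:ℝ) ^ N := by
      rw [inv_le_iff_one_le_mul₀ hpos]
      have : (1/2:ℝ) ^ N * 2 ^ N = 1 := by rw [← mul_pow]; norm_num
      nlinarith [pow_pos (show (0:ℝ) < 1/2 by norm_num) N]
    have hone : ∀ {g : Rn n → ℂ} {B : ℝ}, 0 ≤ B → (1 + ‖x‖) ^ (K+1) * ‖iteratedFDeriv ℝ l g x‖ ≤ B →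
        ‖x‖ ^ K * ‖iteratedFDeriv ℝ l g x‖ ≤ (1/2:ℝ) ^ N * (2 * B) := by
      intro g B hB h
      calc ‖x‖ ^ K * ‖iteratedFDeriv ℝ l g x‖ ≤ (1 + ‖x‖) ^ K * ‖iteratedFDeriv ℝ l g x‖ := by
            gcongr; linarith
        _ = ((1 + ‖x‖) ^ (K+1) * ‖iteratedFDeriv ℝ l g x‖) * (1 + ‖x‖)⁻¹ := by
            rw [pow_succ]; field_simp
        _ ≤ B * (2 * (1/2:ℝ) ^ N) := by gcongr
        _ = _ := by ring
    have hsub : iteratedFDeriv ℝ l (⇑(∑ k ∈ Finset.range N, mulS A (φ k) - A)) x =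
        ∑ k ∈ Finset.range N, iteratedFDeriv ℝ l (mulS A (φ k)) x - iteratedFDeriv ℝ l A x := by
      have e : (⇑(∑ k ∈ Finset.range N, mulS A (φ k) - A)) = (fun y => ∑ k ∈ Finset.range N, mulS A (φ k) y) - ⇑A := by
        funext y
        simp [SchwartzMap.sum_apply]
      rw [e, iteratedFDeriv_sub_apply, iteratedFDeriv_fun_sum_apply]
      · intro k _; exact ((mulS A (φ k)).smooth l).contDiffAt
      · exact (ContDiff.sum fun k _ => (mulS A (φ k)).smooth l).contDiffAt
      · exact (A.smooth l).contDiffAt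
    rw [hsub]
    calc _ ≤ ‖x‖ ^ K * (∑ k ∈ Finset.range N, ‖iteratedFDeriv ℝ l (mulS A (φ k)) x‖ + ‖iteratedFDeriv ℝ l A x‖) := by
          gcongr
          exact (norm_sub_le _ _).trans (by gcongr; exact norm_sum_le _ _)
      _ = ∑ k ∈ Finset.range N, ‖x‖ ^ K * ‖iteratedFDeriv ℝ l (mulS A (φ k)) x‖ + ‖x‖ ^ K * ‖iteratedFDeriv ℝ l A x‖ := by
          rw [mul_add, Finset.mul_sum]
      _ ≤ ∑ k ∈ Finset.range N, (1/2:ℝ) ^ N * (2 * C) + (1/2:ℝ) ^ N * (2 * D) :=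
          add_le_add (Finset.sum_le_sum fun k _ => hone hC (hb k x)) (hone hD (hDb x))
      _ = _ := by simp; ring

lemma two_rpow (r : ℝ) : (2:ℝ≥0∞) ^ r = ENNReal.ofReal ((2:ℝ) ^ r) := by
  rw [← ENNReal.ofReal_rpow_of_pos (by norm_num)]; simp

lemma hW_of {a s δ : ℝ} {L N : ℕ} (hδ : δ ≤ L - s) (hN : a - s + δ ≤ N) {w : ℝ≥0∞} {C : ℝ} (hC : 0 ≤ C) {j k : ℕ}
    (h1 : k ≤ j → w ≤ ENNReal.ofReal (C * ((2:ℝ) ^ k / (2:ℝ) ^ j) ^ L))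
    (h2 : j < k → w ≤ ENNReal.ofReal (C * ((2:ℝ) ^ k / (2:ℝ) ^ j)⁻¹ ^ N)) :
    w * ENNReal.ofReal (max 1 ((2:ℝ) ^ k / (2:ℝ) ^ j) ^ a) *
      (2:ℝ≥0∞) ^ ((j:ℝ) * s) ≤ ENNReal.ofReal C * (ker δ j k * (2:ℝ≥0∞) ^ ((k:ℝ) * s)) := by
  have e : (2:ℝ) ^ k / (2:ℝ) ^ j = (2:ℝ) ^ ((k:ℝ) - j) := by
    rw [Real.rpow_sub (by norm_num), Real.rpow_natCast, Real.rpow_natCast]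
  rw [e] at h1 h2 ⊢
  unfold ker
  simp only [two_rpow]
  rw [← ENNReal.ofReal_mul (by positivity), ← ENNReal.ofReal_mul hC]
  rcases le_or_gt k j with hk | hk
  · have hk' : (k:ℝ) ≤ j := by exact_mod_cast hk
    have hmax : max 1 ((2:ℝ) ^ ((k:ℝ) - j)) = 1 :=
      max_eq_left (Real.rpow_le_one_of_one_le_of_nonpos (by norm_num) (by linarith))
    rw [hmax, Real.one_rpow, ENNReal.ofReal_one, mul_one]
    refine (mul_le_mul_left (h1 hk) _).trans ?_
    rw [← ENNReal.ofReal_mul (by positivity), mul_assoc]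
    apply ENNReal.ofReal_le_ofReal
    apply mul_le_mul_of_nonneg_left _ hC
    rw [← Real.rpow_natCast, ← Real.rpow_mul (by norm_num), ← Real.rpow_add (by norm_num), ← Real.rpow_add (by norm_num)]
    apply Real.rpow_le_rpow_of_exponent_le (by norm_num)
    rw [abs_of_nonneg (by linarith)]
    nlinarith
  · have hk' : (j:ℝ) < k := by exact_mod_cast hk
    have hmax : max 1 ((2:ℝ) ^ ((k:ℝ) - j)) = (2:ℝ) ^ ((k:ℝ) - j) :=
      max_eq_right (Real.one_le_rpow (by norm_num) (by linarith))
    rw [hmax, mul_assoc]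
    refine (mul_le_mul_left (h2 hk) _).trans ?_
    rw [← ENNReal.ofReal_mul (by positivity), ← ENNReal.ofReal_mul (by positivity), mul_assoc]
    apply ENNReal.ofReal_le_ofReal
    apply mul_le_mul_of_nonneg_left _ hC
    rw [← Real.rpow_neg (by norm_num), ← Real.rpow_natCast, ← Real.rpow_mul (by norm_num), ← Real.rpow_mul (by norm_num), ← Real.rpow_add (by norm_num),
      ← Real.rpow_add (by norm_num), ← Real.rpow_add (by norm_num)]
    apply Real.rpow_le_rpow_of_exponent_le (by norm_num)
    rw [abs_of_neg (by linarith)]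
    nlinarith
end Sub
end

noncomputable section
open MeasureTheory Filter Metric Real Set SchwartzMap
open scoped ENNReal NNReal Topology FourierTransform
namespace Sub
variable {n : ℕ}

def Fm (Ψ ψ : Sch n) (j : ℕ) : Sch n := if j = 0 then Ψ else ψ

def Bf (Ψ ψ : Sch n) (j : ℕ) : Sch n := dilate (Fm Ψ ψ j) ((2:ℝ) ^ j)⁻¹

lemma Bf_apply (Ψ ψ : Sch n) (j : ℕ) (x : Rn n) : Bf Ψ ψ j x = Fm Ψ ψ j (((2:ℝ) ^ j)⁻¹ • x) :=
  dilate_apply _ (by positivity) x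

lemma exists_chi {φ : ℕ → Sch n} (hφ : SmoothResolution n φ) : ∃ χ χ' : Sch n,
    tsupport χ ⊆ closedBall 0 3 ∧ tsupport χ' ⊆ closedBall 0 3 ∧ (∀ x ∈ tsupport χ', 2 / 8 ≤ ‖x‖) ∧
    (∀ k, φ k = mulS (dilate χ ((2:ℝ) ^ k)⁻¹) (φ k)) ∧
    (∀ k, φ k = mulS (dilate (Fm χ χ' k) ((2:ℝ) ^ k)⁻¹) (φ k)) := by
  obtain ⟨χ, χ', h1, h2, h3, h4, h5⟩ := exists_bump_pair n (r := 2) (R := 3) (by norm_num) (by norm_num) (κ := 8) (by norm_num)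
  have key : ∀ k x, φ k x ≠ 0 → ‖((2:ℝ) ^ k)⁻¹ • x‖ ≤ 2 := by
    intro k x hx
    have := supp_le hφ hx
    rw [norm_smul, norm_inv, norm_pow, Real.norm_of_nonneg (by norm_num : (0:ℝ) ≤ 2), inv_mul_le_iff₀ (by positivity)]
    linarith
  refine ⟨χ, χ', h2, h4, h5, fun k => ?_, fun k => ?_⟩
  · ext x
    rw [mulS_apply, dilate_apply _ (by positivity)]
    by_cases hx : φ k x = 0
    · simp [hx]
    · rw [h1 _ (key k x hx), one_mul]
  · ext x
    rw [mulS_apply, dilate_apply _ (by positivity)]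
    by_cases hx : φ k x = 0
    · simp [hx]
    · unfold Fm
      split_ifs with hk
      · rw [h1 _ (key k x hx), one_mul]
      · rw [h3, h1 _ (key k x hx), zero_of_tsupp h2, sub_zero, one_mul]
        have := supp_ge hφ (Nat.pos_of_ne_zero hk) hx
        rw [norm_smul, norm_smul, norm_inv, norm_pow, Real.norm_of_nonneg (by norm_num : (0:ℝ) ≤ 2)]
        have h6 : (1:ℝ)/2 ≤ (2 ^ k)⁻¹ * ‖x‖ := by
          rw [← div_eq_inv_mul, le_div_iff₀ (by positivity)]; linarith
        rw [Real.norm_of_nonneg (by norm_num : (0:ℝ) ≤ 8)]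
        linarith

lemma stepC_W {a s : ℝ} {L : ℕ} {δ : ℝ} (hδ : δ ≤ L - s) {Ψ ψ : Sch n}
    (h : ∀ l < L, iteratedFDeriv ℝ l ψ 0 = 0) {χ χ' : Sch n} (h1 : tsupport χ ⊆ closedBall 0 3)
    (h2 : tsupport χ' ⊆ closedBall 0 3) (h3 : ∀ x ∈ tsupport χ', 2 / 8 ≤ ‖x‖) :
    ∃ C : ℝ≥0∞, C ≠ ∞ ∧ ∀ j k : ℕ,
      W a (mulS (dilate (Fm Ψ ψ j) ((2:ℝ) ^ k / (2:ℝ) ^ j)) (Fm χ χ' k)) *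
        ENNReal.ofReal (max 1 ((2:ℝ) ^ k / (2:ℝ) ^ j) ^ a) *
      (2:ℝ≥0∞) ^ ((j:ℝ) * s) ≤ C * (ker δ j k * (2:ℝ≥0∞) ^ ((k:ℝ) * s)) := by
  obtain ⟨N, hN⟩ := exists_nat_ge (a - s + δ)
  obtain ⟨c1, hc1, k1⟩ := T1 a h χ h1
  obtain ⟨c2, hc2, k2⟩ := T1 a h χ' h2
  obtain ⟨c3, hc3, k3⟩ := T1 a (L := 0) (ψ := Ψ) (by simp) χ h1
  obtain ⟨c4, hc4, k4⟩ := T2 a ψ χ' (by norm_num) h2 h3 N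
  obtain ⟨c5, hc5, k5⟩ := T2 a Ψ χ' (by norm_num) h2 h3 N
  refine ⟨ENNReal.ofReal (c1 + c2 + c3 + c4 + c5), by simp, fun j k => ?_⟩
  have ht : (0:ℝ) < (2:ℝ) ^ k / (2:ℝ) ^ j := by positivity
  refine hW_of hδ hN (by positivity) (fun hk => ?_) fun hk => ?_
  · have ht1 : (2:ℝ) ^ k / (2:ℝ) ^ j ≤ 1 := by
      rw [div_le_one (by positivity)]; exact pow_le_pow_right₀ (by norm_num) hk
    by_cases hj : j = 0
    · subst hj
      obtain rfl : k = 0 := by omega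
      simp only [Fm, if_true]
      refine (k3 _ ht ht1).trans (ENNReal.ofReal_le_ofReal ?_)
      simp; linarith
    · simp only [Fm, hj, if_false]
      split_ifs
      · refine (k1 _ ht ht1).trans (ENNReal.ofReal_le_ofReal ?_)
        gcongr; linarith
      · refine (k2 _ ht ht1).trans (ENNReal.ofReal_le_ofReal ?_)
        gcongr; linarith
  · have ht1 : 1 ≤ (2:ℝ) ^ k / (2:ℝ) ^ j := by
      rw [one_le_div (by positivity)]; exact pow_le_pow_right₀ (by norm_num) hk.le
    have hk0 : k ≠ 0 := by omega
    simp only [Fm, hk0, if_false]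
    split_ifs
    · refine (k5 _ ht1).trans (ENNReal.ofReal_le_ofReal ?_)
      gcongr; linarith
    · refine (k4 _ ht1).trans (ENNReal.ofReal_le_ofReal ?_)
      gcongr; linarith

lemma exists_div {χ ψ : Sch n} {R : ℝ} (hχ : tsupport χ ⊆ closedBall 0 R) (hψ : ∀ x ∈ tsupport χ, ψ x ≠ 0) :
    ∃ l : Sch n, (∀ x, l x * ψ x = χ x) ∧ tsupport l ⊆ tsupport χ := by
  have hs : tsupport (fun x => χ x / ψ x) ⊆ tsupport χ := by
    apply closure_mono
    intro x hx
    rw [Function.mem_support] at hx ⊢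
    intro h; apply hx; rw [h, zero_div]
  have hc : HasCompactSupport (fun x => χ x / ψ x) :=
    (isCompact_closedBall (0 : Rn n) R).of_isClosed_subset (isClosed_tsupport _) (hs.trans hχ)
  have hd : ContDiff ℝ ((⊤:ℕ∞):WithTop ℕ∞) (fun x => χ x / ψ x) := by
    rw [contDiff_iff_contDiffAt]
    intro x
    by_cases hx : x ∈ tsupport χ
    · simp only [div_eq_mul_inv]
      exact ContDiffAt.mul (χ.smooth ⊤).contDiffAt (ContDiffAt.inv (ψ.smooth ⊤).contDiffAt (hψ x hx))
    · have hx' : x ∉ tsupport (fun x => χ x / ψ x) := fun h => hx (hs h)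
      have := notMem_tsupport_iff_eventuallyEq.1 hx'
      exact (contDiffAt_const (c := (0:ℂ))).congr_of_eventuallyEq this
  refine ⟨hc.toSchwartzMap hd, fun x => ?_, hs⟩
  show χ x / ψ x * ψ x = χ x
  by_cases hx : χ x = 0
  · simp [hx]
  · rw [div_mul_cancel₀ _ (hψ x (subset_tsupport _ hx))]

lemma W_zero (a : ℝ) : W a (0 : Sch n) = 0 := by
  unfold W
  have : (𝓕⁻ (0 : Sch n) : Sch n) = 0 := by
    exact map_zero (FourierTransform.fourierCLE ℂ (Sch n)).symm
  rw [this]; simp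

lemma W_phi (a : ℝ) {φ : ℕ → Sch n} (hφ : SmoothResolution n φ) (l : Sch n) {R T : ℝ} (hT : 0 ≤ T)
    (hl : tsupport l ⊆ closedBall 0 R) : ∃ D, 0 ≤ D ∧ ∀ j k : ℕ, (2:ℝ) ^ k / (2:ℝ) ^ j ≤ T →
      W a (mulS (dilate (φ j) ((2:ℝ) ^ k)) l) ≤ ENNReal.ofReal D := by
  obtain ⟨L, C, hC, h⟩ := W_dilate a l hl
  choose c hc hb using resol_iter hφ
  have hnn : ∀ i ∈ Finset.range (L+1), 0 ≤ c i * T ^ i := fun i _ => mul_nonneg (hc i) (by positivity)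
  refine ⟨C * ∑ i ∈ Finset.range (L+1), c i * T ^ i, mul_nonneg hC (Finset.sum_nonneg hnn), fun j k hjk => ?_⟩
  refine h (φ j) _ (by positivity) _ (Finset.sum_nonneg hnn) fun i hi x hx => ?_
  refine le_trans ?_ (Finset.single_le_sum (f := fun i => c i * T ^ i) hnn (Finset.mem_range.2 (by omega : i < L + 1)))
  calc _ ≤ ((2:ℝ) ^ k) ^ i * (c i * ((2:ℝ) ^ j)⁻¹ ^ i) := by gcongr; exact hb i j _
    _ = c i * ((2:ℝ) ^ k / 2 ^ j) ^ i := by rw [div_eq_mul_inv, mul_pow]; ring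
    _ ≤ _ := by have := hc i; gcongr

lemma stepD_W (a s : ℝ) {ε : ℝ} (hε : 0 < ε) {φ : ℕ → Sch n} (hφ : SmoothResolution n φ) {l l' : Sch n}
    (h1 : tsupport l ⊆ closedBall 0 (2 * ε)) (h2 : tsupport l' ⊆ closedBall 0 (2 * ε))
    (h3 : ∀ x ∈ tsupport l', ε / 2 ≤ ‖x‖) :
    ∃ C : ℝ≥0∞, C ≠ ∞ ∧ ∀ j k : ℕ,
      W a (mulS (dilate (φ j) ((2:ℝ) ^ k)) (Fm l l' k)) *
        ENNReal.ofReal (max 1 ((2:ℝ) ^ k / (2:ℝ) ^ j) ^ a) *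
      (2:ℝ≥0∞) ^ ((j:ℝ) * s) ≤ C * (ker 1 j k * (2:ℝ≥0∞) ^ ((k:ℝ) * s)) := by
  obtain ⟨N, hN⟩ := exists_nat_ge (a - s + 1)
  obtain ⟨L, hL⟩ := exists_nat_ge (1 + s)
  set T := max 1 (4 / ε) with hT
  have hT0 : 0 < T := lt_of_lt_of_le one_pos (le_max_left _ _)
  set ρ := min 1 (1 / (4 * ε)) with hρ
  have hρ0 : 0 < ρ := lt_min one_pos (by positivity)
  obtain ⟨D1, hD1, k1⟩ := W_phi a hφ l hT0.le h1
  obtain ⟨D2, hD2, k2⟩ := W_phi a hφ l' hT0.le h2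
  have hD : 0 ≤ D1 + D2 := add_nonneg hD1 hD2
  refine ⟨ENNReal.ofReal ((D1 + D2) * ρ⁻¹ ^ L + (D1 + D2) * T ^ N), by simp, fun j k => ?_⟩
  set t := (2:ℝ) ^ k / (2:ℝ) ^ j with ht'
  have ht : 0 < t := by positivity
  by_cases hz : mulS (dilate (φ j) ((2:ℝ) ^ k)) (Fm l l' k) = 0
  · rw [hz, W_zero]; simp
  have hex : ∃ x, φ j ((2:ℝ) ^ k • x) ≠ 0 ∧ Fm l l' k x ≠ 0 := by
    by_contra hcon
    push Not at hcon
    apply hz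
    ext x
    rw [mulS_apply, dilate_apply _ (by positivity)]
    by_cases hx : φ j ((2:ℝ) ^ k • x) = 0
    · simp [hx]
    · simp [hcon x hx]
  obtain ⟨x, hx1, hx2⟩ := hex
  have hxn : ‖(2:ℝ) ^ k • x‖ = 2 ^ k * ‖x‖ := by rw [norm_smul]; simp
  have hxu : ‖x‖ ≤ 2 * ε := by
    unfold Fm at hx2
    split_ifs at hx2
    · exact mem_closedBall_zero_iff.1 (h1 (subset_tsupport _ hx2))
    · exact mem_closedBall_zero_iff.1 (h2 (subset_tsupport _ hx2))
  have htT : t ≤ T := by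
    by_cases hk : k = 0
    · refine le_trans ?_ (le_max_left _ _)
      rw [ht', div_le_one (by positivity)]
      exact pow_le_pow_right₀ (by norm_num) (by omega)
    · refine le_trans ?_ (le_max_right _ _)
      simp only [Fm, hk, if_false] at hx2
      have h5 := h3 x (subset_tsupport _ hx2)
      have h4 := supp_le hφ hx1
      rw [hxn] at h4
      rw [ht', div_le_div_iff₀ (by positivity) hε]
      have := mul_le_mul_of_nonneg_left h5 (show (0:ℝ) ≤ 2 ^ k by positivity)
      linarith
  have htρ : ρ ≤ t := by
    by_cases hj : j = 0
    · refine (min_le_left _ _).trans ?_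
      rw [ht', one_le_div (by positivity)]
      exact pow_le_pow_right₀ (by norm_num) (by omega)
    · refine (min_le_right _ _).trans ?_
      have h4 := supp_ge hφ (Nat.pos_of_ne_zero hj) hx1
      rw [hxn] at h4
      rw [ht', div_le_div_iff₀ (by positivity) (by positivity)]
      have := mul_le_mul_of_nonneg_left hxu (show (0:ℝ) ≤ 2 ^ k by positivity)
      linarith
  have hWle : W a (mulS (dilate (φ j) ((2:ℝ) ^ k)) (Fm l l' k)) ≤ ENNReal.ofReal (D1 + D2) := by
    unfold Fm
    split_ifs
    · exact (k1 j k htT).trans (ENNReal.ofReal_le_ofReal (by linarith))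
    · exact (k2 j k htT).trans (ENNReal.ofReal_le_ofReal (by linarith))
  refine hW_of (L := L) (by linarith) hN (by positivity) (fun _ => hWle.trans (ENNReal.ofReal_le_ofReal ?_))
    fun _ => hWle.trans (ENNReal.ofReal_le_ofReal ?_)
  · have h6 : 1 ≤ ρ⁻¹ ^ L * t ^ L := by
      rw [← mul_pow]; apply one_le_pow₀
      rw [← div_eq_inv_mul, one_le_div hρ0]; exact htρ
    have h7 : 0 ≤ (D1 + D2) * T ^ N * t ^ L := by positivity
    nlinarith
  · have h6 : 1 ≤ T ^ N * t⁻¹ ^ N := by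
      rw [← mul_pow]; apply one_le_pow₀
      rw [← div_eq_mul_inv, one_le_div ht]; exact htT
    have h7 : 0 ≤ (D1 + D2) * ρ⁻¹ ^ L * t⁻¹ ^ N := by positivity
    nlinarith

section
variable {E : Type*} [NormedAddCommGroup E] [NormedSpace ℂ E]

lemma stepC {p q : ℝ≥0∞} (hp : 0 < p) (hp' : p ≠ ∞) (hq : 0 < q) {a : ℝ} (ha : 0 ≤ a) {s : ℝ} {L : ℕ} (hL : s < L)
    {φ : ℕ → Sch n} (hφ : SmoothResolution n φ) {Ψ ψ : Sch n}
    (h : ∀ l < L, iteratedFDeriv ℝ l ψ 0 = 0) :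
    ∃ C : ℝ≥0∞, C ≠ ∞ ∧ ∀ f : TDist n E, pN s p q a (Bf Ψ ψ) f ≤ C * pN s p q a φ f := by
  obtain ⟨χ, χ', h1, h2, h3, -, h5⟩ := exists_chi hφ
  obtain ⟨C, hC, hW⟩ := stepC_W (a := a) (s := s) (δ := L - s) le_rfl (Ψ := Ψ) h h1 h2 h3
  refine transfer_norm hp hp' hq ha s (by linarith : 0 < L - s) _ _ _ (fun j => ?_) hC hW
  have := sum_tendsto hφ (Bf Ψ ψ j)
  refine this.congr fun N => Finset.sum_congr rfl fun k _ => ?_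
  ext x
  have h6 : φ k x = dilate (Fm χ χ' k) ((2:ℝ) ^ k)⁻¹ x * φ k x := by
    conv_lhs => rw [h5 k, mulS_apply]
  rw [dilate_apply _ (by positivity)] at h6
  rw [mulS_apply, mulS_apply, dilate_apply _ (by positivity), mulS_apply, dilate_apply _ (by positivity), Bf_apply,
    smul_smul, mul_assoc, ← h6]
  congr 3
  field_simp

lemma stepD {p q : ℝ≥0∞} (hp : 0 < p) (hp' : p ≠ ∞) (hq : 0 < q) {a : ℝ} (ha : 0 ≤ a) (s : ℝ)
    {φ : ℕ → Sch n} (hφ : SmoothResolution n φ) {Ψ ψ : Sch n} {ε : ℝ} (hε : 0 < ε)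
    (hΨ : ∀ x : Rn n, ‖x‖ < 2 * ε → 0 < ‖Ψ x‖)
    (hψ : ∀ x : Rn n, ε / 2 < ‖x‖ → ‖x‖ < 2 * ε → 0 < ‖ψ x‖) :
    ∃ C : ℝ≥0∞, C ≠ ∞ ∧ ∀ f : TDist n E, pN s p q a φ f ≤ C * pN s p q a (Bf Ψ ψ) f := by
  obtain ⟨Θ, θ, h1, h2, h3, h4, h5⟩ := exists_bump_pair n (r := 3 / 2 * ε) (R := 7 / 4 * ε) (by positivity) (by linarith)
    (κ := 2) (by norm_num)
  obtain ⟨l, hl, hls⟩ := exists_div (ψ := Ψ) h2 fun x hx => by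
    have := mem_closedBall_zero_iff.1 (h2 hx)
    exact norm_pos_iff.1 (hΨ x (by linarith))
  obtain ⟨l', hl', hls'⟩ := exists_div (ψ := ψ) h4 fun x hx => by
    have := mem_closedBall_zero_iff.1 (h4 hx)
    have := h5 x hx
    exact norm_pos_iff.1 (hψ x (by linarith) (by linarith))
  have hsub : closedBall (0 : Rn n) (7 / 4 * ε) ⊆ closedBall 0 (2 * ε) := closedBall_subset_closedBall (by linarith)
  obtain ⟨C, hC, hW⟩ := stepD_W a s hε hφ ((hls.trans h2).trans hsub) ((hls'.trans h4).trans hsub)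
    fun x hx => by have := h5 x (hls' hx); linarith
  refine transfer_norm hp hp' hq ha s one_pos _ _ _ (fun j => ?_) hC hW
  have hmul : ∀ k x, Fm l l' k x * Fm Ψ ψ k x = Fm Θ θ k x := by
    intro k x; unfold Fm; split_ifs
    · exact hl x
    · exact hl' x
  have htel : ∀ N x, ∑ k ∈ Finset.range (N+1), Fm Θ θ k (((2:ℝ) ^ k)⁻¹ • x) = Θ (((2:ℝ) ^ N)⁻¹ • x) := by
    intro N x
    induction N with
    | zero => simp [Fm]
    | succ N ih =>
      rw [Finset.sum_range_succ, ih]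
      simp only [Fm, Nat.succ_ne_zero, if_false, Nat.add_eq_zero_iff, one_ne_zero, and_false]
      rw [h3, smul_smul]
      have : (2:ℝ) * (2 ^ (N+1))⁻¹ = (2 ^ N)⁻¹ := by rw [pow_succ]; field_simp
      rw [this]; ring
  obtain ⟨N0, hN0⟩ := pow_unbounded_of_one_lt (2 * 2 ^ j / (3 / 2 * ε)) (by norm_num : (1:ℝ) < 2)
  refine tendsto_const_nhds.congr' ?_
  filter_upwards [eventually_gt_atTop N0] with N hN
  obtain ⟨m, rfl⟩ : ∃ m, N = m + 1 := ⟨N - 1, by omega⟩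
  ext x
  rw [SchwartzMap.sum_apply]
  have e : ∀ k, mulS (dilate (mulS (dilate (φ j) ((2:ℝ) ^ k)) (Fm l l' k)) ((2:ℝ) ^ k)⁻¹) (Bf Ψ ψ k) x =
      φ j x * Fm Θ θ k (((2:ℝ) ^ k)⁻¹ • x) := by
    intro k
    rw [mulS_apply, dilate_apply _ (by positivity), mulS_apply, dilate_apply _ (by positivity), Bf_apply,
      smul_smul, mul_inv_cancel₀ (by positivity), one_smul, mul_assoc, hmul]
  simp only [e]
  rw [← Finset.mul_sum, htel]
  by_cases hx : φ j x = 0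
  · simp [hx]
  · rw [h1, mul_one]
    have h6 := supp_le hφ hx
    have h7 : (2:ℝ) ^ N0 ≤ 2 ^ m := pow_le_pow_right₀ (by norm_num) (by omega)
    rw [norm_smul, norm_inv, norm_pow, Real.norm_of_nonneg (by norm_num : (0:ℝ) ≤ 2), inv_mul_le_iff₀ (by positivity)]
    rw [div_lt_iff₀ (by positivity)] at hN0
    have := mul_le_mul_of_nonneg_right h7 (show 0 ≤ 3 / 2 * ε by positivity)
    linarith

lemma tpn_eq (s : ℝ) (p q : ℝ≥0∞) (a : ℝ) (Ψ ψ : Sch n) (f : TDist n E) :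
    triebelPeetreNorm s p q a Ψ ψ f = lpNormENN p (peetreMax a (2 ^ 0) (mOp (Bf Ψ ψ 0) f)) +
      lpNormENN p fun x => lqSum q fun j => (2:ℝ≥0∞) ^ (((j+1 : ℕ):ℝ) * s) *
        peetreMax a (2 ^ (j+1)) (mOp (Bf Ψ ψ (j+1)) f) x := by
  have h0 : Bf Ψ ψ 0 = Ψ := by ext x; rw [Bf_apply]; simp [Fm]
  have h1 : ∀ j : ℕ, Bf Ψ ψ (j+1) = dilate ψ ((2 : ℝ) ^ (-((j : ℝ) + 1))) := by
    intro j
    have : (2 : ℝ) ^ (-((j : ℝ) + 1)) = (2 ^ (j+1))⁻¹ := by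
      rw [Real.rpow_neg (by norm_num)]
      norm_cast
    rw [this]; simp [Bf, Fm]
  have h2 : ∀ j : ℕ, (2 : ℝ) ^ ((j : ℝ) + 1) = 2 ^ (j+1) := by intro j; norm_cast
  unfold triebelPeetreNorm
  simp only [h0, h1, h2, pow_zero, Nat.cast_add, Nat.cast_one]

lemma pN_le_tpn {p q : ℝ≥0∞} (hp : 0 < p) (hp' : p ≠ ∞) (hq : 0 < q) (a s : ℝ) (Ψ ψ : Sch n) :
    ∃ C : ℝ≥0∞, C ≠ ∞ ∧ ∀ f : TDist n E, pN s p q a (Bf Ψ ψ) f ≤ C * triebelPeetreNorm s p q a Ψ ψ f := by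
  obtain ⟨C1, hC1, k1⟩ := lqSum_split hq
  obtain ⟨C2, hC2, k2⟩ := lp_add (n := n) hp hp'
  refine ⟨C1 * C2, ENNReal.mul_ne_top hC1 hC2, fun f => ?_⟩
  rw [tpn_eq, mul_assoc]
  have hm := pm_meas (a := a) (t := 2 ^ 0) (by positivity) (mOp_cont (Bf Ψ ψ 0) f)
  refine le_trans ?_ (mul_le_mul_right (k2 _ _ hm) C1)
  rw [← lp_mul hp hp' hC1]
  unfold pN
  refine lp_mono hp' fun x => ?_
  refine (k1 _).trans (le_of_eq ?_)
  simp

lemma tpn_le_pN {p q : ℝ≥0∞} (hp' : p ≠ ∞) (hq : 0 < q) (a s : ℝ) (Ψ ψ : Sch n) (f : TDist n E) :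
    triebelPeetreNorm s p q a Ψ ψ f ≤ 2 * pN s p q a (Bf Ψ ψ) f := by
  rw [tpn_eq, two_mul]
  unfold pN
  refine add_le_add (lp_mono hp' fun x => ?_) (lp_mono hp' fun x => ?_)
  · have := le_lqSum hq (fun j : ℕ => (2:ℝ≥0∞) ^ ((j:ℝ) * s) * peetreMax a (2 ^ j) (mOp (Bf Ψ ψ j) f) x) 0
    simpa using this
  · exact lqSum_shift_le (fun j : ℕ => (2:ℝ≥0∞) ^ ((j:ℝ) * s) * peetreMax a (2 ^ j) (mOp (Bf Ψ ψ j) f) x)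

lemma tn_le_pN {p q : ℝ≥0∞} (hp' : p ≠ ∞) (a s : ℝ) (φ : ℕ → Sch n) (f : TDist n E) :
    triebelNorm s p q φ f ≤ pN s p q a φ f := by
  unfold pN triebelNorm
  refine lp_mono hp' fun x => lqSum_mono fun j => ?_
  exact mul_le_mul_right (le_pm0 (by positivity) _ x) _

end
end Sub

variable {n : ℕ} {E : Type*} [NormedAddCommGroup E] [NormedSpace ℂ E]
variable {n : ℕ} {E : Type*} [NormedAddCommGroup E] [NormedSpace ℂ E]

/-- characterization of `F^s_{p,q}(E)` via the Peetre maximal functions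
for `a > n/min(p,q)`. -/
theorem statement3 (n : ℕ) (E : Type*) [NormedAddCommGroup E] [NormedSpace ℂ E]
    [CompleteSpace E] (s : ℝ) (p q : ℝ≥0∞) (hp : 0 < p) (hp' : p ≠ ∞) (hq : 0 < q)
    (a : ℝ) (ha : (n : ℝ) / (min p q).toReal < a)
    (S : ℤ) (hS : -1 ≤ S) (hSs : ⌊s⌋ ≤ S)
    (ε : ℝ) (hε : 0 < ε) (Ψ ψ : Sch n)
    (hΨ : ∀ x : Rn n, ‖x‖ < 2 * ε → 0 < ‖Ψ x‖)
    (hψ : ∀ x : Rn n, ε / 2 < ‖x‖ → ‖x‖ < 2 * ε → 0 < ‖ψ x‖)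
    (hmom : ∀ α : Fin n → ℕ, (mdeg α : ℤ) ≤ S → mderiv α (fun y => ψ y) 0 = 0)
    (φ : ℕ → Sch n) (hφ : SmoothResolution n φ) :
    (∃ c₁ > (0 : ℝ), ∃ c₂ > (0 : ℝ), ∀ f : TDist n E, triebelNorm s p q φ f < ∞ →
      ENNReal.ofReal c₁ * triebelNorm s p q φ f ≤ triebelPeetreNorm s p q a Ψ ψ f ∧
        triebelPeetreNorm s p q a Ψ ψ f ≤ ENNReal.ofReal c₂ * triebelNorm s p q φ f) ∧
    ∀ f : TDist n E, triebelNorm s p q φ f < ∞ ↔ triebelPeetreNorm s p q a Ψ ψ f < ∞ := by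
  have ha0 : 0 ≤ a := le_trans (by positivity) ha.le
  have hL : s < ((S + 1).toNat : ℕ) := by
    have h1 : (((S + 1).toNat : ℕ) : ℤ) = S + 1 := Int.toNat_of_nonneg (by omega)
    have h2 : s < ((S + 1 : ℤ) : ℝ) := Int.floor_lt.1 (by omega)
    calc s < ((S + 1 : ℤ) : ℝ) := h2
      _ = ((((S + 1).toNat : ℕ) : ℤ) : ℝ) := by rw [h1]
      _ = _ := Int.cast_natCast _
  have hm : ∀ l < (S + 1).toNat, iteratedFDeriv ℝ l ψ 0 = 0 := fun l hl =>
    Sub.iter_zero_of_mom hmom (by omega)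
  obtain ⟨χ, _, _, _, _, hχ, _⟩ := Sub.exists_chi hφ
  obtain ⟨CA, hCA, kA⟩ := Sub.stepA (E := E) hp hp' hq a ha s φ χ hχ
  obtain ⟨CC, hCC, kC⟩ := Sub.stepC (E := E) hp hp' hq ha0 hL hφ (Ψ := Ψ) hm
  obtain ⟨CD, hCD, kD⟩ := Sub.stepD (E := E) hp hp' hq ha0 s hφ hε hΨ hψ
  obtain ⟨CF, hCF, kF⟩ := Sub.pN_le_tpn (E := E) hp hp' hq a s Ψ ψ
  have up : ∃ C : ℝ≥0∞, C ≠ ∞ ∧ ∀ f : TDist n E, triebelPeetreNorm s p q a Ψ ψ f ≤ C * triebelNorm s p q φ f := by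
    refine ⟨2 * (CC * CA), ENNReal.mul_ne_top (by simp) (ENNReal.mul_ne_top hCC hCA), fun f => ?_⟩
    refine (Sub.tpn_le_pN hp' hq a s Ψ ψ f).trans ?_
    rw [mul_assoc, mul_assoc]
    exact mul_le_mul_right ((kC f).trans (mul_le_mul_right (kA f) _)) _
  have lo : ∃ C : ℝ≥0∞, C ≠ ∞ ∧ ∀ f : TDist n E, triebelNorm s p q φ f ≤ C * triebelPeetreNorm s p q a Ψ ψ f := by
    refine ⟨CD * CF, ENNReal.mul_ne_top hCD hCF, fun f => ?_⟩
    refine (Sub.tn_le_pN hp' a s φ f).trans ((kD f).trans ?_)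
    rw [mul_assoc]
    exact mul_le_mul_right (kF f) _
  obtain ⟨C1, hC1, k1⟩ := up
  obtain ⟨C2, hC2, k2⟩ := lo
  refine ⟨⟨(C2.toReal + 1)⁻¹, by positivity, C1.toReal + 1, by positivity, fun f _ => ⟨?_, ?_⟩⟩, fun f => ⟨fun h => ?_, fun h => ?_⟩⟩
  · rw [ENNReal.ofReal_inv_of_pos (by positivity), ENNReal.inv_mul_le_iff (by simp; positivity) (by simp)]
    refine (k2 f).trans (mul_le_mul_left ?_ _)
    rw [← ENNReal.ofReal_toReal hC2]
    apply ENNReal.ofReal_le_ofReal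
    rw [ENNReal.ofReal_toReal hC2]; linarith
  · refine (k1 f).trans (mul_le_mul_left ?_ _)
    rw [← ENNReal.ofReal_toReal hC1]
    apply ENNReal.ofReal_le_ofReal
    rw [ENNReal.ofReal_toReal hC1]; linarith
  · exact (k1 f).trans_lt (ENNReal.mul_lt_top hC1.lt_top h)
  · exact (k2 f).trans_lt (ENNReal.mul_lt_top hC2.lt_top h)

end
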